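/- arXiv:1408.1491 — 4 statements merged into one kernel-verified Lean document; each statement's English description precedes it below -/
import Mathlib

section
/- Let 𝔤 be a finite-dimensional Lie algebra over the field ℝ of real numbers satisfying the condition 𝒜(n), i.e. every abelian Lie subalgebra of 𝔤 has dimension at most n. Then dim 𝔤 ≤ 4n² + 18n. -/
open Module TensorProduct

section
variable {K L : Type*} [Field K] [CharZero K] [LieRing L] [LieAlgebra K L]
  [LieAlgebra.IsSolvable L]

/-- Elements of the derived algebra of a solvable Lie algebra act nilpotently
(triangularizable case). -/
lemma isNilpotent_toEnd_of_mem_derivedSeries_one_of_isAlgClosed [IsAlgClosed K] (d : ℕ) :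
    ∀ (V : Type*) [AddCommGroup V] [Module K V] [LieRingModule L V] [LieModule K L V]
      [FiniteDimensional K V], finrank K V ≤ d →
      ∀ z ∈ LieAlgebra.derivedSeries K L 1, IsNilpotent (LieModule.toEnd K L V z) := by
  induction d with
  | zero =>
    intro V _ _ _ _ _ hV z _
    have : Subsingleton V := finrank_zero_iff.mp (Nat.le_zero.mp hV)
    exact ⟨1, by ext v; exact Subsingleton.elim _ _⟩
  | succ d ih =>
    intro V _ _ _ _ _ hV z hz
    rcases subsingleton_or_nontrivial V with _ | _
    · exact ⟨1, by ext v; exact Subsingleton.elim _ _⟩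
    obtain ⟨χ, hχ⟩ := LieModule.exists_nontrivial_weightSpace_of_isSolvable K L V
    obtain ⟨⟨v, hv⟩, hv0⟩ := exists_ne (0 : LieModule.weightSpace V χ)
    rw [LieModule.mem_weightSpace] at hv
    have hv0 : v ≠ 0 := by simpa using hv0
    let N : LieSubmodule K L V :=
      { Submodule.span K {v} with
        lie_mem := by
          intro x m hm
          obtain ⟨c, rfl⟩ := Submodule.mem_span_singleton.mp hm
          rw [lie_smul, hv]
          exact Submodule.smul_mem _ _
            (Submodule.smul_mem _ _ (Submodule.mem_span_singleton_self v)) }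
    have hvN : v ∈ N := Submodule.mem_span_singleton_self v
    have hzN : ∀ m ∈ N, ⁅z, m⁆ = 0 := by
      have hker : LieAlgebra.derivedSeries K L 1 ≤ LieModule.ker K L N := by
        rw [LieAlgebra.derivedSeries_def, LieAlgebra.derivedSeriesOfIdeal_succ,
          LieAlgebra.derivedSeriesOfIdeal_zero, LieSubmodule.lie_le_iff]
        intro x _ y _
        rw [LieModule.mem_ker]
        rintro ⟨m, hm⟩
        obtain ⟨c, rfl⟩ := Submodule.mem_span_singleton.mp hm
        ext
        change ⁅⁅x, y⁆, c • v⁆ = 0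
        rw [lie_smul, lie_lie, hv, hv, lie_smul, lie_smul, hv, hv, smul_comm, sub_self, smul_zero]
      intro m hm
      simpa using congrArg Subtype.val ((LieModule.mem_ker _ _ _ _).mp (hker hz) ⟨m, hm⟩)
    have hlt : finrank K (V ⧸ N) ≤ d := by
      have h1 := Submodule.finrank_quotient_add_finrank (N : Submodule K V)
      have h2 : 0 < finrank K (N : Submodule K V) := by
        have : Nontrivial (N : Submodule K V) := ⟨⟨v, hvN⟩, 0, by simpa using hv0⟩
        exact finrank_pos
      change finrank K (V ⧸ (N : Submodule K V)) ≤ d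
      omega
    obtain ⟨k, hk⟩ := ih (V ⧸ N) hlt z hz
    refine ⟨k + 1, ?_⟩
    ext m
    rw [pow_succ']
    apply hzN
    rw [← LieSubmodule.Quotient.mk_eq_zero]
    have : ∀ j : ℕ, (LieSubmodule.Quotient.mk' N) (((LieModule.toEnd K L V z) ^ j) m) =
        ((LieModule.toEnd K L (V ⧸ N) z) ^ j) (LieSubmodule.Quotient.mk' N m) := by
      intro j
      induction j with
      | zero => simp
      | succ j hj =>
        rw [pow_succ', pow_succ', Module.End.mul_apply, Module.End.mul_apply, ← hj]; rfl
    rw [this, hk]; rfl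

lemma isNilpotent_toEnd_of_mem_derivedSeries_one (V : Type*) [AddCommGroup V] [Module K V]
    [LieRingModule L V] [LieModule K L V] [FiniteDimensional K V] (z : L)
    (hz : z ∈ LieAlgebra.derivedSeries K L 1) : IsNilpotent (LieModule.toEnd K L V z) := by
  let A := AlgebraicClosure K
  have hz' : 1 ⊗ₜ[K] z ∈ LieAlgebra.derivedSeries A (A ⊗[K] L) 1 := by
    rw [LieAlgebra.derivedSeries_baseChange]
    exact Submodule.tmul_mem_baseChange_of_mem 1 hz
  have hinj : Function.Injective (End.baseChangeHom K A V) :=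
    LinearMap.baseChangeHom_injective K V A
  have aux : (LieModule.toEnd K L V z).baseChangeHom K A V =
      (LieModule.toEnd K L V z).baseChange A := rfl
  rw [← IsNilpotent.map_iff hinj, aux, ← LieModule.toEnd_baseChange]
  have : LieAlgebra.IsSolvable (A ⊗[K] L) := inferInstance
  exact isNilpotent_toEnd_of_mem_derivedSeries_one_of_isAlgClosed _ (A ⊗[K] V) le_rfl _ hz'
end

section NilpotentAction
variable {K L : Type*} [Field K] [LieRing L] [LieAlgebra K L]

lemma LieSubmodule.isNilpotent_quotient {V : Type*} [AddCommGroup V] [Module K V]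
    [LieRingModule L V]   [LieModule K L V] [LieModule.IsNilpotent L V] (N : LieSubmodule K L V) :
    LieModule.IsNilpotent L (V ⧸ N) := by
  refine Function.Surjective.lieModuleIsNilpotent (R := K) (f := LieHom.id (R := K) (L₁ := L))
    (g := (LieSubmodule.Quotient.mk' N : V →ₗ[K] V ⧸ N)) (fun _ _ => rfl) Function.surjective_id
    (LieSubmodule.Quotient.surjective_mk' N)

lemma LieSubmodule.isNilpotent_coe {V : Type*} [AddCommGroup V] [Module K V] [LieRingModule L V]
    [LieModule K L V] [LieModule.IsNilpotent L V] (N : LieSubmodule K L V) :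
    LieModule.IsNilpotent L N := by
  refine Function.Injective.lieModuleIsNilpotent (R := K) (f := LieHom.id (R := K) (L₁ := L))
    (g := (N.incl : N →ₗ[K] V)) (fun _ _ => rfl) Subtype.val_injective

/-- A Lie algebra acting nilpotently on a space of dimension `d` has dimension at most
`d.choose 2` modulo the kernel of the action. -/
lemma finrank_le_finrank_ker_add_choose [FiniteDimensional K L] (d : ℕ) :
    ∀ (V : Type*) [AddCommGroup V] [Module K V] [LieRingModule L V] [LieModule K L V]
      [FiniteDimensional K V] [LieModule.IsNilpotent L V], finrank K V = d →
      finrank K L ≤ finrank K (LieModule.ker K L V) + d.choose 2 := by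
  induction d with
  | zero =>
    intro V _ _ _ _ _ _ hV
    have : Subsingleton V := finrank_zero_iff.mp hV
    have : LieModule.ker K L V = ⊤ := by
      ext x; simp [LieModule.mem_ker, Subsingleton.elim _ (0 : V)]
    rw [this]
    change _ ≤ finrank K (⊤ : Submodule K L) + _
    rw [finrank_top]; omega
  | succ d ih =>
    intro V _ _ _ _ _ _ hV
    have : Nontrivial V := nontrivial_of_finrank_pos (R := K) (by omega)
    have := LieModule.nontrivial_max_triv_of_isNilpotent K L V
    obtain ⟨⟨v, hv⟩, hv0⟩ := exists_ne (0 : LieModule.maxTrivSubmodule K L V)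
    rw [LieModule.mem_maxTrivSubmodule] at hv
    have hv0 : v ≠ 0 := by simpa using hv0
    let N : LieSubmodule K L V :=
      { Submodule.span K {v} with
        lie_mem := by
          intro x m hm
          obtain ⟨c, rfl⟩ := Submodule.mem_span_singleton.mp hm
          rw [lie_smul, hv, smul_zero]
          exact Submodule.zero_mem _ }
    have hN1 : finrank K (N : Submodule K V) = 1 := finrank_span_singleton hv0
    have hNz : ∀ x : L, ∀ m ∈ N, ⁅x, m⁆ = 0 := by
      intro x m hm
      obtain ⟨c, rfl⟩ := Submodule.mem_span_singleton.mp hm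
      rw [lie_smul, hv, smul_zero]
    have hq : finrank K (V ⧸ (N : Submodule K V)) = d := by
      have h1 := Submodule.finrank_quotient_add_finrank (N : Submodule K V)
      omega
    have := N.isNilpotent_quotient
    have h1 := ih (V ⧸ N) hq
    have hmem : ∀ x : LieModule.ker K L (V ⧸ N), ∀ m : V, ⁅(x : L), m⁆ ∈ N := by
      intro x m
      rw [← LieSubmodule.Quotient.mk_eq_zero]
      exact (LieModule.mem_ker K L (V ⧸ N) (x : L)).mp x.2 (LieSubmodule.Quotient.mk' N m)
    let φ : LieModule.ker K L (V ⧸ N) →ₗ[K] ((V ⧸ (N : Submodule K V)) →ₗ[K] (N : Submodule K V)) :=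
      { toFun := fun x => (N : Submodule K V).liftQ
          ((LieModule.toEnd K L V x).codRestrict (N : Submodule K V) (hmem x))
          (fun m hm => by
            rw [LinearMap.mem_ker]
            ext
            exact hNz x m hm)
        map_add' := by
          intro x y
          ext m
          exact add_lie (x : L) (y : L) m
        map_smul' := by
          intro c x
          ext m
          exact smul_lie c (x : L) m }
    have h2 := LinearMap.finrank_range_add_finrank_ker φ
    have h3 : finrank K φ.range ≤ d := by
      refine (Submodule.finrank_le _).trans ?_
      rw [finrank_linearMap, hN1, hq, mul_one]
    have h4 : finrank K φ.ker ≤ finrank K (LieModule.ker K L V) := by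
      let ψ : φ.ker →ₗ[K] LieModule.ker K L V :=
        { toFun := fun x => ⟨x.1.1, by
            rw [LieModule.mem_ker]
            intro m
            have := congrArg Subtype.val (LinearMap.congr_fun ((LinearMap.mem_ker).mp x.2)
              ((N : Submodule K V).mkQ m))
            exact this⟩
          map_add' := fun x y => rfl
          map_smul' := fun c x => rfl }
      refine LinearMap.finrank_le_finrank_of_injective (f := ψ) ?_
      intro x y hxy
      exact Subtype.ext (Subtype.ext (congrArg (fun z : LieModule.ker K L V => (z : L)) hxy))
    have h5 : (d + 1).choose 2 = d + d.choose 2 := by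
      rw [Nat.choose_succ_succ' d 1, Nat.choose_one_right]
    omega


/-- An abelian ideal of maximal dimension of a nilpotent Lie algebra is its own centralizer. -/
lemma ker_le_of_isNilpotent_of_forall_finrank_le [FiniteDimensional K L] [LieRing.IsNilpotent L]
    (A : LieIdeal K L) (hab : ∀ x ∈ A, ∀ y ∈ A, ⁅x, y⁆ = 0)
    (hmax : ∀ B : LieIdeal K L, (∀ x ∈ B, ∀ y ∈ B, ⁅x, y⁆ = 0) → finrank K B ≤ finrank K A) :
    LieModule.ker K L A ≤ A := by
  have hker : ∀ z, z ∈ LieModule.ker K L A ↔ ∀ a ∈ A, ⁅z, a⁆ = 0 := by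
    intro z
    rw [LieModule.mem_ker]
    constructor
    · intro h a ha
      exact congrArg Subtype.val (h ⟨a, ha⟩)
    · rintro h ⟨a, ha⟩
      exact Subtype.ext (h a ha)
  by_contra hle
  obtain ⟨y, hy, hyA⟩ := SetLike.not_le_iff_exists.mp hle
  have hnil : LieModule.IsNilpotent L (L ⧸ A) := LieSubmodule.isNilpotent_quotient A
  let C : LieSubmodule K L (L ⧸ A) :=
    LieSubmodule.map (LieSubmodule.Quotient.mk' A) (LieModule.ker K L A)
  have hCnil : LieModule.IsNilpotent L C := C.isNilpotent_coe
  have hCnt : Nontrivial C := by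
    refine ⟨⟨⟨LieSubmodule.Quotient.mk' A y, LieSubmodule.mem_map_of_mem hy⟩, 0, ?_⟩⟩
    intro h
    apply hyA
    rw [← LieSubmodule.Quotient.mk_eq_zero]
    exact congrArg Subtype.val h
  have := LieModule.nontrivial_max_triv_of_isNilpotent K L C
  obtain ⟨⟨⟨z', hz'⟩, hz⟩, hz0⟩ := exists_ne (0 : LieModule.maxTrivSubmodule K L C)
  obtain ⟨z, hzC, rfl⟩ := (LieSubmodule.mem_map _).mp hz'
  have hzA : z ∉ A := by
    intro h
    apply hz0
    rw [← LieSubmodule.Quotient.mk_eq_zero] at h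
    exact Subtype.ext (Subtype.ext h)
  have hlie : ∀ x : L, ⁅x, z⁆ ∈ A := by
    intro x
    rw [← LieSubmodule.Quotient.mk_eq_zero]
    exact congrArg Subtype.val ((LieModule.mem_maxTrivSubmodule _ _ _ _).mp hz x)
  rw [hker] at hzC
  let B : LieIdeal K L :=
    { (A : Submodule K L) ⊔ Submodule.span K {z} with
      lie_mem := by
        intro x m hm
        obtain ⟨a, ha, b, hb, rfl⟩ := Submodule.mem_sup.mp hm
        obtain ⟨c, rfl⟩ := Submodule.mem_span_singleton.mp hb
        rw [lie_add, lie_smul]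
        exact Submodule.mem_sup_left (add_mem (A.lie_mem ha) (Submodule.smul_mem _ _ (hlie x))) }
  have hBab : ∀ x ∈ B, ∀ y ∈ B, ⁅x, y⁆ = 0 := by
    intro x hx y hy
    obtain ⟨a, ha, b, hb, rfl⟩ := Submodule.mem_sup.mp hx
    obtain ⟨c, rfl⟩ := Submodule.mem_span_singleton.mp hb
    obtain ⟨a', ha', b', hb', rfl⟩ := Submodule.mem_sup.mp hy
    obtain ⟨c', rfl⟩ := Submodule.mem_span_singleton.mp hb'
    have h1 : ⁅a, z⁆ = 0 := by rw [← lie_skew, hzC a ha, neg_zero]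
    simp [hab a ha a' ha', hzC a' ha', h1]
  have hlt : (A : Submodule K L) < (B : Submodule K L) := by
    refine lt_of_le_of_ne (le_sup_left (b := Submodule.span K {z})) ?_
    intro h
    apply hzA
    have : z ∈ (B : Submodule K L) :=
      Submodule.mem_sup_right (Submodule.mem_span_singleton_self z)
    rwa [← h] at this
  exact absurd (Submodule.finrank_lt_finrank_of_lt hlt) (not_lt.mpr (hmax B hBab))

lemma finrank_le_of_isNilpotent [FiniteDimensional K L] [LieRing.IsNilpotent L] (n : ℕ)
    (hA : ∀ H : LieSubalgebra K L, IsLieAbelian H → finrank K H ≤ n) :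
    finrank K L ≤ n + n.choose 2 := by
  let P : ℕ → Prop := fun d => ∃ A : LieIdeal K L, (∀ x ∈ A, ∀ y ∈ A, ⁅x, y⁆ = 0) ∧ finrank K A = d
  have hP0 : P 0 := by
    refine ⟨⊥, ?_, ?_⟩
    · intro x hx y hy
      rw [(LieSubmodule.mem_bot x).mp hx, zero_lie]
    · exact finrank_bot K L
  have hPn : ∀ d, P d → d ≤ n := by
    rintro d ⟨A, hab, rfl⟩
    refine hA (LieIdeal.toLieSubalgebra K L A) ⟨?_⟩
    rintro ⟨x, hx⟩ ⟨y, hy⟩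
    exact Subtype.ext (hab x hx y hy)
  classical
  obtain ⟨A, hab, hd⟩ := Nat.findGreatest_spec (P := P) (Nat.zero_le n) hP0
  have hmax : ∀ B : LieIdeal K L, (∀ x ∈ B, ∀ y ∈ B, ⁅x, y⁆ = 0) → finrank K B ≤ finrank K A := by
    intro B hB
    rw [hd]
    exact Nat.le_findGreatest (hPn _ ⟨B, hB, rfl⟩) ⟨B, hB, rfl⟩
  have hle := ker_le_of_isNilpotent_of_forall_finrank_le A hab hmax
  have hAnil : LieModule.IsNilpotent L A := LieSubmodule.isNilpotent_coe A
  have h1 := finrank_le_finrank_ker_add_choose _ A rfl (L := L) (K := K)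
  have h2 : finrank K (LieModule.ker K L A) ≤ finrank K A := 
    Submodule.finrank_mono (s := (LieModule.ker K L A : Submodule K L)) (t := (A : Submodule K L))
      hle
  have h3 : finrank K A ≤ n := hPn _ ⟨A, hab, rfl⟩
  have h4 := Nat.choose_le_choose 2 h3
  omega

end NilpotentAction

section SolvableBound
variable {K L : Type*} [Field K] [CharZero K] [LieRing L] [LieAlgebra K L]
  [LieAlgebra.IsSolvable L] [FiniteDimensional K L]

omit [CharZero K] [LieAlgebra.IsSolvable L] [FiniteDimensional K L] in
lemma isNilpotent_toEnd_of_quotient {V : Type*} [AddCommGroup V] [Module K V] [LieRingModule L V]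
    [LieModule K L V] (N : LieSubmodule K L V) (x : L) (hN : ∀ m ∈ N, ⁅x, m⁆ = 0)
    (h : IsNilpotent (LieModule.toEnd K L (V ⧸ N) x)) : IsNilpotent (LieModule.toEnd K L V x) := by
  obtain ⟨k, hk⟩ := h
  refine ⟨k + 1, ?_⟩
  ext m
  rw [pow_succ']
  apply hN
  rw [← LieSubmodule.Quotient.mk_eq_zero]
  have : ∀ j : ℕ, (LieSubmodule.Quotient.mk' N) (((LieModule.toEnd K L V x) ^ j) m) =
      ((LieModule.toEnd K L (V ⧸ N) x) ^ j) (LieSubmodule.Quotient.mk' N m) := by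
    intro j
    induction j with
    | zero => simp
    | succ j hj => rw [pow_succ', pow_succ', Module.End.mul_apply, Module.End.mul_apply, ← hj]; rfl
  rw [this, hk]; rfl

/-- A solvable Lie algebra acting on `V` has an ideal of codimension at most `finrank K V`
containing the derived algebra and acting by nilpotent endomorphisms. -/
lemma exists_lieIdeal_forall_isNilpotent_toEnd (d : ℕ) :
    ∀ (V : Type*) [AddCommGroup V] [Module K V] [LieRingModule L V] [LieModule K L V]
      [FiniteDimensional K V], finrank K V ≤ d →
      ∃ T : LieIdeal K L, LieAlgebra.derivedSeries K L 1 ≤ T ∧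
        finrank K L ≤ finrank K T + finrank K V ∧
        ∀ x ∈ T, IsNilpotent (LieModule.toEnd K L V x) := by
  induction d with
  | zero =>
    intro V _ _ _ _ _ hV
    have : Subsingleton V := finrank_zero_iff.mp (Nat.le_zero.mp hV)
    refine ⟨⊤, le_top, ?_, fun x _ => ⟨1, by ext v; exact Subsingleton.elim _ _⟩⟩
    change finrank K L ≤ finrank K (⊤ : Submodule K L) + _
    rw [finrank_top]; omega
  | succ d ih =>
    intro V _ _ _ _ _ hV
    rcases subsingleton_or_nontrivial V with _ | _
    · refine ⟨⊤, le_top, ?_, fun x _ => ⟨1, by ext v; exact Subsingleton.elim _ _⟩⟩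
      change finrank K L ≤ finrank K (⊤ : Submodule K L) + _
      rw [finrank_top]; omega
    let D := LieAlgebra.derivedSeries K L 1
    have hlieD : ∀ x y : L, ⁅x, y⁆ ∈ D := by
      intro x y
      change _ ∈ LieAlgebra.derivedSeries K L 1
      rw [LieAlgebra.derivedSeries_def, LieAlgebra.derivedSeriesOfIdeal_succ,
          LieAlgebra.derivedSeriesOfIdeal_zero]
      exact LieSubmodule.lie_mem_lie (LieSubmodule.mem_top _) (LieSubmodule.mem_top _)
    have hDnil : LieModule.IsNilpotent D V := by
      rw [LieModule.isNilpotent_iff_forall' (R := K)]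
      rintro ⟨x, hx⟩
      exact isNilpotent_toEnd_of_mem_derivedSeries_one V x hx
    have := LieModule.nontrivial_max_triv_of_isNilpotent K D V
    obtain ⟨⟨w, hw⟩, hw0⟩ := exists_ne (0 : LieModule.maxTrivSubmodule K D V)
    rw [LieModule.mem_maxTrivSubmodule] at hw
    have hw0 : w ≠ 0 := by simpa using hw0
    let VD : LieSubmodule K L V :=
      { carrier := {v | ∀ x ∈ D, ⁅x, v⁆ = 0}
        add_mem' := fun {a b} ha hb x hx => by rw [lie_add, ha x hx, hb x hx, add_zero]
        zero_mem' := fun x _ => lie_zero x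
        smul_mem' := fun c a ha x hx => by rw [lie_smul, ha x hx, smul_zero]
        lie_mem := fun {x m} hm y hy => by
          rw [leibniz_lie, hm y hy, hm _ (hlieD y x), lie_zero, add_zero] }
    let Z : L → LieSubmodule K L V := fun z => 
      { carrier := {v | v ∈ VD ∧ ⁅z, v⁆ = 0}
        add_mem' := fun {a b} ha hb => ⟨add_mem ha.1 hb.1, by rw [lie_add, ha.2, hb.2, add_zero]⟩
        zero_mem' := ⟨zero_mem _, lie_zero z⟩
        smul_mem' := fun c a ha => ⟨VD.smul_mem c ha.1, by rw [lie_smul, ha.2, smul_zero]⟩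
        lie_mem := fun {x m} hm => ⟨VD.lie_mem hm.1, by
          rw [leibniz_lie, hm.2, hm.1 _ (hlieD z x), lie_zero, add_zero]⟩ }
    let W : LieSubmodule K L V := LieSubmodule.lieSpan K L {w}
    have hwW : w ∈ W := LieSubmodule.subset_lieSpan rfl
    have hwVD : w ∈ VD := fun x hx => hw ⟨x, hx⟩
    have hWZ : ∀ z : L, ⁅z, w⁆ = 0 → ∀ m ∈ W, ⁅z, m⁆ = 0 := by
      intro z hz m hm
      have : W ≤ Z z := LieSubmodule.lieSpan_le.mpr (Set.singleton_subset_iff.mpr ⟨hwVD, hz⟩)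
      exact (this hm).2
    have hW1 : 0 < finrank K (W : Submodule K V) := by
      have : Nontrivial (W : Submodule K V) := ⟨⟨w, hwW⟩, 0, by simpa using hw0⟩
      exact finrank_pos
    have hWq := Submodule.finrank_quotient_add_finrank (W : Submodule K V)
    obtain ⟨T, hT1, hT2, hT3⟩ := ih (V ⧸ W) (by
      change finrank K (V ⧸ (W : Submodule K V)) ≤ d
      omega)
    have hkerW : ∀ z : L, z ∈ LieModule.ker K L W ↔ ⁅z, w⁆ = 0 := by
      intro z
      rw [LieModule.mem_ker]
      constructor
      · intro h
        exact congrArg Subtype.val (h ⟨w, hwW⟩)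
      · rintro h ⟨a, ha⟩
        exact Subtype.ext (hWZ z h a ha)
    refine ⟨T ⊓ LieModule.ker K L W, le_inf hT1 ?_, ?_, ?_⟩
    · intro x hx
      rw [hkerW]
      exact hwVD x hx
    · let orb : L →ₗ[K] (W : Submodule K V) :=
        (((LieModule.toEnd K L V : L →ₗ[K] Module.End K V).flip) w).codRestrict (W : Submodule K V)
          (fun x => W.lie_mem hwW)
      have h1 := LinearMap.finrank_range_add_finrank_ker orb
      have h2 : orb.ker ≤ (LieModule.ker K L W : Submodule K L) := by
        intro x hx
        exact (hkerW x).mpr (congrArg Subtype.val (LinearMap.mem_ker.mp hx))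
      have h3 := Submodule.finrank_mono h2
      have h4 := Submodule.finrank_le orb.range
      have h5 := Submodule.finrank_sup_add_finrank_inf_eq (T : Submodule K L)
        (LieModule.ker K L W : Submodule K L)
      have h6 := Submodule.finrank_le ((T : Submodule K L) ⊔ (LieModule.ker K L W : Submodule K L))
      change finrank K L ≤ finrank K 
        ((T : Submodule K L) ⊓ (LieModule.ker K L W : Submodule K L) : Submodule K L) + _
      change finrank K L ≤ finrank K (T : Submodule K L) +
        finrank K (V ⧸ (W : Submodule K V)) at hT2
      omega
    · intro x hx
      obtain ⟨hxT, hxW⟩ := (LieSubmodule.mem_inf _ _ _).mp hx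
      exact isNilpotent_toEnd_of_quotient W x (hWZ x ((hkerW x).mp hxW)) (hT3 x hxT)

omit [CharZero K] [LieAlgebra.IsSolvable L] in
lemma finrank_lieIdeal_le_of_forall_isNilpotent_ad (n : ℕ)
    (hA : ∀ H : LieSubalgebra K L, IsLieAbelian H → finrank K H ≤ n) (I : LieIdeal K L)
    (hI : ∀ x ∈ I, IsNilpotent (LieAlgebra.ad K L x)) : finrank K I ≤ n + n.choose 2 := by
  have : LieRing.IsNilpotent I := by
    rw [LieAlgebra.isNilpotent_iff_forall (R := K)]
    rintro ⟨x, hx⟩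
    obtain ⟨k, hk⟩ := hI x hx
    refine ⟨k, ?_⟩
    ext y
    have : ∀ j : ℕ, (((LieAlgebra.ad K I ⟨x, hx⟩) ^ j) y : L) = ((LieAlgebra.ad K L x) ^ j) y := by
      intro j
      induction j with
      | zero => simp
      | succ j hj =>
        rw [pow_succ', pow_succ', Module.End.mul_apply, Module.End.mul_apply, ← hj]; rfl
    rw [this, hk]; rfl
  apply finrank_le_of_isNilpotent (L := I)
  intro H hH
  let f : I →ₗ⁅K⁆ L := I.incl
  have hab : IsLieAbelian (H.map f) := by
    refine ⟨?_⟩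
    rintro ⟨_, x, hx, rfl⟩ ⟨_, y, hy, rfl⟩
    have h1 := hH.trivial ⟨x, hx⟩ ⟨y, hy⟩
    have h2 : ⁅x, y⁆ = 0 := congrArg Subtype.val h1
    apply Subtype.ext
    change ⁅f x, f y⁆ = 0
    rw [← LieHom.map_lie, h2, map_zero]
  have h1 := hA (H.map f) hab
  have h2 : finrank K (H.map f) = finrank K H :=
    LinearEquiv.finrank_eq (Submodule.equivMapOfInjective (f : I →ₗ[K] L) Subtype.val_injective
      (H : Submodule K I)).symm
  omega

/-- A solvable Lie algebra in characteristic zero all of whose abelian subalgebras have dimension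
at most `n` has dimension at most `n * (n + 1)`. -/
lemma finrank_le_of_isSolvable (n : ℕ)
    (hA : ∀ H : LieSubalgebra K L, IsLieAbelian H → finrank K H ≤ n) :
    finrank K L ≤ n ^ 2 + n := by
  let D := LieAlgebra.derivedSeries K L 1
  have hlieD : ∀ x y : L, ⁅x, y⁆ ∈ D := by
    intro x y
    change _ ∈ LieAlgebra.derivedSeries K L 1
    rw [LieAlgebra.derivedSeries_def, LieAlgebra.derivedSeriesOfIdeal_succ,
        LieAlgebra.derivedSeriesOfIdeal_zero]
    exact LieSubmodule.lie_mem_lie (LieSubmodule.mem_top _) (LieSubmodule.mem_top _)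
  have h1 : finrank K D ≤ n + n.choose 2 :=
    finrank_lieIdeal_le_of_forall_isNilpotent_ad n hA D
      (fun x hx => isNilpotent_toEnd_of_mem_derivedSeries_one L x hx)
  obtain ⟨T, -, hT2, hT3⟩ := exists_lieIdeal_forall_isNilpotent_toEnd (K := K) (L := L) _ D le_rfl
  have h2 : finrank K T ≤ n + n.choose 2 := by
    refine finrank_lieIdeal_le_of_forall_isNilpotent_ad n hA T (fun x hx => ?_)
    obtain ⟨k, hk⟩ := hT3 x hx
    refine ⟨k + 1, ?_⟩
    ext y
    have : ∀ (j : ℕ) (d : D), (((LieModule.toEnd K L D x) ^ j) d : L) = 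
        ((LieAlgebra.ad K L x) ^ j) d := by
      intro j d
      induction j with
      | zero => simp
      | succ j hj =>
        rw [pow_succ', pow_succ', Module.End.mul_apply, Module.End.mul_apply, ← hj]; rfl
    rw [pow_succ, Module.End.mul_apply]
    have h3 := this k ⟨⁅x, y⁆, hlieD x y⟩
    rw [hk] at h3
    exact h3.symm
  have h4 : 2 * n.choose 2 + n = n ^ 2 := by
    rcases n with _ | m
    · simp
    · rw [Nat.choose_two_right]
      have h5 : (m + 1) * (m + 1 - 1) = 2 * ((m + 1) * (m + 1 - 1) / 2) := by
        refine (Nat.mul_div_cancel' ?_).symm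
        rw [mul_comm]
        exact (Nat.even_mul_succ_self m).two_dvd
      rw [← h5]
      simp; ring
  omega

end SolvableBound

section FixedVectors
variable {K L : Type*} [Field K] [CharZero K] [LieRing L] [LieAlgebra K L] [FiniteDimensional K L]

attribute [local instance] LieRing.ofAssociativeRing

omit [CharZero K] [FiniteDimensional K L] in
lemma toEnd_ad_pow_apply {V : Type*} [AddCommGroup V] [Module K V] [LieRingModule L V]
    [LieModule K L V] (x y : L) (j : ℕ) :
    LieModule.toEnd K L V (((LieAlgebra.ad K L x) ^ j) y) =
      ((LieAlgebra.ad K (Module.End K V) (LieModule.toEnd K L V x)) ^ j)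
        (LieModule.toEnd K L V y) := by
  induction j with
  | zero => simp
  | succ j hj =>
    rw [pow_succ', pow_succ', Module.End.mul_apply, Module.End.mul_apply, ← hj]
    simp only [LieAlgebra.ad_apply, LieHom.map_lie]

omit [CharZero K] in
/-- A Lie algebra with a faithful action by nilpotent endomorphisms is nilpotent. -/
lemma LieRing.isNilpotent_of_faithful (V : Type*) [AddCommGroup V] [Module K V] [LieRingModule L V]
    [LieModule K L V] (h0 : ∀ x : L, (∀ v : V, ⁅x, v⁆ = 0) → x = 0)
    (h : ∀ x : L, _root_.IsNilpotent (LieModule.toEnd K L V x)) : LieRing.IsNilpotent L := by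
  rw [LieAlgebra.isNilpotent_iff_forall (R := K)]
  intro x
  obtain ⟨k, hk⟩ := LieAlgebra.ad_nilpotent_of_nilpotent (R := K) (h x)
  refine ⟨k, ?_⟩
  ext y
  apply h0
  intro v
  have h1 := toEnd_ad_pow_apply (K := K) (V := V) x y k
  rw [hk] at h1
  exact LinearMap.congr_fun h1 v

/-- If `L` has trivial radical, the trace form of a representation is nondegenerate on every ideal
that acts faithfully. -/
lemma eq_zero_of_forall_traceForm_eq_zero [LieAlgebra.HasTrivialRadical K L] (V : Type*)
    [AddCommGroup V] [Module K V] [LieRingModule L V] [LieModule K L V] [FiniteDimensional K V]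
    (I : LieIdeal K L) (hI : I ⊓ LieModule.ker K L V = ⊥) (x : L) (hx : x ∈ I)
    (h : ∀ y ∈ I, LieModule.traceForm K L V x y = 0) : x = 0 := by
  let I' : LieIdeal K L :=
    { carrier := {x | x ∈ I ∧ ∀ y ∈ I, LieModule.traceForm K L V x y = 0}
      add_mem' := fun {a b} ha hb => ⟨add_mem ha.1 hb.1, fun y hy => by
        rw [map_add, LinearMap.add_apply, ha.2 y hy, hb.2 y hy, add_zero]⟩
      zero_mem' := ⟨zero_mem _, fun y _ => by rw [map_zero, LinearMap.zero_apply]⟩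
      smul_mem' := fun c a ha => ⟨I.smul_mem c ha.1, fun y hy => by
        rw [map_smul, LinearMap.smul_apply, ha.2 y hy, smul_zero]⟩
      lie_mem := fun {z a} ha => ⟨I.lie_mem ha.1, fun y hy => by
        rw [LieModule.traceForm_apply_lie_apply', ha.2 _ (I.lie_mem hy), neg_zero]⟩ }
  have hI'0 : ∀ x ∈ I', (∀ v : V, ⁅x, v⁆ = 0) → x = 0 := by
    intro x hx hv
    have : x ∈ I ⊓ LieModule.ker K L V :=
      (LieSubmodule.mem_inf _ _ _).mpr ⟨hx.1, (LieModule.mem_ker _ _ _ _).mpr hv⟩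
    rwa [hI, LieSubmodule.mem_bot] at this
  have tf : LieModule.traceForm K I' V = 0 := by
    ext ⟨x, hx⟩ ⟨y, hy⟩
    exact hx.2 y hy.1
  have hnil := LieModule.isNilpotent_derivedSeries_of_traceForm_eq_zero tf
  have hnil' : LieRing.IsNilpotent (LieAlgebra.derivedSeries K I' 1) := by
    refine LieRing.isNilpotent_of_faithful (K := K) V ?_
      ((LieModule.isNilpotent_iff_forall' (R := K)).mp hnil)
    intro z hz
    exact Subtype.ext (Subtype.ext (hI'0 z.1.1 z.1.2 hz))
  have hsol : LieAlgebra.IsSolvable I' := by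
    obtain ⟨k, hk⟩ := LieAlgebra.IsSolvable.solvable K (LieAlgebra.derivedSeries K I' 1)
    refine LieAlgebra.IsSolvable.mk (R := K) (k := k + 1) ?_
    rw [LieIdeal.derivedSeries_eq_bot_iff] at hk
    rw [LieAlgebra.derivedSeries_def, LieAlgebra.derivedSeriesOfIdeal_add]
    exact hk
  have hbot := (LieAlgebra.hasTrivialRadical_iff_no_solvable_ideals K L).mp inferInstance I' hsol
  have : x ∈ I' := ⟨hx, h⟩
  rwa [hbot, LieSubmodule.mem_bot] at this

omit [CharZero K] in
/-- The Casimir endomorphism of a representation attached to an ideal on which the trace form is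
nondegenerate. -/
lemma exists_casimir (V : Type*)
    [AddCommGroup V] [Module K V] [LieRingModule L V] [LieModule K L V] [FiniteDimensional K V]
    (I : LieIdeal K L)
    (hI : ∀ x ∈ I, (∀ y ∈ I, LieModule.traceForm K L V x y = 0) → x = 0) :
    ∃ C : Module.End K V, (∀ (x : L) (v : V), C ⁅x, v⁆ = ⁅x, C v⁆) ∧
      LinearMap.trace K V C = finrank K I ∧
      ∀ W : Submodule K V, (∀ (x : L) (v : V), ⁅x, v⁆ ∈ W) → ∀ v, C v ∈ W := by
  let B : LinearMap.BilinForm K I := LieModule.traceForm K I V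
  have hBapp : ∀ x y : I, B x y = LieModule.traceForm K L V x y := fun _ _ => rfl
  have hsymm : LinearMap.BilinForm.IsSymm B := ⟨LieModule.traceForm_comm K I V⟩
  have hB : B.Nondegenerate := by
    refine (hsymm.isRefl.nondegenerate_iff_separatingLeft).mpr ?_
    intro x hx
    exact Subtype.ext (hI x x.2 (fun y hy => hx ⟨y, hy⟩))
  let b : Basis (Fin (finrank K I)) K I := finBasis K I
  let b' := B.dualBasis hB b
  have hrepr : ∀ y : I, y = ∑ j, B y (b' j) • b j := by
    intro y
    have h1 := b.sum_repr y
    conv_lhs => rw [← h1]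
    refine Finset.sum_congr rfl fun j _ => ?_
    congr 1
    conv_rhs => rw [← h1]
    rw [map_sum, LinearMap.sum_apply, Finset.sum_eq_single j]
    · rw [map_smul, LinearMap.smul_apply, LinearMap.BilinForm.apply_dualBasis_right hB hsymm]
      simp
    · intro i _ hij
      rw [map_smul, LinearMap.smul_apply, LinearMap.BilinForm.apply_dualBasis_right hB hsymm]
      simp [hij]
    · simp
  have hrepr' : ∀ y : I, y = ∑ j, B y (b j) • b' j := by
    intro y
    conv_lhs => rw [← b'.sum_repr y]
    simp only [b', LinearMap.BilinForm.dualBasis_repr_apply]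
  let ρ := LieModule.toEnd K L V
  refine ⟨∑ i, ρ (b i) * ρ (b' i), ?_, ?_, ?_⟩
  · intro x v
    have e1 : ∀ i, (⁅x, (b i : L)⁆ : L) = ∑ j, B ⁅x, b i⁆ (b' j) • (b j : L) := by
      intro i
      have := congrArg Subtype.val (hrepr ⁅x, b i⁆)
      rw [LieSubmodule.coe_bracket] at this
      rw [this]
      simp
    have e2 : ∀ j, (⁅x, (b' j : L)⁆ : L) = - ∑ i, B ⁅x, b i⁆ (b' j) • (b' i : L) := by
      intro j
      have := congrArg Subtype.val (hrepr' ⁅x, b' j⁆)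
      rw [LieSubmodule.coe_bracket] at this
      rw [this, ← Finset.sum_neg_distrib]
      simp only [AddSubmonoidClass.coe_finsetSum, LieSubmodule.coe_smul]
      refine Finset.sum_congr rfl fun i _ => ?_
      rw [← neg_smul]
      congr 1
      rw [hBapp, hBapp, LieSubmodule.coe_bracket, LieSubmodule.coe_bracket,
        LieModule.traceForm_apply_lie_apply', LieModule.traceForm_comm]
    have e3 : ∀ i, ⁅x, ⁅(b i : L), ⁅(b' i : L), v⁆⁆⁆ = ⁅⁅x, (b i : L)⁆, ⁅(b' i : L), v⁆⁆ +
        ⁅(b i : L), ⁅⁅x, (b' i : L)⁆, v⁆⁆ + ⁅(b i : L), ⁅(b' i : L), ⁅x, v⁆⁆⁆ := by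
      intro i
      rw [leibniz_lie x (b i : L), leibniz_lie x (b' i : L), lie_add, add_assoc]
    have e4 : ∀ u, (∑ i, ρ (b i) * ρ (b' i)) u = ∑ i, ⁅(b i : L), ⁅(b' i : L), u⁆⁆ := by
      intro u
      rw [LinearMap.sum_apply]
      rfl
    rw [e4, e4, lie_sum]
    simp only [e3]
    rw [Finset.sum_add_distrib, Finset.sum_add_distrib, right_eq_add]
    simp only [e1, e2]
    simp only [sum_lie, neg_lie, lie_neg, lie_sum, smul_lie, lie_smul, Finset.sum_neg_distrib]
    rw [Finset.sum_comm, add_neg_eq_zero]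
  · rw [map_sum]
    have : ∀ i, LinearMap.trace K V (ρ (b i) * ρ (b' i)) = 1 := by
      intro i
      change B (b i) (b' i) = 1
      rw [LinearMap.BilinForm.apply_dualBasis_right hB hsymm]
      simp
    simp [this]
  · intro W hW v
    rw [LinearMap.sum_apply]
    exact Submodule.sum_mem _ fun i _ => hW _ _

/-- If `L` has trivial radical and acts on `V` with values in a proper submodule `W`, then some
vector outside `W` is fixed. -/
lemma exists_notMem_forall_lie_eq_zero [LieAlgebra.HasTrivialRadical K L] (d : ℕ) :
    ∀ (V : Type*) [AddCommGroup V] [Module K V] [LieRingModule L V] [LieModule K L V]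
      [FiniteDimensional K V] (W : LieSubmodule K L V), finrank K V < d → W ≠ ⊤ →
      (∀ (x : L) (v : V), ⁅x, v⁆ ∈ W) → ∃ v ∉ W, ∀ x : L, ⁅x, v⁆ = 0 := by
  induction d with
  | zero => intro V _ _ _ _ _ W h; omega
  | succ d ih =>
    intro V _ _ _ _ _ W hd hWtop hW
    let J := LieModule.ker K L V
    let I := LieIdeal.killingCompl K L J
    have hcompl : IsCompl J I := LieIdeal.isCompl_killingCompl J
    obtain ⟨C, hC1, hC2, hC3⟩ := exists_casimir V I
      (eq_zero_of_forall_traceForm_eq_zero V I (by rw [inf_comm]; exact hcompl.inf_eq_bot))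
    by_cases hnil : IsNilpotent C
    · have h0 := (LinearMap.isNilpotent_trace_of_isNilpotent hnil).eq_zero
      rw [hC2, Nat.cast_eq_zero] at h0
      have hIbot : I = ⊥ := by
        rw [← LieSubmodule.toSubmodule_eq_bot]
        exact Submodule.finrank_eq_zero.mp h0
      have hJtop : J = ⊤ := by
        have := hcompl.sup_eq_top
        rwa [hIbot, sup_bot_eq] at this
      obtain ⟨v, -, hv⟩ := SetLike.exists_of_lt (lt_top_iff_ne_top.mpr hWtop)
      refine ⟨v, hv, fun x => ?_⟩
      have hx : x ∈ J := hJtop ▸ LieSubmodule.mem_top x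
      exact (LieModule.mem_ker _ _ _ _).mp hx v
    · obtain ⟨N, hN1, hN⟩ := ((Filter.eventually_ge_atTop 1).and
        (LinearMap.eventually_isCompl_ker_pow_range_pow C)).exists
      have hcomm : ∀ (j : ℕ) (x : L) (v : V), (C ^ j) ⁅x, v⁆ = ⁅x, (C ^ j) v⁆ := by
        intro j x
        induction j with
        | zero => intro v; simp
        | succ j hj =>
          intro v
          rw [pow_succ, Module.End.mul_apply, Module.End.mul_apply, hC1, hj]
      let V' : LieSubmodule K L V :=
        { LinearMap.ker (C ^ N) with
          lie_mem := by
            intro x m hm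
            have hm : (C ^ N) m = 0 := hm
            change (C ^ N) ⁅x, m⁆ = 0
            rw [hcomm, hm, lie_zero] }
      have hrange : LinearMap.range (C ^ N) ≤ (W : Submodule K V) := by
        rintro _ ⟨v, rfl⟩
        obtain ⟨m, rfl⟩ := Nat.exists_eq_add_of_le' hN1
        rw [pow_succ', Module.End.mul_apply]
        exact hC3 _ hW _
      have hV'W : ¬ (LinearMap.ker (C ^ N) ≤ (W : Submodule K V)) := by
        intro hle
        apply hWtop
        rw [← LieSubmodule.toSubmodule_eq_top, eq_top_iff, ← hN.sup_eq_top]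
        exact sup_le hle hrange
      have hlt : finrank K V' < finrank K V := by
        refine Submodule.finrank_lt (s := LinearMap.ker (C ^ N)) ?_
        intro h
        exact hnil ⟨N, LinearMap.ker_eq_top.mp h⟩
      have hW' : W.comap V'.incl ≠ ⊤ := by
        intro h
        apply hV'W
        intro v hv
        have : (⟨v, hv⟩ : V') ∈ W.comap V'.incl := h ▸ LieSubmodule.mem_top _
        exact this
      obtain ⟨v, hv, hfix⟩ := ih V' (W.comap V'.incl) (by omega) hW' (fun x v => hW x v)
      exact ⟨v, hv, fun x => congrArg Subtype.val (hfix x)⟩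

end FixedVectors

section Levi
variable {K : Type*} [Field K] [CharZero K]
  {G : Type*} [LieRing G] [LieAlgebra K G] [FiniteDimensional K G]

attribute [local instance] LieRing.ofAssociativeRing

lemma exists_notMem_forall_lie_eq_zero_of_surjective [LieAlgebra.HasTrivialRadical K G]
    {L : Type*} [LieRing L] [LieAlgebra K L] (π : L →ₗ⁅K⁆ G) (hπ : Function.Surjective π)
    (V : Type*) [AddCommGroup V] [Module K V] [LieRingModule L V] [LieModule K L V]
    [FiniteDimensional K V] (htriv : ∀ x, π x = 0 → ∀ v : V, ⁅x, v⁆ = 0) (W : LieSubmodule K L V)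
    (hWtop : W ≠ ⊤) (hW : ∀ (x : L) (v : V), ⁅x, v⁆ ∈ W) : ∃ v ∉ W, ∀ x : L, ⁅x, v⁆ = 0 := by
  obtain ⟨σ, hσ⟩ := LinearMap.exists_rightInverse_of_surjective (π : L →ₗ[K] G)
    (LinearMap.range_eq_top.mpr hπ)
  have hσ : ∀ y, π (σ y) = y := fun y => LinearMap.congr_fun hσ y
  have hact : ∀ x (v : V), ⁅σ (π x), v⁆ = ⁅x, v⁆ := by
    intro x v
    rw [← sub_eq_zero, ← sub_lie]
    exact htriv _ (by rw [map_sub, hσ, sub_self]) v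
  let ρ : G →ₗ⁅K⁆ Module.End K V :=
    { (LieModule.toEnd K L V : L →ₗ[K] Module.End K V) ∘ₗ σ with
      map_lie' := by
        intro x y
        ext v
        change ⁅σ ⁅x, y⁆, v⁆ = ⁅σ x, ⁅σ y, v⁆⁆ - ⁅σ y, ⁅σ x, v⁆⁆
        rw [← lie_lie, ← hact ⁅σ x, σ y⁆, LieHom.map_lie, hσ, hσ] }
  let _ : LieRingModule G V := LieRingModule.compLieHom V ρ
  have : LieModule K G V := LieModule.compLieHom V ρ
  have hbr : ∀ (y : G) (v : V), ⁅y, v⁆ = ⁅σ y, v⁆ := fun y v => rfl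
  let W' : LieSubmodule K G V := { (W : Submodule K V) with lie_mem := fun _ => hW _ _ }
  obtain ⟨v, hv, hfix⟩ := exists_notMem_forall_lie_eq_zero (K := K) (L := G) _ V W'
    (Nat.lt_succ_self _) (by
      intro h
      apply hWtop
      rw [← LieSubmodule.toSubmodule_eq_top] at h ⊢
      exact h) (fun y v => hW _ _)
  exact ⟨v, hv, fun x => by rw [← hact, ← hbr, hfix]⟩

omit [CharZero K] [FiniteDimensional K G] in
lemma exists_section_of_subalgebra {L : Type*} [LieRing L] [LieAlgebra K L] (π : L →ₗ⁅K⁆ G)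
    (S : LieSubalgebra K L) (h1 : ∀ y, ∃ x ∈ S, π x = y) (h2 : ∀ x ∈ S, π x = 0 → x = 0) :
    ∃ s : G →ₗ⁅K⁆ L, ∀ y, π (s y) = y := by
  choose s hsS hs using h1
  have huniq : ∀ x ∈ S, ∀ y, π x = y → s y = x := by
    intro x hx y hxy
    rw [← sub_eq_zero]
    exact h2 _ (sub_mem (hsS y) hx) (by rw [map_sub, hs, hxy, sub_self])
  exact ⟨{ toFun := s
           map_add' := fun x y => huniq _ (add_mem (hsS x) (hsS y)) _ (by rw [map_add, hs, hs])
           map_smul' := fun c x => huniq _ (S.smul_mem c (hsS x)) _ (by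
            rw [map_smul, hs])
           map_lie' := fun {x y} => huniq _ (S.lie_mem (hsS x) (hsS y)) _ (by
            rw [LieHom.map_lie, hs, hs]) }, hs⟩

/-- The inductive step of the Levi decomposition when the kernel is abelian: either there is a
section or a proper subalgebra still surjects. -/
lemma exists_section_or_subalgebra [LieAlgebra.HasTrivialRadical K G]
    {L : Type*} [LieRing L] [LieAlgebra K L] [FiniteDimensional K L] (π : L →ₗ⁅K⁆ G)
    (hπ : Function.Surjective π) (hab : ∀ x ∈ π.ker, ∀ y ∈ π.ker, ⁅x, y⁆ = 0) (hne : π.ker ≠ ⊥) :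
    (∃ s : G →ₗ⁅K⁆ L, ∀ y, π (s y) = y) ∨
      ∃ S : LieSubalgebra K L, S ≠ ⊤ ∧ ∀ y, ∃ x ∈ S, π x = y := by
  set R := π.ker with hR
  let M : LieSubmodule K L (L →ₗ[K] L) :=
    { carrier := {f | (∀ y, f y ∈ R) ∧ ∃ c : K, ∀ r ∈ R, f r = c • r}
      add_mem' := by
        rintro f g ⟨hf, c, hc⟩ ⟨hg, d, hd⟩
        exact ⟨fun y => add_mem (hf y) (hg y), c + d, fun r hr => by
          rw [LinearMap.add_apply, hc r hr, hd r hr, add_smul]⟩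
      zero_mem' := ⟨fun y => zero_mem _, 0, fun r _ => by simp⟩
      smul_mem' := by
        rintro a f ⟨hf, c, hc⟩
        exact ⟨fun y => R.smul_mem a (hf y), a * c, fun r hr => by
          rw [LinearMap.smul_apply, hc r hr, mul_smul]⟩
      lie_mem := by
        rintro x f ⟨hf, c, hc⟩
        refine ⟨fun y => ?_, 0, fun r hr => ?_⟩
        · rw [LieHom.lie_apply]
          exact sub_mem (R.lie_mem (hf y)) (hf _)
        · rw [LieHom.lie_apply, hc r hr, hc _ (R.lie_mem hr), lie_smul, sub_self, zero_smul] }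
  let N : LieSubmodule K L M :=
    { carrier := {f | ∀ r ∈ R, f.1 r = 0}
      add_mem' := by
        rintro f g hf hg r hr
        change f.1 r + g.1 r = 0
        rw [hf r hr, hg r hr, add_zero]
      zero_mem' := fun r _ => rfl
      smul_mem' := by
        rintro a f hf r hr
        change a • f.1 r = 0
        rw [hf r hr, smul_zero]
      lie_mem := by
        rintro x f hf r hr
        change ⁅x, f.1⁆ r = 0
        rw [LieHom.lie_apply, hf r hr, hf _ (R.lie_mem hr), lie_zero, sub_zero] }
  have hadlie : ∀ x y : L, ⁅x, (LieAlgebra.ad K L y : L →ₗ[K] L)⁆ = LieAlgebra.ad K L ⁅x, y⁆ := by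
    intro x y
    ext z
    rw [LieHom.lie_apply, LieAlgebra.ad_apply, LieAlgebra.ad_apply, LieAlgebra.ad_apply, lie_lie]
  let P : LieSubmodule K L M :=
    { carrier := {f | ∃ r ∈ R, f.1 = LieAlgebra.ad K L r}
      add_mem' := by
        rintro f g ⟨r, hr, hf⟩ ⟨t, ht, hg⟩
        refine ⟨r + t, add_mem hr ht, ?_⟩
        rw [map_add, ← hf, ← hg]
        rfl
      zero_mem' := ⟨0, zero_mem _, by rw [map_zero]; rfl⟩
      smul_mem' := by
        rintro a f ⟨r, hr, hf⟩
        refine ⟨a • r, R.smul_mem a hr, ?_⟩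
        rw [map_smul, ← hf]
        rfl
      lie_mem := by
        rintro x f ⟨r, hr, hf⟩
        refine ⟨⁅x, r⁆, R.lie_mem hr, ?_⟩
        rw [← hadlie, ← hf]
        rfl }
  have hPN : P ≤ N := by
    rintro f ⟨r, hr, hf⟩ t ht
    rw [hf]
    exact hab r hr t ht
  have hlieN : ∀ (x : L) (f : M), ⁅x, f⁆ ∈ N := by
    rintro x ⟨f, hf, c, hc⟩ r hr
    change ⁅x, f⁆ r = 0
    rw [LieHom.lie_apply, hc r hr, hc _ (R.lie_mem hr), lie_smul, sub_self]
  have hRact : ∀ r ∈ R, ∀ (f : L →ₗ[K] L) (c : K), (∀ y, f y ∈ R) → (∀ t ∈ R, f t = c • t) →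
      ⁅r, f⁆ = LieAlgebra.ad K L (-(c • r)) := by
    intro r hr f c hf hc
    ext y
    rw [LieHom.lie_apply, hab r hr _ (hf y), LieAlgebra.ad_apply, zero_sub, neg_lie, smul_lie,
      hc _ (lie_mem_left K L R r y hr)]
  have hW : LieSubmodule.map (LieSubmodule.Quotient.mk' P) N ≠ ⊤ := by
    intro htop
    obtain ⟨g, hg⟩ := LinearMap.exists_leftInverse_of_injective (R : Submodule K L).subtype
      (Submodule.ker_subtype _)
    have hg : ∀ r (hr : r ∈ R), g r = ⟨r, hr⟩ := fun r hr => LinearMap.congr_fun hg ⟨r, hr⟩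
    let f : M := ⟨(R : Submodule K L).subtype ∘ₗ g, fun y => (g y).2, 1, fun r hr => by
      rw [LinearMap.comp_apply, hg r hr, one_smul]; rfl⟩
    have hf : LieSubmodule.Quotient.mk' P f ∈ LieSubmodule.map (LieSubmodule.Quotient.mk' P) N :=
      htop ▸ LieSubmodule.mem_top _
    obtain ⟨n, hn, hnf⟩ := (LieSubmodule.mem_map _).mp hf
    have hfN : f ∈ N := by
      have : n - f ∈ P := by
        rw [← LieSubmodule.Quotient.mk_eq_zero, map_sub, hnf, sub_self]
      have h2 := sub_mem hn (hPN this)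
      rwa [sub_sub_cancel] at h2
    apply hne
    rw [LieSubmodule.eq_bot_iff]
    intro r hr
    have h1 : (g r : L) = 0 := hfN r hr
    rwa [hg r hr] at h1
  obtain ⟨v, hv, hfix⟩ := exists_notMem_forall_lie_eq_zero_of_surjective π hπ (M ⧸ P) (by
    intro r hr v
    obtain ⟨⟨f, hf, c, hc⟩, rfl⟩ := LieSubmodule.Quotient.surjective_mk' P v
    rw [← LieModuleHom.map_lie, LieSubmodule.Quotient.mk_eq_zero]
    exact ⟨-(c • r), neg_mem (R.smul_mem c hr), hRact r hr f c hf hc⟩) _ hW (by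
    intro x v
    obtain ⟨f, rfl⟩ := LieSubmodule.Quotient.surjective_mk' P v
    rw [← LieModuleHom.map_lie]
    exact LieSubmodule.mem_map_of_mem (hlieN x f))
  obtain ⟨⟨f, hf, c, hc⟩, rfl⟩ := LieSubmodule.Quotient.surjective_mk' P v
  have hc0 : c ≠ 0 := by
    rintro rfl
    apply hv
    refine LieSubmodule.mem_map_of_mem ?_
    intro r hr
    change f r = 0
    rw [hc r hr, zero_smul]
  have hfP : ∀ x : L, ∃ r ∈ R, ⁅x, f⁆ = LieAlgebra.ad K L r := by
    intro x
    have := hfix x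
    rw [← LieModuleHom.map_lie, LieSubmodule.Quotient.mk_eq_zero] at this
    exact this
  let S : LieSubalgebra K L :=
    { carrier := {x | ⁅x, f⁆ = 0}
      add_mem' := by
        intro x y hx hy
        change ⁅x + y, f⁆ = 0
        rw [add_lie, hx, hy, add_zero]
      zero_mem' := zero_lie f
      smul_mem' := by
        intro a x hx
        change ⁅a • x, f⁆ = 0
        rw [smul_lie, hx, smul_zero]
      lie_mem' := by
        intro x y hx hy
        change ⁅⁅x, y⁆, f⁆ = 0
        rw [lie_lie, hx, hy, lie_zero, lie_zero, sub_zero] }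
  by_cases hS : S = ⊤
  · left
    have hcomm : ∀ x y : L, f ⁅x, y⁆ = ⁅x, f y⁆ := by
      intro x y
      have hx : x ∈ S := hS ▸ LieSubalgebra.mem_top x
      have := LinearMap.congr_fun (show ⁅x, f⁆ = 0 from hx) y
      rw [LieHom.lie_apply, LinearMap.zero_apply, sub_eq_zero] at this
      exact this.symm
    let T : LieSubalgebra K L :=
      { LinearMap.ker f with
        lie_mem' := by
          intro x y _ hy
          have hy : f y = 0 := hy
          change f ⁅x, y⁆ = 0
          rw [hcomm, hy, lie_zero] }
    refine exists_section_of_subalgebra π T ?_ ?_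
    · intro y
      obtain ⟨x, rfl⟩ := hπ y
      refine ⟨x - c⁻¹ • f x, ?_, ?_⟩
      · change f (x - c⁻¹ • f x) = 0
        rw [map_sub, map_smul, hc _ (hf x), smul_smul, inv_mul_cancel₀ hc0, one_smul, sub_self]
      · rw [map_sub, map_smul, LieHom.mem_ker.mp (hf x), smul_zero, sub_zero]
    · intro x hx hxR
      have h1 : f x = 0 := hx
      rw [hc x hxR] at h1
      exact (smul_eq_zero.mp h1).resolve_left hc0
  · right
    refine ⟨S, hS, fun y => ?_⟩
    obtain ⟨x, rfl⟩ := hπ y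
    obtain ⟨r, hr, hxr⟩ := hfP x
    refine ⟨x + c⁻¹ • r, ?_, ?_⟩
    · change ⁅x + c⁻¹ • r, f⁆ = 0
      rw [add_lie, hxr, smul_lie, hRact r hr f c hf hc, map_neg, map_smul, smul_neg, smul_smul,
        inv_mul_cancel₀ hc0, one_smul, add_neg_cancel]
    · rw [map_add, map_smul, LieHom.mem_ker.mp hr, smul_zero, add_zero]

/-- **Levi's theorem**: a surjection with solvable kernel onto a Lie algebra with trivial radical
splits. -/
lemma exists_levi_section [LieAlgebra.HasTrivialRadical K G] (d : ℕ) :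
    ∀ (L : Type*) [LieRing L] [LieAlgebra K L] [FiniteDimensional K L] (π : L →ₗ⁅K⁆ G),
      finrank K L < d → Function.Surjective π → LieAlgebra.IsSolvable π.ker →
      ∃ s : G →ₗ⁅K⁆ L, ∀ y, π (s y) = y := by
  induction d with
  | zero => intro L _ _ _ π h; omega
  | succ d ih =>
    intro L _ _ _ π hd hπ hsol
    have hsub : ∀ S : LieSubalgebra K L, S ≠ ⊤ → (∀ y, ∃ x ∈ S, π x = y) →
        ∃ s : G →ₗ⁅K⁆ L, ∀ y, π (s y) = y := by
      intro S hS hsurj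
      have hlt : finrank K S < finrank K L := by
        refine Submodule.finrank_lt (s := (S : Submodule K L)) ?_
        rwa [Ne, LieSubalgebra.toSubmodule_eq_top]
      let j : (π.comp S.incl).ker →ₗ⁅K⁆ π.ker :=
        { toFun := fun x => ⟨x.1.1, x.2⟩
          map_add' := fun _ _ => rfl
          map_smul' := fun _ _ => rfl
          map_lie' := rfl }
      have hj : Function.Injective j := by
        intro x y hxy
        exact Subtype.ext (Subtype.ext (congrArg (fun z : π.ker => (z : L)) hxy))
      obtain ⟨s, hs⟩ := ih S (π.comp S.incl) (by omega) (by
        intro y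
        obtain ⟨x, hx, hxy⟩ := hsurj y
        exact ⟨⟨x, hx⟩, hxy⟩) hj.lieAlgebra_isSolvable
      exact ⟨S.incl.comp s, hs⟩
    by_cases hD : ⁅π.ker, π.ker⁆ = ⊥
    · have hab : ∀ x ∈ π.ker, ∀ y ∈ π.ker, ⁅x, y⁆ = 0 := by
        intro x hx y hy
        have := LieSubmodule.lie_mem_lie hx hy
        rwa [hD, LieSubmodule.mem_bot] at this
      by_cases hR : π.ker = ⊥
      · refine exists_section_of_subalgebra π ⊤ ?_ ?_
        · intro y
          obtain ⟨x, rfl⟩ := hπ y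
          exact ⟨x, LieSubalgebra.mem_top x, rfl⟩
        · intro x _ hx
          have : x ∈ π.ker := hx
          rwa [hR, LieSubmodule.mem_bot] at this
      · rcases exists_section_or_subalgebra π hπ hab hR with h | ⟨S, hS, hsurj⟩
        · exact h
        · exact hsub S hS hsurj
    · set D : LieIdeal K L := ⁅π.ker, π.ker⁆ with hDdef
      have hDR : D ≤ π.ker := LieSubmodule.lie_le_left _ _
      let q : L →ₗ⁅K⁆ L ⧸ D :=
        { (LieSubmodule.Quotient.mk' D : L →ₗ[K] L ⧸ D) with
          map_lie' := fun {x y} => LieSubmodule.Quotient.mk_bracket D x y }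
      have hq : Function.Surjective q := LieSubmodule.Quotient.surjective_mk' D
      have hq0 : ∀ x, q x = 0 ↔ x ∈ D := fun x => LieSubmodule.Quotient.mk_eq_zero D
      let π' : L ⧸ D →ₗ⁅K⁆ G :=
        { (D : Submodule K L).liftQ (π : L →ₗ[K] G) hDR with
          map_lie' := by
            rintro ⟨x⟩ ⟨y⟩
            exact π.map_lie x y }
      have hπ' : ∀ x, π' (q x) = π x := fun x => rfl
      let t : π.ker →ₗ⁅K⁆ π'.ker :=
        { toFun := fun x => ⟨q x, x.2⟩
          map_add' := fun x y => Subtype.ext (map_add q x.1 y.1)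
          map_smul' := fun c x => Subtype.ext (map_smul q c x.1)
          map_lie' := fun {x y} => Subtype.ext (LieHom.map_lie q x.1 y.1) }
      have ht : Function.Surjective t := by
        rintro ⟨z, hz⟩
        obtain ⟨x, rfl⟩ := hq z
        exact ⟨⟨x, hz⟩, rfl⟩
      have hlt : finrank K (L ⧸ D) < finrank K L := by
        have h1 := Submodule.finrank_quotient_add_finrank (D : Submodule K L)
        have h2 : finrank K (D : Submodule K L) ≠ 0 := by
          intro h
          rw [Submodule.finrank_eq_zero] at h
          exact hD ((LieSubmodule.toSubmodule_eq_bot (D : LieSubmodule K L L)).mp h)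
        change finrank K (L ⧸ (D : Submodule K L)) < _
        omega
      obtain ⟨s, hs⟩ := ih (L ⧸ D) π' (by omega) (by
        intro y
        obtain ⟨x, rfl⟩ := hπ y
        exact ⟨q x, rfl⟩) ht.lieAlgebra_isSolvable
      refine hsub (s.range.comap q) ?_ ?_
      · intro htop
        have hRD : D = π.ker := by
          refine le_antisymm hDR ?_
          intro x hx
          have h1 : x ∈ s.range.comap q := htop ▸ LieSubalgebra.mem_top x
          obtain ⟨y, hy⟩ : ∃ y, s y = q x := h1
          have h2 : y = 0 := by
            rw [← hs y, hy, hπ']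
            exact hx
          rw [← hq0, ← hy, h2, map_zero]
        have hser : ∀ k, LieAlgebra.derivedSeriesOfIdeal K L k π.ker = π.ker := by
          intro k
          induction k with
          | zero => rfl
          | succ k hk => rw [LieAlgebra.derivedSeriesOfIdeal_succ, hk, ← hDdef, hRD]
        obtain ⟨k, hk⟩ := LieAlgebra.IsSolvable.solvable K π.ker
        rw [LieIdeal.derivedSeries_eq_bot_iff, hser] at hk
        exact hD (hRD.trans hk)
      · intro y
        obtain ⟨x, hx⟩ := hq (s y)
        refine ⟨x, ⟨y, hx.symm⟩, ?_⟩
        rw [← hπ', hx, hs]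

end Levi

section PosDefForm
variable {E : Type*} [AddCommGroup E] [Module ℝ E]

/-- A symmetric positive definite real bilinear form. -/
structure IsSymmPosDef (β : LinearMap.BilinForm ℝ E) : Prop where
  symm : ∀ x y, β x y = β y x
  pos : ∀ x, x ≠ 0 → 0 < β x x

namespace IsSymmPosDef
variable {β : LinearMap.BilinForm ℝ E} (h : IsSymmPosDef β)
include h

lemma nonneg (x : E) : 0 ≤ β x x := by
  rcases eq_or_ne x 0 with rfl | hx
  · simp
  · exact (h.pos x hx).le

lemma eq_zero {x : E} (hx : β x x ≤ 0) : x = 0 := by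
  by_contra h0
  exact absurd (h.pos x h0) (not_lt.mpr hx)

lemma sub_self (x y : E) : β (x - y) (x - y) = β x x - 2 * β x y + β y y := by
  simp only [map_sub, LinearMap.sub_apply, h.symm y x]; ring

lemma add_self (x y : E) : β (x + y) (x + y) = β x x + 2 * β x y + β y y := by
  simp only [map_add, LinearMap.add_apply, h.symm y x]; ring

lemma eq_of_le {x y : E} (hxy : β x x + β y y ≤ 2 * β x y) : x = y := by
  rw [← sub_eq_zero]
  exact h.eq_zero (by rw [h.sub_self]; linarith)

lemma eq_neg_of_le {x y : E} (hxy : β x x + β y y ≤ -(2 * β x y)) : x = -y := by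
  rw [← add_eq_zero_iff_eq_neg]
  exact h.eq_zero (by rw [h.add_self]; linarith)

lemma sq_le (x y : E) : β x y ^ 2 ≤ β x x * β y y := by
  rcases eq_or_ne y 0 with rfl | hy
  · simp
  have h1 := h.nonneg (β y y • x - β x y • y)
  rw [h.sub_self] at h1
  simp only [map_smul, LinearMap.smul_apply, smul_eq_mul] at h1
  have h2 := h.pos y hy
  by_contra hc
  nlinarith [mul_pos h2 (sub_pos.mpr (not_le.mp hc))]

lemma bessel (T : Finset E) (hT : ∀ x ∈ T, ∀ y ∈ T, x ≠ y → β x y = 0) (q : ℝ) (hq : 0 < q)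
    (hTq : ∀ x ∈ T, β x x = q) (w : E) : ∑ x ∈ T, β x w ^ 2 ≤ q * β w w := by
  set z := ∑ x ∈ T, β x w • x with hz
  have h1 : β z w = ∑ x ∈ T, β x w ^ 2 := by
    simp [hz, LinearMap.sum_apply, sq]
  have h2 : β z z = q * ∑ x ∈ T, β x w ^ 2 := by
    have h3 : ∀ y ∈ T, β z y = q * β y w := by
      intro y hy
      rw [hz, map_sum, LinearMap.sum_apply, Finset.sum_eq_single y]
      · rw [map_smul, LinearMap.smul_apply, hTq y hy, smul_eq_mul, mul_comm]
      · intro x hx hxy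
        rw [map_smul, LinearMap.smul_apply, hT x hx y hy hxy, smul_zero]
      · exact fun hn => absurd hy hn
    conv_lhs => rw [hz]
    rw [map_sum, ← hz, Finset.mul_sum]
    refine Finset.sum_congr rfl fun y hy => ?_
    rw [map_smul, h3 y hy, smul_eq_mul]; ring
  have h4 := h.nonneg (q • w - z)
  rw [h.sub_self] at h4
  simp only [map_smul, LinearMap.smul_apply, smul_eq_mul] at h4
  rw [h.symm w z, h1, h2] at h4
  have h5 : 0 ≤ q * (q * β w w - ∑ x ∈ T, β x w ^ 2) := by linarith
  have := nonneg_of_mul_nonneg_right h5 hq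
  linarith

open scoped Classical in
/-- A finite set whose elements are pairwise equal, opposite or orthogonal has at most twice as many
elements as its orthogonal subsets. -/
lemma card_le_two_mul (S : Finset E) (hS : ∀ x ∈ S, ∀ y ∈ S, x = y ∨ x = -y ∨ β x y = 0) (m : ℕ)
    (hm : ∀ T ⊆ S, (∀ x ∈ T, ∀ y ∈ T, x ≠ y → β x y = 0) → T.card ≤ m) : S.card ≤ 2 * m := by
  obtain ⟨P, hP⟩ : ∃ P : Finset E → Prop, ∀ T, P T ↔ ∀ x ∈ T, ∀ y ∈ T, x ≠ y → β x y = 0 :=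
    ⟨_, fun _ => Iff.rfl⟩
  obtain ⟨T, hT⟩ := (S.powerset.filter P).exists_maximal ⟨∅, by simp [hP]⟩
  have hTmem := hT.prop
  rw [Finset.mem_filter, Finset.mem_powerset, hP] at hTmem
  obtain ⟨hTS, horth⟩ := hTmem
  have hsub : S ⊆ T ∪ T.image (fun x => -x) := by
    intro x hx
    by_contra hxT
    rw [Finset.mem_union, not_or, Finset.mem_image] at hxT
    have hx0 : ∀ y ∈ T, β x y = 0 := by
      intro y hy
      rcases hS x hx y (hTS hy) with rfl | rfl | h0
      · exact absurd hy hxT.1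
      · exact absurd ⟨y, hy, rfl⟩ hxT.2
      · exact h0
    have : insert x T ≤ T := by
      refine hT.le_of_ge ?_ (Finset.subset_insert x T)
      rw [Finset.mem_filter, Finset.mem_powerset, hP]
      refine ⟨Finset.insert_subset hx hTS, ?_⟩
      intro u hu v hv huv
      rw [Finset.mem_insert] at hu hv
      rcases hu with rfl | hu <;> rcases hv with rfl | hv
      · exact absurd rfl huv
      · exact hx0 v hv
      · rw [h.symm]; exact hx0 u hu
      · exact horth u hu v hv huv
    exact hxT.1 (this (Finset.mem_insert_self x T))
  have h1 := Finset.card_le_card hsub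
  have h2 := Finset.card_union_le T (T.image (fun x => -x))
  have h3 : (T.image (fun x => -x)).card ≤ T.card := Finset.card_image_le
  have h4 := hm T hTS horth
  omega

lemma card_le_finrank [FiniteDimensional ℝ E] (T : Finset E) (h0 : ∀ x ∈ T, x ≠ 0)
    (hT : ∀ x ∈ T, ∀ y ∈ T, x ≠ y → β x y = 0) : T.card ≤ finrank ℝ E := by
  have hli : LinearIndependent ℝ (fun x : T => (x : E)) := by
    refine LinearMap.BilinForm.linearIndependent_of_iIsOrtho (B := β) ?_ ?_
    · intro x y hxy
      exact hT x x.2 y y.2 (fun hc => hxy (Subtype.ext hc))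
    · intro x hx
      exact absurd hx (h.pos x (h0 x x.2)).ne'
  simpa using hli.fintype_card_le_finrank

lemma card_le_two_mul_finrank [FiniteDimensional ℝ E] (S : Finset E) (h0 : ∀ x ∈ S, x ≠ 0)
    (hS : ∀ x ∈ S, ∀ y ∈ S, x = y ∨ x = -y ∨ β x y = 0) : S.card ≤ 2 * finrank ℝ E :=
  h.card_le_two_mul S hS _ fun T hTS hT => h.card_le_finrank T (fun x hx => h0 x (hTS hx)) hT

end IsSymmPosDef
end PosDefForm

section OrthogonalToRoot
variable {E : Type*} [AddCommGroup E] [Module ℝ E] [FiniteDimensional ℝ E]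
  {β : LinearMap.BilinForm ℝ E}

/-- A finite set of vectors with Gram matrix entries in `{0, 1, 2}` modelled on the roots of a
simply laced root system having inner product `1` with a root `a` and `0` with another such root; the vector
`p` is `2a - x₀`. The set is closed under completing an orthogonal pair to a triple of sum `p`. -/
structure IsTripleSystem (β : LinearMap.BilinForm ℝ E) (p : E) (D : Finset E) : Prop where
  norm : ∀ x ∈ D, β x x = 2
  norm_sum : β p p = 6
  inner_sum : ∀ x ∈ D, β x p = 2
  inner : ∀ x ∈ D, ∀ y ∈ D, x ≠ y → β x y = 0 ∨ β x y = 1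
  mem : ∀ x ∈ D, ∀ y ∈ D, β x y = 0 → p - x - y ∈ D

namespace IsTripleSystem
variable {p : E} {D : Finset E} (h : IsSymmPosDef β) (hD : IsTripleSystem β p D)
include h hD

open scoped Classical in
lemma card_orthogonal_le (x : E) (hx : x ∈ D) :
    (D.filter (fun y => β x y = 0)).card ≤ 2 * finrank ℝ E := by
  set f : E → E := fun y => (2 : ℝ) • y - (p - x) with hf
  have hinj : Function.Injective f := by
    intro y y' hyy
    simpa [hf] using hyy
  rw [← Finset.card_image_of_injective _ hinj]
  have key : ∀ y ∈ D, β x y = 0 → ∀ y' ∈ D, β x y' = 0 → β (f y) (f y') = 4 * β y y' - 4 := by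
    intro y hy hxy y' hy' hxy'
    simp only [hf, map_sub, map_smul, LinearMap.sub_apply, LinearMap.smul_apply, smul_eq_mul,
      hxy', hxy, h.symm y x, h.symm p x, h.symm p y', hD.inner_sum x hx, hD.inner_sum y hy,
      hD.inner_sum y' hy', hD.norm_sum, hD.norm x hx]
    ring
  refine h.card_le_two_mul_finrank _ ?_ ?_
  · simp only [Finset.mem_image, Finset.mem_filter]
    rintro _ ⟨y, ⟨hy, hxy⟩, rfl⟩ h0
    have := key y hy hxy y hy hxy
    rw [h0, hD.norm y hy] at this
    norm_num at this
  · simp only [Finset.mem_image, Finset.mem_filter]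
    rintro _ ⟨y, ⟨hy, hxy⟩, rfl⟩ _ ⟨y', ⟨hy', hxy'⟩, rfl⟩
    have k1 := key y hy hxy y' hy' hxy'
    have k2 := key y hy hxy y hy hxy
    have k3 := key y' hy' hxy' y' hy' hxy'
    rw [hD.norm y hy] at k2
    rw [hD.norm y' hy'] at k3
    by_cases hyy : y = y'
    · exact Or.inl (by rw [hyy])
    rcases hD.inner y hy y' hy' hyy with h0 | h1
    · right; left
      exact h.eq_neg_of_le (by rw [k1, k2, k3, h0]; norm_num)
    · right; right
      rw [k1, h1]; norm_num

omit h in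
lemma card_le_of_inner_eq_one (h1 : ∀ x ∈ D, ∀ y ∈ D, x ≠ y → β x y = 1) :
    D.card ≤ finrank ℝ E := by
  have hli : LinearIndependent ℝ (fun x : D => (x : E)) := by
    rw [Fintype.linearIndependent_iff]
    intro g hg y
    have e1 : ∑ x : D, g x * 2 = 0 := by
      have := congrArg (fun v => β v p) hg
      simp only [map_sum, LinearMap.sum_apply, map_smul, LinearMap.smul_apply, smul_eq_mul,
        map_zero, LinearMap.zero_apply] at this
      rw [← this]
      exact Finset.sum_congr rfl fun x _ => by rw [hD.inner_sum x x.2]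
    have e2 : ∑ x : D, g x * β x y = 0 := by
      have := congrArg (fun v => β v y) hg
      simpa only [map_sum, LinearMap.sum_apply, map_smul, LinearMap.smul_apply, smul_eq_mul,
        map_zero, LinearMap.zero_apply] using this
    have e3 : ∑ x : D, g x * (β x y - 1) = g y := by
      rw [Finset.sum_eq_single y]
      · rw [hD.norm y y.2]; ring
      · intro x _ hxy
        rw [h1 x x.2 y y.2 (fun hc => hxy (Subtype.ext hc))]; ring
      · simp
    rw [← Finset.sum_mul] at e1
    simp only [mul_sub, mul_one, Finset.sum_sub_distrib] at e3
    linarith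
  simpa using hli.fintype_card_le_finrank

omit [FiniteDimensional ℝ E] in
open scoped Classical in
lemma card_orthogonal_le_ten {u ζ : E} (hu : u ∈ D) (hζ : ζ ∈ D) (huζ : β ζ u = 1) :
    (D.filter (fun y => β u y = 0)).card ≤ 10 := by
  set N := D.filter (fun y => β u y = 0) with hN
  set N₀ := N.filter (fun y => β ζ y = 0) with hN₀
  have mN : ∀ y, y ∈ N ↔ y ∈ D ∧ β u y = 0 := fun y => by rw [hN, Finset.mem_filter]
  have mN₀ : ∀ y, y ∈ N₀ ↔ y ∈ N ∧ β ζ y = 0 := fun y => by rw [hN₀, Finset.mem_filter]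
  have hsub : N ⊆ N₀ ∪ N₀.image (fun y => p - u - y) := by
    intro y hy
    obtain ⟨hyD, huy⟩ := (mN y).1 hy
    rw [Finset.mem_union, Finset.mem_image]
    have hne : ζ ≠ y := by
      rintro rfl
      rw [h.symm] at huy
      rw [huy] at huζ
      exact zero_ne_one huζ
    rcases hD.inner ζ hζ y hyD hne with h0 | h1
    · exact Or.inl ((mN₀ y).2 ⟨hy, h0⟩)
    · right
      refine ⟨p - u - y, ?_, by abel⟩
      rw [mN₀, mN]
      refine ⟨⟨hD.mem u hu y hyD huy, ?_⟩, ?_⟩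
      · simp only [map_sub, hD.inner_sum u hu, hD.norm u hu, huy]; norm_num
      · simp only [map_sub, hD.inner_sum ζ hζ, huζ, h1]; norm_num
  have hone : ∀ y ∈ N₀, ∀ y' ∈ N₀, y ≠ y' → β y y' = 1 := by
    intro y hy y' hy' hne
    obtain ⟨hyN, hζy⟩ := (mN₀ y).1 hy
    obtain ⟨hyD, huy⟩ := (mN y).1 hyN
    obtain ⟨hyN', hζy'⟩ := (mN₀ y').1 hy'
    obtain ⟨hyD', huy'⟩ := (mN y').1 hyN'
    refine (hD.inner y hyD y' hyD' hne).resolve_left fun h0 => ?_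
    have hz : y + y' = p - u := by
      refine h.eq_of_le ?_
      simp only [map_sub, map_add, LinearMap.sub_apply, LinearMap.add_apply, h.symm y' y, h0,
        h.symm y u, h.symm y' u, h.symm p u, huy, huy', hD.inner_sum u hu, hD.norm u hu,
        hD.inner_sum y hyD, hD.inner_sum y' hyD', hD.norm y hyD, hD.norm y' hyD', hD.norm_sum]
      norm_num
    have := congrArg (β ζ) hz
    rw [map_add, map_sub, hζy, hζy', hD.inner_sum ζ hζ, huζ] at this
    norm_num at this
  set s := ∑ y ∈ N₀, y with hs
  have hss : β s s = N₀.card ^ 2 + N₀.card := by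
    have e : ∀ y ∈ N₀, β s y = N₀.card + 1 := by
      intro y hy
      have hyD := ((mN y).1 ((mN₀ y).1 hy).1).1
      have e1 : ∑ x ∈ N₀, (β x y - 1) = 1 := by
        rw [Finset.sum_eq_single_of_mem y hy]
        · rw [hD.norm y hyD]; norm_num
        · intro x hx hxy
          rw [hone x hx y hy hxy, sub_self]
      rw [Finset.sum_sub_distrib, Finset.sum_const, nsmul_eq_mul, mul_one] at e1
      rw [hs, map_sum, LinearMap.sum_apply]
      linarith
    conv_lhs => rw [hs]
    rw [← hs, map_sum, Finset.sum_congr rfl e, Finset.sum_const, nsmul_eq_mul]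
    ring
  set v := (3 : ℝ) • p - (2 : ℝ) • u - (2 : ℝ) • ζ with hv
  have hvv : β v v = 30 := by
    simp only [hv, map_sub, map_smul, LinearMap.sub_apply, LinearMap.smul_apply, smul_eq_mul,
      h.symm p u, h.symm p ζ, h.symm u ζ, huζ, hD.inner_sum u hu, hD.inner_sum ζ hζ,
      hD.norm u hu, hD.norm ζ hζ, hD.norm_sum]
    norm_num
  have hsv : β s v = 6 * N₀.card := by
    rw [hs, map_sum, LinearMap.sum_apply]
    have e : ∀ y ∈ N₀, β y v = 6 := by
      intro y hy
      obtain ⟨hyN, hζy⟩ := (mN₀ y).1 hy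
      obtain ⟨hyD, huy⟩ := (mN y).1 hyN
      simp only [hv, map_sub, map_smul, smul_eq_mul, h.symm y u, h.symm y ζ, huy, hζy,
        hD.inner_sum y hyD]
      norm_num
    rw [Finset.sum_congr rfl e, Finset.sum_const, nsmul_eq_mul, mul_comm]
  have hcs := h.sq_le s v
  rw [hss, hsv, hvv] at hcs
  have hk : N₀.card ≤ 5 := by
    by_contra hc
    have hc' : (6 : ℝ) ≤ N₀.card := by exact_mod_cast not_le.mp hc
    nlinarith
  have h1 := Finset.card_le_card hsub
  have h2 := Finset.card_union_le N₀ (N₀.image (fun y => p - u - y))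
  have h3 : (N₀.image (fun y => p - u - y)).card ≤ N₀.card := Finset.card_image_le
  omega

theorem card_le : D.card ≤ 3 * finrank ℝ E + 14 := by
  classical
  by_cases hadj : ∀ x ∈ D, ∀ y ∈ D, x ≠ y → β x y = 1
  · have := hD.card_le_of_inner_eq_one hadj
    omega
  push Not at hadj
  obtain ⟨x, hx, y, hy, hxy, hne⟩ := hadj
  have h0 : β x y = 0 := (hD.inner x hx y hy hxy).resolve_right hne
  set δ := p - x - y with hδ
  have hδD : δ ∈ D := hD.mem x hx y hy h0
  have hxδ : β x δ = 0 := by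
    simp only [hδ, map_sub, hD.inner_sum x hx, hD.norm x hx, h0]; norm_num
  have hyδ : β y δ = 0 := by
    simp only [hδ, map_sub, hD.inner_sum y hy, hD.norm y hy, h.symm y x, h0]; norm_num
  set N : E → Finset E := fun u => D.filter (fun z => β u z = 0) with hN
  have mN : ∀ u z, z ∈ N u ↔ z ∈ D ∧ β u z = 0 := fun u z => by rw [hN, Finset.mem_filter]
  have hcover : D ⊆ N x ∪ ((N y).erase δ ∪ (N δ).erase x) := by
    intro ζ hζ
    simp only [Finset.mem_union, Finset.mem_erase, mN]
    by_cases hζδ : ζ = δ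
    · subst hζδ; exact Or.inl ⟨hζ, hxδ⟩
    by_cases hζx : ζ = x
    · subst hζx
      exact Or.inr (Or.inl ⟨hζδ, hζ, by rw [h.symm, h0]⟩)
    by_cases hζy : ζ = y
    · subst hζy; exact Or.inl ⟨hζ, h0⟩
    rcases hD.inner x hx ζ hζ (Ne.symm hζx) with h1 | h1
    · exact Or.inl ⟨hζ, h1⟩
    rcases hD.inner y hy ζ hζ (Ne.symm hζy) with h2 | h2
    · exact Or.inr (Or.inl ⟨hζδ, hζ, h2⟩)
    right; right
    refine ⟨hζx, hζ, ?_⟩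
    rw [hδ, h.symm]
    simp only [map_sub, hD.inner_sum ζ hζ, h.symm ζ x, h.symm ζ y, h1, h2]
    norm_num
  have c1 := Finset.card_le_card hcover
  have c2 := Finset.card_union_le (N x) ((N y).erase δ ∪ (N δ).erase x)
  have c3 := Finset.card_union_le ((N y).erase δ) ((N δ).erase x)
  have c4 : ((N y).erase δ).card = (N y).card - 1 :=
    Finset.card_erase_of_mem ((mN y δ).2 ⟨hδD, hyδ⟩)
  have c5 : ((N δ).erase x).card = (N δ).card - 1 :=
    Finset.card_erase_of_mem ((mN δ x).2 ⟨hx, by rw [h.symm, hxδ]⟩)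
  have key : ∀ u ∈ D, (N u).card ≤ 2 * finrank ℝ E ∧
      (D.card ≤ 2 * finrank ℝ E + 1 ∨ (N u).card ≤ 10) := by
    intro u hu
    have b1 := hD.card_orthogonal_le h u hu
    refine ⟨b1, ?_⟩
    by_cases hall : ∀ ζ ∈ D, ζ ≠ u → β ζ u = 0
    · left
      have hs : D ⊆ insert u (N u) := by
        intro ζ hζ
        rw [Finset.mem_insert, mN]
        by_cases hζu : ζ = u
        · exact Or.inl hζu
        · exact Or.inr ⟨hζ, by rw [h.symm]; exact hall ζ hζ hζu⟩
      have := Finset.card_le_card hs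
      have b2 := Finset.card_insert_le u (N u)
      have b3 : (N u).card ≤ 2 * finrank ℝ E := b1
      omega
    · right
      push Not at hall
      obtain ⟨ζ, hζ, hζu, hn⟩ := hall
      exact hD.card_orthogonal_le_ten h hu hζ ((hD.inner ζ hζ u hu hζu).resolve_left hn)
  obtain ⟨kx, kx'⟩ := key x hx
  obtain ⟨ky, ky'⟩ := key y hy
  obtain ⟨kδ, kδ'⟩ := key δ hδD
  omega

end IsTripleSystem
end OrthogonalToRoot

section RootSet
variable {E : Type*} [AddCommGroup E] [Module ℝ E]

/-- A finite reduced crystallographic set of roots with respect to a bilinear form. -/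
structure IsRootSet (β : LinearMap.BilinForm ℝ E) (Φ : Finset E) : Prop where
  posDef : IsSymmPosDef β
  zero_notMem : (0 : E) ∉ Φ
  integral : ∀ a ∈ Φ, ∀ b ∈ Φ, ∃ z : ℤ, 2 * β a b = z * β b b
  reflection_mem : ∀ a ∈ Φ, ∀ b ∈ Φ, b - (2 * β b a / β a a) • a ∈ Φ
  reduced : ∀ a ∈ Φ, ∀ c : ℝ, c • a ∈ Φ → c = 1 ∨ c = -1

namespace IsRootSet
variable {β : LinearMap.BilinForm ℝ E} {Φ : Finset E} (h : IsRootSet β Φ)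
include h

lemma norm_pos {a : E} (ha : a ∈ Φ) : 0 < β a a :=
  h.posDef.pos a fun h0 => h.zero_notMem (h0 ▸ ha)

lemma sub_smul_mem {a b : E} (ha : a ∈ Φ) (hb : b ∈ Φ) {c : ℝ} (hc : 2 * β b a = c * β a a) :
    b - c • a ∈ Φ := by
  have := h.reflection_mem a ha b hb
  rwa [hc, mul_div_cancel_right₀ _ (h.norm_pos ha).ne'] at this

lemma neg_mem {a : E} (ha : a ∈ Φ) : -a ∈ Φ := by
  have := h.sub_smul_mem ha ha (c := 2) rfl
  rwa [two_smul, sub_add_cancel_left] at this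

lemma smul {t : ℝ} (ht : 0 < t) : IsRootSet (t • β) Φ where
  posDef := ⟨fun x y => by simp [h.posDef.symm x y], fun x hx => by
    simpa using mul_pos ht (h.posDef.pos x hx)⟩
  zero_notMem := h.zero_notMem
  integral a ha b hb := by
    obtain ⟨z, hz⟩ := h.integral a ha b hb
    refine ⟨z, ?_⟩
    simp only [LinearMap.smul_apply, smul_eq_mul]
    linear_combination t * hz
  reflection_mem a ha b hb := by
    refine (congrArg (fun c : ℝ => b - c • a ∈ Φ) ?_).mp (h.reflection_mem a ha b hb)
    have := (h.norm_pos ha).ne'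
    simp only [LinearMap.smul_apply, smul_eq_mul]
    field_simp
  reduced := h.reduced

section Neighbours
variable {a : E} (ha : a ∈ Φ) (haa : β a a = 2)
include ha haa

lemma norm_cases {x : E} (hx : x ∈ Φ) (hxa : β x a = 1) :
    β x x = 2 ∨ β x x = 1 ∨ β x x = 2 / 3 := by
  obtain ⟨z, hz⟩ := h.integral a ha x hx
  rw [h.posDef.symm, hxa] at hz
  have hpos := h.norm_pos hx
  have hcs := h.posDef.sq_le x a
  rw [hxa, haa] at hcs
  have hz0 : 0 < z := by
    by_contra hc
    have : (z : ℝ) ≤ 0 := by exact_mod_cast not_lt.mp hc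
    nlinarith
  have hz4 : z < 4 := by
    by_contra hc
    have hz4 : (4 : ℝ) ≤ z := by exact_mod_cast not_lt.mp hc
    have hxx : β x x = 1 / 2 := by nlinarith
    have e : (1 / 2 : ℝ) • a = x := by
      refine h.posDef.eq_of_le ?_
      simp only [map_smul, LinearMap.smul_apply, smul_eq_mul, haa, hxx, h.posDef.symm a x, hxa]
      norm_num
    have := h.reduced a ha (1 / 2) (e ▸ hx)
    norm_num at this
  interval_cases z
  · left; push_cast at hz; linarith
  · right; left; push_cast at hz; linarith
  · right; right; push_cast at hz; linarith

lemma sub_mem {x : E} (hx : x ∈ Φ) (hxa : β x a = 1) : a - x ∈ Φ := by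
  have := h.neg_mem (h.sub_smul_mem ha hx (c := 1) (by rw [hxa, haa]; norm_num))
  rwa [one_smul, neg_sub] at this

omit h ha in
lemma inner_sub {x : E} (hxa : β x a = 1) : β (a - x) a = 1 := by
  rw [map_sub, LinearMap.sub_apply, hxa, haa]; norm_num

omit ha in
lemma norm_sub {x : E} (hxa : β x a = 1) : β (a - x) (a - x) = β x x := by
  rw [h.posDef.sub_self, haa, h.posDef.symm a x, hxa]; ring

omit ha in
lemma inner_shift {x y : E} (hxa : β x a = 1) (hya : β y a = 1) :
    β (x - (1 / 2 : ℝ) • a) (y - (1 / 2 : ℝ) • a) = β x y - 1 / 2 := by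
  simp only [map_sub, map_smul, LinearMap.sub_apply, LinearMap.smul_apply, smul_eq_mul,
    h.posDef.symm a y, hxa, hya, haa]
  ring

lemma mem_of_norm_eq {b : E} (hb : b ∈ Φ) (hba : β b a = 1) (hbb : β b b = 2 / 3)
    {x : E} (hx : x ∈ Φ) (hxa : β x a = 1) :
    x = b ∨ x = a - b ∨ x = (3 : ℝ) • b - a ∨ x = (2 : ℝ) • a - (3 : ℝ) • b := by
  obtain ⟨k, hk⟩ := h.integral x hx b hb
  obtain ⟨z, hz⟩ := h.integral b hb x hx
  rw [h.posDef.symm] at hz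
  rw [hbb] at hk
  have hcs := h.posDef.sq_le (x - (1 / 2 : ℝ) • a) (b - (1 / 2 : ℝ) • a)
  rw [h.inner_shift haa hxa hba, h.inner_shift haa hxa hxa, h.inner_shift haa hba hba, hbb] at hcs
  have hxb : β x b = k / 3 := by linarith
  rw [hxb] at hcs hz
  rcases h.norm_cases ha haa hx hxa with hn | hn | hn
  · rw [hn] at hcs hz
    have hzk : (k : ℝ) / 3 = z := by linarith
    rw [hzk] at hcs hxb
    have z1 : z < 2 := by
      by_contra hc
      have : (2 : ℝ) ≤ z := by exact_mod_cast not_lt.mp hc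
      nlinarith
    have z0 : -1 < z := by
      by_contra hc
      have : (z : ℝ) ≤ -1 := by exact_mod_cast not_lt.mp hc
      nlinarith
    interval_cases z
    · right; right; right
      refine h.posDef.eq_of_le ?_
      simp only [map_sub, map_smul, LinearMap.sub_apply, LinearMap.smul_apply, smul_eq_mul,
        h.posDef.symm a b, hxa, hba, haa, hbb, hn, hxb]
      norm_num
    · right; right; left
      refine h.posDef.eq_of_le ?_
      simp only [map_sub, map_smul, LinearMap.sub_apply, LinearMap.smul_apply, smul_eq_mul,
        h.posDef.symm a b, hxa, hba, haa, hbb, hn, hxb]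
      norm_num
  · exfalso
    rw [hn] at hcs hz
    have k1 : k < 3 := by
      by_contra hc
      have : (3 : ℝ) ≤ k := by exact_mod_cast not_lt.mp hc
      nlinarith
    have k0 : 0 < k := by
      by_contra hc
      have : (k : ℝ) ≤ 0 := by exact_mod_cast not_lt.mp hc
      nlinarith
    have h3 : (2 * k : ℝ) = 3 * z := by linarith
    have h3' : 2 * k = 3 * z := by exact_mod_cast h3
    omega
  · rw [hn] at hcs
    have k1 : k < 3 := by
      by_contra hc
      have : (3 : ℝ) ≤ k := by exact_mod_cast not_lt.mp hc
      nlinarith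
    have k0 : 0 < k := by
      by_contra hc
      have : (k : ℝ) ≤ 0 := by exact_mod_cast not_lt.mp hc
      nlinarith
    interval_cases k
    · right; left
      refine h.posDef.eq_of_le ?_
      simp only [map_sub, LinearMap.sub_apply,
        h.posDef.symm a b, hxa, hba, haa, hbb, hn, hxb]
      norm_num
    · left
      refine h.posDef.eq_of_le ?_
      rw [hn, hbb, hxb]
      norm_num

end Neighbours
end IsRootSet
end RootSet

section RootSet
variable {E : Type*} [AddCommGroup E] [Module ℝ E] [FiniteDimensional ℝ E]
variable {β : LinearMap.BilinForm ℝ E} {Φ : Finset E}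

namespace IsRootSet
variable (h : IsRootSet β Φ) {a : E} (ha : a ∈ Φ) (haa : β a a = 2)
include h haa

omit [FiniteDimensional ℝ E] in
lemma short_cases {x y : E} (hx : x ∈ Φ) (hxa : β x a = 1) (hxx : β x x = 1)
    (hy : y ∈ Φ) (hya : β y a = 1) (hyy : β y y = 1) :
    x = y ∨ x = a - y ∨ β x y = 1 / 2 := by
  obtain ⟨z, hz⟩ := h.integral x hx y hy
  rw [hyy, mul_one] at hz
  have hcs := h.posDef.sq_le (x - (1 / 2 : ℝ) • a) (y - (1 / 2 : ℝ) • a)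
  rw [h.inner_shift haa hxa hya, h.inner_shift haa hxa hxa, h.inner_shift haa hya hya, hxx,
    hyy] at hcs
  have hxy : β x y = z / 2 := by linarith
  rw [hxy] at hcs
  have z1 : z < 3 := by
    by_contra hc
    have : (3 : ℝ) ≤ z := by exact_mod_cast not_lt.mp hc
    nlinarith
  have z0 : -1 < z := by
    by_contra hc
    have : (z : ℝ) ≤ -1 := by exact_mod_cast not_lt.mp hc
    nlinarith
  interval_cases z
  · right; left
    refine h.posDef.eq_of_le ?_
    simp only [map_sub, LinearMap.sub_apply, h.posDef.symm a y, hxa, hya, haa, hxx, hyy, hxy]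
    norm_num
  · right; right
    rw [hxy]; norm_num
  · left
    refine h.posDef.eq_of_le ?_
    rw [hxx, hyy, hxy]; norm_num

lemma card_short_le (S : Finset E) (hS : ∀ x ∈ S, x ∈ Φ ∧ β x a = 1 ∧ β x x = 1) :
    S.card ≤ 2 * finrank ℝ E := by
  classical
  have hinj : Function.Injective fun x : E => x - (1 / 2 : ℝ) • a := fun x y hxy => by
    simpa using hxy
  rw [← Finset.card_image_of_injective _ hinj]
  refine h.posDef.card_le_two_mul_finrank _ ?_ ?_
  · simp only [Finset.mem_image]
    rintro _ ⟨x, hx, rfl⟩ h0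
    obtain ⟨-, hxa, hxx⟩ := hS x hx
    have := h.inner_shift haa hxa hxa
    rw [h0, hxx] at this
    norm_num at this
  · simp only [Finset.mem_image]
    rintro _ ⟨x, hx, rfl⟩ _ ⟨y, hy, rfl⟩
    obtain ⟨hx, hxa, hxx⟩ := hS x hx
    obtain ⟨hy, hya, hyy⟩ := hS y hy
    rcases h.short_cases haa hx hxa hxx hy hya hyy with e | e | e
    · exact Or.inl (by rw [e])
    · right; left
      rw [e]; module
    · right; right
      rw [h.inner_shift haa hxa hya, e]; norm_num

omit [FiniteDimensional ℝ E] in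
lemma long_cases {x y : E} (hx : x ∈ Φ) (hxa : β x a = 1) (hxx : β x x = 2)
    (hy : y ∈ Φ) (hya : β y a = 1) (hyy : β y y = 2) :
    x = y ∨ x = a - y ∨ β x y = 0 ∨ β x y = 1 := by
  obtain ⟨z, hz⟩ := h.integral x hx y hy
  rw [hyy] at hz
  have hcs := h.posDef.sq_le (x - (1 / 2 : ℝ) • a) (y - (1 / 2 : ℝ) • a)
  rw [h.inner_shift haa hxa hya, h.inner_shift haa hxa hxa, h.inner_shift haa hya hya, hxx,
    hyy] at hcs
  have hxy : β x y = z := by linarith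
  rw [hxy] at hcs
  have z1 : z < 3 := by
    by_contra hc
    have : (3 : ℝ) ≤ z := by exact_mod_cast not_lt.mp hc
    nlinarith
  have z0 : -2 < z := by
    by_contra hc
    have : (z : ℝ) ≤ -2 := by exact_mod_cast not_lt.mp hc
    nlinarith
  interval_cases z
  · right; left
    refine h.posDef.eq_of_le ?_
    simp only [map_sub, LinearMap.sub_apply, h.posDef.symm a y, hxa, hya, haa, hxx, hyy, hxy]
    norm_num
  · simp [hxy]
  · simp [hxy]
  · left
    refine h.posDef.eq_of_le ?_
    rw [hxx, hyy, hxy]; norm_num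

omit [FiniteDimensional ℝ E] in
lemma long_short_cases {x b : E} (hx : x ∈ Φ) (hxa : β x a = 1) (hxx : β x x = 2)
    (hb : b ∈ Φ) (hba : β b a = 1) (hbb : β b b = 1) : β x b = 0 ∨ β x b = 1 := by
  obtain ⟨z, hz⟩ := h.integral b hb x hx
  rw [hxx, h.posDef.symm] at hz
  have hcs := h.posDef.sq_le (x - (1 / 2 : ℝ) • a) (b - (1 / 2 : ℝ) • a)
  rw [h.inner_shift haa hxa hba, h.inner_shift haa hxa hxa, h.inner_shift haa hba hba, hxx,
    hbb] at hcs
  have hxy : β x b = z := by linarith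
  rw [hxy] at hcs
  have z1 : z < 2 := by
    by_contra hc
    have : (2 : ℝ) ≤ z := by exact_mod_cast not_lt.mp hc
    nlinarith
  have z0 : -1 < z := by
    by_contra hc
    have : (z : ℝ) ≤ -1 := by exact_mod_cast not_lt.mp hc
    nlinarith
  interval_cases z <;> simp [hxy]

/-- A set of long neighbours of `a`, all having inner product `1` with a short neighbour `b`. -/
lemma card_long_le {b : E} (hb : b ∈ Φ) (hba : β b a = 1) (hbb : β b b = 1) (S : Finset E)
    (hS : ∀ x ∈ S, x ∈ Φ ∧ β x a = 1 ∧ β x x = 2 ∧ β x b = 1) :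
    S.card ≤ 2 * finrank ℝ E ∧ ((∃ c ∈ Φ, β c a = 1 ∧ β c c = 1 ∧ c ≠ b ∧ c ≠ a - b) →
      S.card ≤ 4) := by
  classical
  have hinj : Function.Injective fun x : E => x - b := fun x y hxy => by simpa using hxy
  have key : ∀ x ∈ S, ∀ y ∈ S, β (x - b) (y - b) = β x y - 1 := by
    intro x hx y hy
    simp only [map_sub, LinearMap.sub_apply, h.posDef.symm b y, hbb, (hS x hx).2.2.2,
      (hS y hy).2.2.2]
    ring
  have hpair : ∀ x ∈ S.image (fun x => x - b), ∀ y ∈ S.image (fun x => x - b),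
      x = y ∨ x = -y ∨ β x y = 0 := by
    simp only [Finset.mem_image]
    rintro _ ⟨x, hx, rfl⟩ _ ⟨y, hy, rfl⟩
    have k := key x hx y hy
    have kx := key x hx x hx
    have ky := key y hy y hy
    obtain ⟨hxΦ, hxa, hxx, hxb⟩ := hS x hx
    obtain ⟨hyΦ, hya, hyy, hyb⟩ := hS y hy
    rcases h.long_cases haa hxΦ hxa hxx hyΦ hya hyy with e | e | e | e
    · exact Or.inl (by rw [e])
    · exfalso
      rw [e, map_sub, LinearMap.sub_apply, h.posDef.symm, hba, hyb] at hxb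
      norm_num at hxb
    · right; left
      refine h.posDef.eq_neg_of_le ?_
      rw [k, kx, ky, hxx, hyy, e]; norm_num
    · right; right
      rw [k, e]; norm_num
  rw [← Finset.card_image_of_injective _ hinj]
  constructor
  · refine h.posDef.card_le_two_mul_finrank _ ?_ hpair
    simp only [Finset.mem_image]
    rintro _ ⟨x, hx, rfl⟩ h0
    have := key x hx x hx
    rw [h0, (hS x hx).2.2.1] at this
    norm_num at this
  · rintro ⟨c, hc, hca, hcc, hcb, hcab⟩
    have hbc : β b c = 1 / 2 := by
      rw [h.posDef.symm]
      exact ((h.short_cases haa hc hca hcc hb hba hbb).resolve_left hcb).resolve_left hcab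
    refine h.posDef.card_le_two_mul _ hpair 2 ?_
    intro T hT horth
    have hT1 : ∀ y ∈ T, β y y = 1 := by
      intro y hy
      obtain ⟨x, hx, rfl⟩ := Finset.mem_image.1 (hT hy)
      rw [key x hx x hx, (hS x hx).2.2.1]; norm_num
    have hT2 : ∀ y ∈ T, β y (c - (1 / 2 : ℝ) • a) ^ 2 = 1 / 4 := by
      intro y hy
      obtain ⟨x, hx, rfl⟩ := Finset.mem_image.1 (hT hy)
      obtain ⟨hxΦ, hxa, hxx, hxb⟩ := hS x hx
      simp only [map_sub, map_smul, LinearMap.sub_apply, smul_eq_mul, hxa, hba, hbc]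
      rcases h.long_short_cases haa hxΦ hxa hxx hc hca hcc with e | e <;> rw [e] <;> norm_num
    have hbes := h.posDef.bessel T horth 1 one_pos hT1 (c - (1 / 2 : ℝ) • a)
    rw [Finset.sum_congr rfl hT2, Finset.sum_const, nsmul_eq_mul, h.inner_shift haa hca hca,
      hcc] at hbes
    have : (T.card : ℝ) ≤ 2 := by linarith
    exact_mod_cast this

include ha

lemma card_long_le_of_simplyLaced (S : Finset E)
    (hS : ∀ x, x ∈ S ↔ x ∈ Φ ∧ β x a = 1) (hlong : ∀ x ∈ S, β x x = 2) :
    S.card ≤ 6 * finrank ℝ E + 30 := by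
  classical
  rcases S.eq_empty_or_nonempty with rfl | ⟨x₀, hx₀⟩
  · simp
  obtain ⟨hx₀Φ, hx₀a⟩ := (hS x₀).1 hx₀
  have hx₀x₀ := hlong x₀ hx₀
  set D := S.filter (fun x => β x x₀ = 0) with hD
  have mD : ∀ x, x ∈ D ↔ x ∈ S ∧ β x x₀ = 0 := fun x => by rw [hD, Finset.mem_filter]
  have hsubS : ∀ x ∈ S, a - x ∈ S := fun x hx => by
    obtain ⟨hxΦ, hxa⟩ := (hS x).1 hx
    exact (hS _).2 ⟨h.sub_mem ha haa hxΦ hxa, inner_sub haa hxa⟩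
  have hT : IsTripleSystem β ((2 : ℝ) • a - x₀) D := by
    have hp : ∀ x ∈ D, β x ((2 : ℝ) • a - x₀) = 2 := by
      intro x hx
      obtain ⟨hxS, hxx₀⟩ := (mD x).1 hx
      simp only [map_sub, map_smul, smul_eq_mul, ((hS x).1 hxS).2, hxx₀]
      norm_num
    refine ⟨fun x hx => hlong x ((mD x).1 hx).1, ?_, hp, ?_, ?_⟩
    · simp only [map_sub, map_smul, LinearMap.sub_apply, LinearMap.smul_apply, smul_eq_mul,
        h.posDef.symm a x₀, haa, hx₀a, hx₀x₀]
      norm_num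
    · intro x hx y hy hne
      obtain ⟨hxS, hxx₀⟩ := (mD x).1 hx
      obtain ⟨hyS, hyx₀⟩ := (mD y).1 hy
      obtain ⟨hxΦ, hxa⟩ := (hS x).1 hxS
      obtain ⟨hyΦ, hya⟩ := (hS y).1 hyS
      rcases h.long_cases haa hxΦ hxa (hlong x hxS) hyΦ hya (hlong y hyS) with e | e | e
      · exact absurd e hne
      · exfalso
        rw [e, map_sub, LinearMap.sub_apply, h.posDef.symm, hx₀a, hyx₀] at hxx₀
        norm_num at hxx₀
      · exact e
    · intro x hx y hy hxy
      obtain ⟨hxS, hxx₀⟩ := (mD x).1 hx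
      obtain ⟨hyS, hyx₀⟩ := (mD y).1 hy
      obtain ⟨hxΦ, hxa⟩ := (hS x).1 hxS
      obtain ⟨hyΦ, hya⟩ := (hS y).1 hyS
      have h1 : a - x₀ - x ∈ Φ := by
        have := h.sub_smul_mem hxΦ ((hS _).1 (hsubS x₀ hx₀)).1 (c := 1) (by
          rw [map_sub, LinearMap.sub_apply, h.posDef.symm a x, hxa, h.posDef.symm x₀ x, hxx₀,
            hlong x hxS]
          norm_num)
        rwa [one_smul] at this
      have h2 : a - x₀ - x - y ∈ Φ := by
        have := h.sub_smul_mem hyΦ h1 (c := 1) (by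
          simp only [map_sub, LinearMap.sub_apply]
          rw [h.posDef.symm a y, hya, h.posDef.symm x₀ y, hyx₀, hlong y hyS, hxy]
          norm_num)
        rwa [one_smul] at this
      have h3 : (2 : ℝ) • a - x₀ - x - y ∈ Φ := by
        have := h.sub_smul_mem ha h2 (c := -1) (by
          simp only [map_sub, LinearMap.sub_apply]
          rw [hxa, hya, hx₀a, haa]
          norm_num)
        have e : a - x₀ - x - y - (-1 : ℝ) • a = (2 : ℝ) • a - x₀ - x - y := by module
        rwa [e] at this
      rw [mD, hS]
      refine ⟨⟨h3, ?_⟩, ?_⟩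
      · simp only [map_sub, map_smul, LinearMap.sub_apply, LinearMap.smul_apply, smul_eq_mul,
          hxa, hya, hx₀a, haa]
        norm_num
      · simp only [map_sub, map_smul, LinearMap.sub_apply, LinearMap.smul_apply, smul_eq_mul,
          hxx₀, hyx₀, hx₀x₀, h.posDef.symm a x₀, hx₀a]
        norm_num
  have hcard := hT.card_le h.posDef
  have hcover : S ⊆ {x₀, a - x₀} ∪ (D ∪ D.image (fun x => a - x)) := by
    intro x hx
    obtain ⟨hxΦ, hxa⟩ := (hS x).1 hx
    simp only [Finset.mem_union, Finset.mem_insert, Finset.mem_singleton, Finset.mem_image]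
    rcases h.long_cases haa hxΦ hxa (hlong x hx) hx₀Φ hx₀a hx₀x₀ with e | e | e | e
    · exact Or.inl (Or.inl e)
    · exact Or.inl (Or.inr e)
    · exact Or.inr (Or.inl ((mD x).2 ⟨hx, e⟩))
    · refine Or.inr (Or.inr ⟨a - x, (mD _).2 ⟨hsubS x hx, ?_⟩, by abel⟩)
      rw [map_sub, LinearMap.sub_apply, e, h.posDef.symm, hx₀a, sub_self]
  have c1 := Finset.card_le_card hcover
  have c2 := Finset.card_union_le {x₀, a - x₀} (D ∪ D.image (fun x => a - x))
  have c3 := Finset.card_union_le D (D.image (fun x => a - x))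
  have c4 : (D.image (fun x => a - x)).card ≤ D.card := Finset.card_image_le
  have c5 : ({x₀, a - x₀} : Finset E).card ≤ 2 := Finset.card_le_two
  omega

theorem sum_two_div_norm_le (S : Finset E) (hS : ∀ x, x ∈ S ↔ x ∈ Φ ∧ β x a = 1) :
    ∑ x ∈ S, 2 / β x x ≤ 6 * finrank ℝ E + 30 := by
  classical
  by_cases h3 : ∃ b ∈ S, β b b = 2 / 3
  · obtain ⟨b, hbS, hbb⟩ := h3
    obtain ⟨hb, hba⟩ := (hS b).1 hbS
    have hsub : S ⊆ {b, a - b, (3 : ℝ) • b - a, (2 : ℝ) • a - (3 : ℝ) • b} := by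
      intro x hx
      simp only [Finset.mem_insert, Finset.mem_singleton]
      exact h.mem_of_norm_eq ha haa hb hba hbb ((hS x).1 hx).1 ((hS x).1 hx).2
    have hc : S.card ≤ 4 := (Finset.card_le_card hsub).trans Finset.card_le_four
    have hb3 : ∀ x ∈ S, 2 / β x x ≤ 3 := by
      intro x hx
      rcases h.norm_cases ha haa ((hS x).1 hx).1 ((hS x).1 hx).2 with e | e | e <;> rw [e] <;>
        norm_num
    have := Finset.sum_le_card_nsmul S _ 3 hb3
    rw [nsmul_eq_mul] at this
    have hc' : (S.card : ℝ) ≤ 4 := by exact_mod_cast hc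
    have : (0 : ℝ) ≤ finrank ℝ E := Nat.cast_nonneg _
    linarith
  push Not at h3
  have hn : ∀ x ∈ S, β x x = 2 ∨ β x x = 1 := by
    intro x hx
    rcases h.norm_cases ha haa ((hS x).1 hx).1 ((hS x).1 hx).2 with e | e | e
    · exact Or.inl e
    · exact Or.inr e
    · exact absurd e (h3 x hx)
  by_cases h2 : ∃ b ∈ S, β b b = 1
  · obtain ⟨b, hbS, hbb⟩ := h2
    obtain ⟨hb, hba⟩ := (hS b).1 hbS
    set S₁ := S.filter (fun x => β x x = 1) with hS₁
    set P := S.filter (fun x => β x x = 2 ∧ β x b = 1) with hP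
    set Q := S.filter (fun x => β x x = 2 ∧ β x (a - b) = 1) with hQ
    have hsum : ∑ x ∈ S, 2 / β x x ≤ 2 * S₁.card + P.card + Q.card := by
      have e : ∀ x ∈ S, 2 / β x x ≤ (if β x x = 1 then 2 else 0) +
          (if β x x = 2 ∧ β x b = 1 then 1 else 0) +
          (if β x x = 2 ∧ β x (a - b) = 1 then (1 : ℝ) else 0) := by
        intro x hx
        obtain ⟨hxΦ, hxa⟩ := (hS x).1 hx
        rcases hn x hx with e | e
        · rcases h.long_short_cases haa hxΦ hxa e hb hba hbb with e' | e' <;>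
            simp [e, e', hxa]
        · simp [e]
      refine (Finset.sum_le_sum e).trans (le_of_eq ?_)
      rw [Finset.sum_add_distrib, Finset.sum_add_distrib, ← Finset.sum_filter, ← Finset.sum_filter,
        ← Finset.sum_filter, Finset.sum_const, Finset.sum_const, Finset.sum_const]
      simp only [nsmul_eq_mul, mul_one, ← hS₁, ← hP, ← hQ]
      ring
    have hm : ∀ x ∈ S₁, x ∈ Φ ∧ β x a = 1 ∧ β x x = 1 := by
      intro x hx
      rw [hS₁, Finset.mem_filter, hS] at hx
      exact ⟨hx.1.1, hx.1.2, hx.2⟩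
    have b1 := h.card_short_le haa S₁ hm
    obtain ⟨b2, b2'⟩ := h.card_long_le haa hb hba hbb P fun x hx => by
      rw [hP, Finset.mem_filter, hS] at hx
      exact ⟨hx.1.1, hx.1.2, hx.2⟩
    obtain ⟨b3, b3'⟩ := h.card_long_le haa (h.sub_mem ha haa hb hba) (inner_sub haa hba)
      ((h.norm_sub haa hba).trans hbb) Q fun x hx => by
        rw [hQ, Finset.mem_filter, hS] at hx
        exact ⟨hx.1.1, hx.1.2, hx.2⟩
    have htotal : 2 * S₁.card + P.card + Q.card ≤ 6 * finrank ℝ E + 30 := by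
      by_cases hex : ∃ c ∈ S₁, c ≠ b ∧ c ≠ a - b
      · obtain ⟨c, hc, hcb, hcab⟩ := hex
        obtain ⟨hcΦ, hca, hcc⟩ := hm c hc
        have := b2' ⟨c, hcΦ, hca, hcc, hcb, hcab⟩
        have := b3' ⟨c, hcΦ, hca, hcc, hcab, by rwa [sub_sub_cancel]⟩
        omega
      · push Not at hex
        have hsub : S₁ ⊆ {b, a - b} := by
          intro c hc
          rw [Finset.mem_insert, Finset.mem_singleton]
          by_cases hcb : c = b
          · exact Or.inl hcb
          · exact Or.inr (hex c hc hcb)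
        have : S₁.card ≤ 2 := (Finset.card_le_card hsub).trans Finset.card_le_two
        omega
    exact hsum.trans (by exact_mod_cast htotal)
  · push Not at h2
    have hlong : ∀ x ∈ S, β x x = 2 := fun x hx => (hn x hx).resolve_right (h2 x hx)
    have hc := h.card_long_le_of_simplyLaced ha haa S hS hlong
    have e : ∑ x ∈ S, 2 / β x x = S.card := by
      rw [Finset.sum_congr rfl fun x hx => by rw [hlong x hx]]
      simp
    rw [e]
    exact_mod_cast hc

end IsRootSet
end RootSet

section RootSet
variable {E : Type*} [AddCommGroup E] [Module ℝ E]
variable {β : LinearMap.BilinForm ℝ E} {Φ : Finset E}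

/-- The endomorphism `v ↦ ∑ b ∈ Φ, (2 β(v, b) / β(b, b)) b`. -/
noncomputable def rootOperator (β : LinearMap.BilinForm ℝ E) (Φ : Finset E) : E →ₗ[ℝ] E :=
  ∑ b ∈ Φ, (2 / β b b) • (β.flip b).smulRight b

/-- The eigenvalue of `rootOperator β Φ` on the root `a`. -/
noncomputable def rootEigenvalue (β : LinearMap.BilinForm ℝ E) (Φ : Finset E) (a : E) : ℝ :=
  ∑ b ∈ Φ, 2 * β a b ^ 2 / (β a a * β b b)

lemma rootOperator_apply (v : E) :
    rootOperator β Φ v = ∑ b ∈ Φ, (2 * β v b / β b b) • b := by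
  simp only [rootOperator, LinearMap.sum_apply, LinearMap.smul_apply, LinearMap.smulRight_apply,
    LinearMap.BilinForm.flip_apply, smul_smul]
  exact Finset.sum_congr rfl fun b _ => by congr 1; ring

namespace IsRootSet
variable (h : IsRootSet β Φ)
include h

lemma rootOperator_eq {a : E} (ha : a ∈ Φ) :
    rootOperator β Φ a = rootEigenvalue β Φ a • a := by
  have haa := (h.norm_pos ha).ne'
  set s : E → E := fun b => b - (2 * β b a / β a a) • a with hs
  have hsa : ∀ b, β a (s b) = - β a b := by
    intro b
    simp only [hs, map_sub, map_smul, smul_eq_mul, h.posDef.symm b a]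
    field_simp; ring
  have hss : ∀ b, s (s b) = b := by
    intro b
    have e : β (s b) a = - β b a := by rw [h.posDef.symm, hsa, h.posDef.symm a b]
    change s b - (2 * β (s b) a / β a a) • a = b
    rw [e]
    simp only [hs]
    module
  have hnorm : ∀ b, β (s b) (s b) = β b b := by
    intro b
    simp only [hs, map_sub, map_smul, LinearMap.sub_apply, LinearMap.smul_apply, smul_eq_mul,
      h.posDef.symm a b]
    field_simp; ring
  have e1 : rootOperator β Φ a = ∑ b ∈ Φ, (2 * β a (s b) / β (s b) (s b)) • s b := by
    rw [rootOperator_apply]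
    exact Finset.sum_nbij' s s (fun b hb => h.reflection_mem a ha b hb)
      (fun b hb => h.reflection_mem a ha b hb) (fun b _ => hss b) (fun b _ => hss b)
      (fun b _ => by rw [hss])
  have e2 : rootOperator β Φ a + rootOperator β Φ a = (2 * rootEigenvalue β Φ a) • a := by
    conv_lhs => lhs; rw [rootOperator_apply]
    rw [e1, ← Finset.sum_add_distrib, rootEigenvalue, Finset.mul_sum, Finset.sum_smul]
    refine Finset.sum_congr rfl fun b hb => ?_
    have hbb := (h.norm_pos hb).ne'
    rw [hsa, hnorm]
    have e3 : (2 * (2 * β a b ^ 2 / (β a a * β b b))) =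
        (2 * β a b / β b b) * (2 * β b a / β a a) := by
      rw [h.posDef.symm b a]; field_simp
    rw [e3]
    simp only [hs]
    module
  have e4 : (2 : ℝ) • rootOperator β Φ a = (2 : ℝ) • rootEigenvalue β Φ a • a := by
    rw [two_smul, e2, smul_smul]
  exact smul_right_injective E (two_ne_zero (α := ℝ)) e4

lemma rootOperator_selfAdjoint (v w : E) :
    β (rootOperator β Φ v) w = β v (rootOperator β Φ w) := by
  simp only [rootOperator_apply, map_sum, map_smul, LinearMap.sum_apply, LinearMap.smul_apply,
    smul_eq_mul]
  refine Finset.sum_congr rfl fun b _ => ?_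
  rw [h.posDef.symm w b]; ring

lemma rootEigenvalue_eq {a b : E} (ha : a ∈ Φ) (hb : b ∈ Φ) (hab : β a b ≠ 0) :
    rootEigenvalue β Φ a = rootEigenvalue β Φ b := by
  have := h.rootOperator_selfAdjoint a b
  rw [h.rootOperator_eq ha, h.rootOperator_eq hb] at this
  simp only [map_smul, LinearMap.smul_apply, smul_eq_mul] at this
  exact mul_right_cancel₀ hab this

lemma rootEigenvalue_le_of_norm_eq_two [FiniteDimensional ℝ E] {θ : E} (hθ : θ ∈ Φ)
    (hθθ : β θ θ = 2) (hmax : ∀ b ∈ Φ, β b θ ≠ 0 → β b b ≤ β θ θ) :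
    rootEigenvalue β Φ θ ≤ 6 * finrank ℝ E + 34 := by
  classical
  have hcases : ∀ b ∈ Φ, b = θ ∨ b = -θ ∨ β b θ = 0 ∨ β b θ = 1 ∨ β b θ = -1 := by
    intro b hb
    obtain ⟨z, hz⟩ := h.integral b hb θ hθ
    rw [hθθ] at hz
    have hbz : β b θ = z := by linarith
    by_cases h0 : β b θ = 0
    · simp [h0]
    have hm := hmax b hb h0
    have hcs := h.posDef.sq_le b θ
    rw [hθθ] at hm hcs
    rw [hbz] at hcs
    have z1 : z < 3 := by
      by_contra hc
      have : (3 : ℝ) ≤ z := by exact_mod_cast not_lt.mp hc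
      nlinarith
    have z0 : -3 < z := by
      by_contra hc
      have : (z : ℝ) ≤ -3 := by exact_mod_cast not_lt.mp hc
      nlinarith
    interval_cases z
    · right; left
      exact h.posDef.eq_neg_of_le (by rw [hbz, hθθ]; push_cast; linarith)
    · simp [hbz]
    · simp [hbz]
    · simp [hbz]
    · left
      exact h.posDef.eq_of_le (by rw [hbz, hθθ]; push_cast; linarith)
  set S := Φ.filter (fun x => β x θ = 1) with hS
  set S' := Φ.filter (fun x => β x θ = -1) with hS'
  have hM := h.sum_two_div_norm_le hθ hθθ S (fun x => by rw [hS, Finset.mem_filter])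
  have hneg : ∑ b ∈ S', 1 / β b b = ∑ b ∈ S, 1 / β b b := by
    refine Finset.sum_nbij' (fun x => -x) (fun x => -x) ?_ ?_ (fun x _ => neg_neg x)
      (fun x _ => neg_neg x) (fun x _ => by simp)
    · intro x hx
      rw [hS', Finset.mem_filter] at hx
      rw [hS, Finset.mem_filter]
      exact ⟨h.neg_mem hx.1, by simp [hx.2]⟩
    · intro x hx
      rw [hS, Finset.mem_filter] at hx
      rw [hS', Finset.mem_filter]
      exact ⟨h.neg_mem hx.1, by simp [hx.2]⟩
  have hle : ∀ b ∈ Φ, 2 * β θ b ^ 2 / (β θ θ * β b b) ≤ (if b = θ then 2 else 0) +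
      (if b = -θ then 2 else 0) + (if β b θ = 1 then 1 / β b b else 0) +
      (if β b θ = -1 then 1 / β b b else 0) := by
    intro b hb
    have hbb := h.norm_pos hb
    have hinv : 0 ≤ (β b b)⁻¹ := (inv_pos.mpr hbb).le
    have hne : θ ≠ -θ := by
      intro hc
      have := congrArg (β θ) hc
      rw [map_neg, hθθ] at this
      norm_num at this
    rw [h.posDef.symm θ b]
    rcases hcases b hb with e | e | e | e | e
    · subst e
      simp [hθθ, hne]; norm_num
    · subst e
      simp [hθθ, hne.symm]; norm_num
    · simp only [e]
      norm_num
      positivity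
    · have e' : b ≠ θ := by rintro rfl; rw [hθθ] at e; norm_num at e
      have e'' : b ≠ -θ := by rintro rfl; simp [hθθ] at e; norm_num at e
      simp only [e, e', e'', hθθ, if_true, if_false]
      norm_num
      field_simp
      norm_num
    · have e' : b ≠ θ := by rintro rfl; rw [hθθ] at e; norm_num at e
      have e'' : b ≠ -θ := by rintro rfl; simp [hθθ] at e
      simp only [e, e', e'', hθθ, if_true, if_false]
      norm_num
      field_simp
      norm_num
  have hsum := Finset.sum_le_sum hle
  rw [Finset.sum_add_distrib, Finset.sum_add_distrib, Finset.sum_add_distrib,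
    ← Finset.sum_filter (fun b => β b θ = 1), ← Finset.sum_filter (fun b => β b θ = -1),
    Finset.sum_ite_eq' Φ θ, Finset.sum_ite_eq' Φ (-θ), if_pos hθ, if_pos (h.neg_mem hθ),
    ← hS, ← hS', hneg] at hsum
  have e5 : ∑ x ∈ S, 2 / β x x = ∑ x ∈ S, 1 / β x x + ∑ x ∈ S, 1 / β x x := by
    rw [← Finset.sum_add_distrib]
    exact Finset.sum_congr rfl fun x _ => by ring
  rw [e5] at hM
  rw [rootEigenvalue]
  linarith

lemma rootEigenvalue_le [FiniteDimensional ℝ E] {a : E} (ha : a ∈ Φ) :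
    rootEigenvalue β Φ a ≤ 6 * finrank ℝ E + 34 := by
  classical
  obtain ⟨θ, hθ, hmax⟩ := (Φ.filter (fun b => rootEigenvalue β Φ b = rootEigenvalue β Φ a))
    |>.exists_max_image (fun b => β b b) ⟨a, by simp [ha]⟩
  rw [Finset.mem_filter] at hθ
  obtain ⟨hθ, hlam⟩ := hθ
  have hθθ := h.norm_pos hθ
  have ht : 0 < 2 / β θ θ := by positivity
  have hmax' : ∀ b ∈ Φ, β b θ ≠ 0 → β b b ≤ β θ θ := by
    intro b hb hbθ
    exact hmax b (Finset.mem_filter.2 ⟨hb, (h.rootEigenvalue_eq hb hθ hbθ).trans hlam⟩)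
  have := (h.smul ht).rootEigenvalue_le_of_norm_eq_two hθ
    (by simp only [LinearMap.smul_apply, smul_eq_mul]; field_simp)
    (fun b hb hbθ => by
      simp only [LinearMap.smul_apply, smul_eq_mul] at hbθ ⊢
      exact mul_le_mul_of_nonneg_left (hmax' b hb (right_ne_zero_of_mul hbθ)) ht.le)
  rw [← hlam]
  refine le_of_eq_of_le ?_ this
  refine Finset.sum_congr rfl fun b hb => ?_
  have := (h.norm_pos hb).ne'
  have := hθθ.ne'
  simp only [LinearMap.smul_apply, smul_eq_mul]
  field_simp

theorem card_le [FiniteDimensional ℝ E] (hspan : Submodule.span ℝ (Φ : Set E) = ⊤) :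
    Φ.card ≤ 3 * finrank ℝ E ^ 2 + 17 * finrank ℝ E := by
  have htr : LinearMap.trace ℝ E (rootOperator β Φ) = 2 * Φ.card := by
    rw [rootOperator, map_sum, Finset.sum_congr rfl (g := fun _ => (2 : ℝ))]
    · rw [Finset.sum_const, nsmul_eq_mul, mul_comm]
    · intro b hb
      rw [map_smul, LinearMap.trace_smulRight, LinearMap.BilinForm.flip_apply, smul_eq_mul,
        div_mul_cancel₀ _ (h.norm_pos hb).ne']
  obtain ⟨s, hsΦ, hs, hli⟩ := exists_linearIndependent ℝ (Φ : Set E)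
  have : Fintype s := (Φ.finite_toSet.subset hsΦ).fintype
  let b : Basis s ℝ E := Basis.mk hli (by
    rw [Subtype.range_coe_subtype, Set.ofPred_mem_eq, hs, hspan])
  have hb : ∀ i, b i ∈ Φ := fun i => by
    rw [Basis.mk_apply]; exact hsΦ i.2
  have hle : LinearMap.trace ℝ E (rootOperator β Φ) ≤
      finrank ℝ E * (6 * finrank ℝ E + 34) := by
    classical
    rw [LinearMap.trace_eq_matrix_trace ℝ b, Matrix.trace, finrank_eq_card_basis b,
      ← nsmul_eq_mul]
    refine Finset.sum_le_card_nsmul _ _ _ fun i _ => ?_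
    rw [Matrix.diag_apply, LinearMap.toMatrix_apply, h.rootOperator_eq (hb i), map_smul,
      Finsupp.smul_apply, Basis.repr_self, Finsupp.single_eq_same, smul_eq_mul, mul_one,
      ← finrank_eq_card_basis b]
    exact h.rootEigenvalue_le (hb i)
  rw [htr] at hle
  have : (Φ.card : ℝ) ≤ 3 * finrank ℝ E ^ 2 + 17 * finrank ℝ E := by nlinarith
  exact_mod_cast this

end IsRootSet
end RootSet

namespace RootPairing
variable {ι M N : Type*} [Fintype ι] [AddCommGroup M] [Module ℂ M] [AddCommGroup N] [Module ℂ N]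
  (P : RootPairing ι ℂ M N) [P.IsCrystallographic]

/-- The vector of Cartan integers of a root. -/
noncomputable def cartanVector (i : ι) : ι → ℝ := fun k => P.pairingIn ℤ i k

omit [Fintype ι] in
lemma pairingIn_reflectionPerm_left (i j k : ι) :
    P.pairingIn ℤ (P.reflectionPerm j i) k =
      P.pairingIn ℤ i k - P.pairingIn ℤ i j * P.pairingIn ℤ j k := by
  have h : P.root (P.reflectionPerm j i) =
      (1 : ℤ) • P.root i + (-P.pairingIn ℤ i j) • P.root j := by
    rw [root_reflectionPerm, P.reflection_apply_root' ℤ]; module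
  rw [P.pairingIn_eq_add_of_root_eq_smul_add_smul (S := ℤ) h]
  simp only [smul_eq_mul]; ring

omit [Fintype ι] in
lemma cartanVector_reflectionPerm (i j : ι) :
    P.cartanVector (P.reflectionPerm j i) =
      P.cartanVector i - (P.pairingIn ℤ i j : ℝ) • P.cartanVector j := by
  ext k
  simp only [cartanVector, P.pairingIn_reflectionPerm_left i j k, Pi.sub_apply, Pi.smul_apply,
    smul_eq_mul]
  push_cast; ring

lemma two_mul_cartanVector_dotProduct (i j : ι) :
    2 * (P.cartanVector i ⬝ᵥ P.cartanVector j) =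
      P.pairingIn ℤ i j * (P.cartanVector j ⬝ᵥ P.cartanVector j) := by
  have h : P.cartanVector i ⬝ᵥ P.cartanVector j =
      P.cartanVector (P.reflectionPerm j i) ⬝ᵥ P.cartanVector (P.reflectionPerm j j) := by
    simp only [dotProduct, cartanVector, ← P.pairingIn_reflectionPerm ℤ]
    exact (Equiv.sum_comp (P.reflectionPerm j)
      fun k => (P.pairingIn ℤ i k : ℝ) * (P.pairingIn ℤ j k : ℝ)).symm
  rw [cartanVector_reflectionPerm, cartanVector_reflectionPerm, pairingIn_same, sub_dotProduct,
    dotProduct_sub, dotProduct_sub] at h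
  simp only [smul_dotProduct, dotProduct_smul, smul_eq_mul] at h
  push_cast at h
  linarith

lemma finrank_span_cartanVector_le [FiniteDimensional ℂ M] :
    finrank ℝ (Submodule.span ℝ (Set.range P.cartanVector)) ≤ finrank ℂ M := by
  obtain ⟨b, hb, hspan, hli⟩ := exists_linearIndependent ℂ (Set.range P.root)
  have : Fintype b := ((Set.finite_range P.root).subset hb).fintype
  let f : M → ι → ℝ := fun x k => (P.coroot' k x).re
  have hf : ∀ i, f (P.root i) = P.cartanVector i := by
    intro i
    ext k
    simp only [f, cartanVector, root_coroot'_eq_pairing, ← P.algebraMap_pairingIn ℤ]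
    simp
  have hmem : ∀ x ∈ Submodule.span ℂ b, ∀ z : ℂ, f (z • x) ∈ Submodule.span ℝ (f '' b) := by
    intro x hx
    induction hx using Submodule.span_induction with
    | mem x hx =>
      intro z
      obtain ⟨i, rfl⟩ := hb hx
      have e : f (z • P.root i) = z.re • f (P.root i) := by
        ext k
        simp only [f, map_smul, root_coroot'_eq_pairing, ← P.algebraMap_pairingIn ℤ, Pi.smul_apply,
          smul_eq_mul]
        simp
      rw [e]
      exact Submodule.smul_mem _ _ (Submodule.subset_span ⟨_, hx, rfl⟩)
    | zero =>
      intro z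
      have e : f (z • 0) = 0 := by ext k; simp [f]
      rw [e]; exact Submodule.zero_mem _
    | add x y _ _ hx hy =>
      intro z
      have e : f (z • (x + y)) = f (z • x) + f (z • y) := by
        ext k; simp only [f, smul_add, map_add, Complex.add_re, Pi.add_apply]
      rw [e]; exact Submodule.add_mem _ (hx z) (hy z)
    | smul c x _ hx =>
      intro z
      rw [smul_smul]; exact hx _
  have hle : Submodule.span ℝ (Set.range P.cartanVector) ≤ Submodule.span ℝ (f '' b) := by
    rw [Submodule.span_le]
    rintro _ ⟨i, rfl⟩
    have := hmem (P.root i) (hspan ▸ Submodule.subset_span ⟨i, rfl⟩) 1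
    rwa [one_smul, hf] at this
  classical
  have h1 := Submodule.finrank_mono hle
  have h2 := finrank_span_le_card (R := ℝ) (f '' b)
  have h3 : (f '' b).toFinset.card ≤ Fintype.card b := by
    rw [Set.toFinset_image]
    exact Finset.card_image_le.trans (Set.toFinset_card b).le
  have h4 : Fintype.card b ≤ finrank ℂ M := by
    convert hli.fintype_card_le_finrank
  exact h1.trans (h2.trans (h3.trans h4))

theorem card_le_of_isReduced [P.IsReduced] [FiniteDimensional ℂ M] :
    Fintype.card ι ≤ 3 * finrank ℂ M ^ 2 + 17 * finrank ℂ M := by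
  classical
  set E := Submodule.span ℝ (Set.range P.cartanVector) with hE
  let v : ι → E := fun i => ⟨P.cartanVector i, Submodule.subset_span ⟨i, rfl⟩⟩
  have hv : ∀ i k, (v i : ι → ℝ) k = P.pairingIn ℤ i k := fun _ _ => rfl
  have four : ∀ i j, P.pairingIn ℤ i j * P.pairingIn ℤ j i = 4 →
      P.root i = P.root j ∨ P.root i = -P.root j := by
    intro i j hij
    exact IsReduced.eq_or_eq_neg i j ((P.coxeterWeightIn_eq_four_iff_not_linearIndependent ℤ).1 hij)
  have hinj : Function.Injective v := by
    intro i j hij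
    have h1 : P.pairingIn ℤ i j = 2 := by
      have := hv i j
      rw [hij, hv, pairingIn_same] at this
      exact_mod_cast this.symm
    have h2 : P.pairingIn ℤ j i = 2 := by
      have := hv j i
      rw [← hij, hv, pairingIn_same] at this
      exact_mod_cast this.symm
    exact (P.pairingIn_two_two_iff ℤ i j).1 ⟨h1, h2⟩
  let β : LinearMap.BilinForm ℝ E := (dotProductBilin ℝ ℝ).compl₁₂ E.subtype E.subtype
  have hβ : ∀ x y : E, β x y = (x : ι → ℝ) ⬝ᵥ (y : ι → ℝ) := fun _ _ => rfl
  have hroot : IsRootSet β (Finset.univ.image v) := by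
    have hpd : IsSymmPosDef β := by
      refine ⟨fun x y => by rw [hβ, hβ, dotProduct_comm], fun x hx => ?_⟩
      rw [hβ]
      refine lt_of_le_of_ne (Finset.sum_nonneg fun i _ => mul_self_nonneg _) fun h0 => hx ?_
      exact Subtype.ext (dotProduct_self_eq_zero.1 h0.symm)
    have hv0 : ∀ i, v i ≠ 0 := by
      intro i h0
      have := hv i i
      rw [h0, pairingIn_same] at this
      norm_num at this
    have hpair : ∀ i j, 2 * β (v i) (v j) = P.pairingIn ℤ i j * β (v j) (v j) :=
      fun i j => P.two_mul_cartanVector_dotProduct i j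
    refine ⟨hpd, ?_, ?_, ?_, ?_⟩
    · simp only [Finset.mem_image, Finset.mem_univ, true_and]
      rintro ⟨i, hi⟩
      exact hv0 i hi
    · simp only [Finset.mem_image, Finset.mem_univ, true_and]
      rintro _ ⟨i, rfl⟩ _ ⟨j, rfl⟩
      exact ⟨_, hpair i j⟩
    · simp only [Finset.mem_image, Finset.mem_univ, true_and]
      rintro _ ⟨j, rfl⟩ _ ⟨i, rfl⟩
      refine ⟨P.reflectionPerm j i, Subtype.ext ?_⟩
      rw [hpair i j, mul_div_cancel_right₀ _ (hpd.pos _ (hv0 j)).ne']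
      exact P.cartanVector_reflectionPerm i j
    · simp only [Finset.mem_image, Finset.mem_univ, true_and]
      rintro _ ⟨i, rfl⟩ c ⟨j, hj⟩
      have h1 : (P.pairingIn ℤ j i : ℝ) = c * 2 := by
        have := hv j i
        rw [hj] at this
        rw [← this, Submodule.coe_smul, Pi.smul_apply, hv, pairingIn_same]; norm_num
      have h2 : (2 : ℝ) = c * P.pairingIn ℤ i j := by
        have := hv j j
        rw [hj, pairingIn_same] at this
        rw [← hv i j, ← smul_eq_mul, ← Pi.smul_apply, ← Submodule.coe_smul, this]; norm_num
      have h3 : (P.pairingIn ℤ i j * P.pairingIn ℤ j i : ℝ) = 4 := by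
        rw [h1]; linarith
      rcases four i j (by exact_mod_cast h3) with e | e
      · left
        have : i = j := P.root.injective e
        subst this
        rw [pairingIn_same] at h1
        push_cast at h1; linarith
      · right
        have e' : j = P.reflectionPerm i i := P.root.injective (by
          rw [root_reflectionPerm, reflection_apply_self, e, neg_neg])
        rw [e', pairingIn_reflectionPerm_self_left, pairingIn_same] at h1
        push_cast at h1; linarith
  have hspan : Submodule.span ℝ ((Finset.univ.image v : Finset E) : Set E) = ⊤ := by
    have e : ((Finset.univ.image v : Finset E) : Set E) =
        ((↑) : E → ι → ℝ) ⁻¹' (Set.range P.cartanVector) := by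
      ext x
      simp only [Finset.coe_image, Finset.coe_univ, Set.image_univ, Set.mem_range, Set.mem_preimage]
      exact exists_congr fun i => Subtype.ext_iff
    rw [e]
    exact Submodule.span_span_coe_preimage
  have hcard := hroot.card_le hspan
  rw [Finset.card_image_of_injective _ hinj, Finset.card_univ] at hcard
  have hr : finrank ℝ E ≤ finrank ℂ M := P.finrank_span_cartanVector_le
  refine hcard.trans ?_
  gcongr

end RootPairing

namespace LieAlgebra
variable {L : Type*} [LieRing L] [LieAlgebra ℝ L]

lemma exists_eq_one_tmul_add_I_tmul (z : ℂ ⊗[ℝ] L) :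
    ∃ a b : L, z = (1 : ℂ) ⊗ₜ a + Complex.I ⊗ₜ b := by
  induction z using TensorProduct.induction_on with
  | zero => exact ⟨0, 0, by simp⟩
  | tmul c x =>
    refine ⟨c.re • x, c.im • x, ?_⟩
    rw [tmul_smul, tmul_smul, smul_tmul', smul_tmul', ← add_tmul]
    congr 1
    apply Complex.ext <;> simp
  | add z w hz hw =>
    obtain ⟨a, b, rfl⟩ := hz
    obtain ⟨c, d, rfl⟩ := hw
    exact ⟨a + c, b + d, by rw [tmul_add, tmul_add]; abel⟩

/-- The linear map induced on the complexification by a real linear functional on `ℂ`. -/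
noncomputable def complexificationProj (L : Type*) [LieRing L] [LieAlgebra ℝ L]
    (φ : ℂ →ₗ[ℝ] ℝ) : ℂ ⊗[ℝ] L →ₗ[ℝ] L :=
  (TensorProduct.lid ℝ L).toLinearMap ∘ₗ φ.rTensor L

@[simp] lemma complexificationProj_tmul (φ : ℂ →ₗ[ℝ] ℝ) (c : ℂ) (x : L) :
    complexificationProj L φ (c ⊗ₜ x) = φ c • x := by
  simp [complexificationProj]

instance isKilling_complexification [FiniteDimensional ℝ L] [IsKilling ℝ L] :
    IsKilling ℂ (ℂ ⊗[ℝ] L) := by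
  constructor
  rw [eq_bot_iff]
  intro z hz
  rw [LieIdeal.mem_killingCompl] at hz
  obtain ⟨a, b, rfl⟩ := exists_eq_one_tmul_add_I_tmul z
  have key : ∀ y : L, killingForm ℝ L y a = 0 ∧ killingForm ℝ L y b = 0 := by
    intro y
    have := hz ((1 : ℂ) ⊗ₜ y) trivial
    rw [killingForm, LieModule.traceForm_baseChange] at this
    simp only [map_add, LinearMap.BilinForm.baseChange_tmul] at this
    have h1 := congrArg Complex.re this
    have h2 := congrArg Complex.im this
    simp at h1 h2
    exact ⟨h1, h2⟩
  have hnd := (IsKilling.killingForm_nondegenerate ℝ L).2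
  rw [hnd a fun y => (key y).1, hnd b fun y => (key y).2]
  simp

/-- The complexification of a real Lie subalgebra. -/
noncomputable def complexifiedSubalgebra (H : LieSubalgebra ℝ L) : LieSubalgebra ℂ (ℂ ⊗[ℝ] L) :=
  { H.toSubmodule.baseChange ℂ with
    lie_mem' := by
      intro x y hx hy
      obtain ⟨u, rfl⟩ := hx
      obtain ⟨v, rfl⟩ := hy
      obtain ⟨a, b, rfl⟩ := exists_eq_one_tmul_add_I_tmul (L := H) u
      obtain ⟨c, d, rfl⟩ := exists_eq_one_tmul_add_I_tmul (L := H) v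
      refine ⟨⁅(1 : ℂ) ⊗ₜ[ℝ] a + Complex.I ⊗ₜ b, (1 : ℂ) ⊗ₜ[ℝ] c + Complex.I ⊗ₜ d⁆, ?_⟩
      simp
      abel }

lemma tmul_mem_complexifiedSubalgebra {H : LieSubalgebra ℝ L} (c : ℂ) {x : L} (hx : x ∈ H) :
    c ⊗ₜ x ∈ complexifiedSubalgebra H :=
  Submodule.tmul_mem_baseChange_of_mem (p := H.toSubmodule) c hx

lemma mem_complexifiedSubalgebra_iff {H : LieSubalgebra ℝ L} {a b : L} :
    (1 : ℂ) ⊗ₜ a + Complex.I ⊗ₜ b ∈ complexifiedSubalgebra H ↔ a ∈ H ∧ b ∈ H := by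
  constructor
  · intro h
    have key : ∀ z ∈ complexifiedSubalgebra H, ∀ φ, complexificationProj L φ z ∈ H := by
      intro z hz φ
      obtain ⟨w, rfl⟩ := hz
      induction w using TensorProduct.induction_on with
      | zero => simp
      | tmul c x => simpa using H.smul_mem _ x.2
      | add z w hz hw => rw [map_add, map_add]; exact H.add_mem hz hw
    have h1 := key _ h Complex.reLm
    have h2 := key _ h Complex.imLm
    simp at h1 h2
    exact ⟨h1, h2⟩
  · rintro ⟨ha, hb⟩
    exact add_mem (tmul_mem_complexifiedSubalgebra _ ha) (tmul_mem_complexifiedSubalgebra _ hb)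

lemma finrank_complexifiedSubalgebra_le [FiniteDimensional ℝ L] (H : LieSubalgebra ℝ L) :
    finrank ℂ (complexifiedSubalgebra H) ≤ finrank ℝ H := by
  have h : finrank ℂ (H.toSubmodule.baseChange ℂ) ≤ finrank ℂ (ℂ ⊗[ℝ] H.toSubmodule) :=
    LinearMap.finrank_range_le _
  rw [finrank_baseChange] at h
  exact h

instance isLieAbelian_complexifiedSubalgebra (H : LieSubalgebra ℝ L) [IsLieAbelian H] :
    IsLieAbelian (complexifiedSubalgebra H) := by
  have hab : ∀ x ∈ H, ∀ y ∈ H, ⁅x, y⁆ = 0 := fun x hx y hy =>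
    congrArg Subtype.val (trivial_lie_zero H H ⟨x, hx⟩ ⟨y, hy⟩)
  refine ⟨fun ⟨x, hx⟩ ⟨y, hy⟩ => Subtype.ext ?_⟩
  change ⁅x, y⁆ = 0
  obtain ⟨a, b, rfl⟩ := exists_eq_one_tmul_add_I_tmul x
  obtain ⟨c, d, rfl⟩ := exists_eq_one_tmul_add_I_tmul y
  obtain ⟨ha, hb⟩ := mem_complexifiedSubalgebra_iff.1 hx
  obtain ⟨hc, hd⟩ := mem_complexifiedSubalgebra_iff.1 hy
  simp [hab a ha c hc, hab a ha d hd, hab b hb c hc, hab b hb d hd]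

instance isCartanSubalgebra_complexifiedSubalgebra (H : LieSubalgebra ℝ L) [H.IsCartanSubalgebra]
    [IsLieAbelian H] : (complexifiedSubalgebra H).IsCartanSubalgebra where
  nilpotent := inferInstance
  self_normalizing := by
    refine le_antisymm (fun z hz => ?_) (LieSubalgebra.le_normalizer _)
    obtain ⟨a, b, rfl⟩ := exists_eq_one_tmul_add_I_tmul z
    rw [LieSubalgebra.mem_normalizer_iff] at hz
    have key : ∀ y ∈ H, ⁅a, y⁆ ∈ H ∧ ⁅b, y⁆ ∈ H := by
      intro y hy
      have := hz _ (tmul_mem_complexifiedSubalgebra 1 hy)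
      rw [add_lie, ExtendScalars.bracket_tmul, ExtendScalars.bracket_tmul, mul_one, mul_one,
        mem_complexifiedSubalgebra_iff] at this
      exact this
    rw [mem_complexifiedSubalgebra_iff]
    have hH := LieSubalgebra.IsCartanSubalgebra.self_normalizing (H := H)
    constructor
    · rw [← hH, LieSubalgebra.mem_normalizer_iff]
      exact fun y hy => (key y hy).1
    · rw [← hH, LieSubalgebra.mem_normalizer_iff]
      exact fun y hy => (key y hy).2

end LieAlgebra

namespace LieAlgebra.IsKilling
open LieAlgebra LieModule

theorem finrank_le_finrank_add_card_root {K L : Type*} [Field K] [CharZero K] [LieRing L]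
    [LieAlgebra K L] [FiniteDimensional K L] [IsKilling K L] (H : LieSubalgebra K L)
    [H.IsCartanSubalgebra] [IsTriangularizable K H L] :
    finrank K L ≤ finrank K H + (LieSubalgebra.root (H := H)).card := by
  classical
  have hind := LieSubmodule.iSupIndep_toSubmodule.2 (iSupIndep_genWeightSpace' K H L)
  have htop := LieSubmodule.iSup_toSubmodule_eq_top.2 (iSup_genWeightSpace_eq_top' K H L)
  have hinternal := DirectSum.isInternal_submodule_of_iSupIndep_of_iSup_eq_top hind htop
  rw [← (LinearEquiv.ofBijective (DirectSum.coeLinearMap _) hinternal).finrank_eq, finrank_directSum,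
    ← Finset.sum_filter_add_sum_filter_not _ (fun χ : Weight K H L => χ.IsNonZero), add_comm]
  refine add_le_add ?_
    ((Finset.sum_le_card_nsmul _ _ 1 fun χ hχ => ?_).trans_eq (by rw [smul_eq_mul, mul_one]))
  · have hsub : ∀ χ ∈ Finset.univ.filter (fun χ : Weight K H L => ¬ χ.IsNonZero),
        (χ : H → K) = 0 := fun χ hχ => not_not.1 (Finset.mem_filter.1 hχ).2
    have hcard : (Finset.univ.filter (fun χ : Weight K H L => ¬ χ.IsNonZero)).card ≤ 1 :=
      Finset.card_le_one.2 fun χ hχ ψ hψ => Weight.ext_iff'.1 ((hsub χ hχ).trans (hsub ψ hψ).symm)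
    refine (Finset.sum_le_card_nsmul _ _ (finrank K H) fun χ hχ => ?_).trans ?_
    · rw [hsub χ hχ]
      exact (congrArg (fun N : LieSubmodule K H L => finrank K N) (rootSpace_zero_eq K L H)).le
    · rw [smul_eq_mul]
      exact (Nat.mul_le_mul_right _ hcard).trans_eq (one_mul _)
  · exact (finrank_rootSpace_eq_one χ (Finset.mem_filter.1 hχ).2).le

theorem finrank_le_of_isCartanSubalgebra {L : Type*} [LieRing L] [LieAlgebra ℝ L]
    [FiniteDimensional ℝ L] [IsKilling ℝ L] (H : LieSubalgebra ℝ L) [H.IsCartanSubalgebra] :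
    finrank ℝ L ≤ 3 * finrank ℝ H ^ 2 + 18 * finrank ℝ H := by
  have hr := finrank_complexifiedSubalgebra_le H
  set r := finrank ℝ H
  set C := complexifiedSubalgebra H
  have h1 := finrank_le_finrank_add_card_root C
  rw [finrank_baseChange] at h1
  have h2 := (rootSystem C).card_le_of_isReduced
  rw [Fintype.card_coe, Subspace.dual_finrank_eq] at h2
  have h3 : finrank ℂ C ^ 2 ≤ r ^ 2 := by gcongr
  omega
end LieAlgebra.IsKilling

namespace LieAlgebra
variable {K L L' : Type*} [Field K] [LieRing L] [LieAlgebra K L] [LieRing L'] [LieAlgebra K L']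

lemma isSolvable_of_isSolvable_ker (f : L' →ₗ⁅K⁆ L) [IsSolvable L] [IsSolvable f.ker] :
    IsSolvable L' := by
  obtain ⟨k, hk⟩ := IsSolvable.solvable K L
  obtain ⟨l, hl⟩ := IsSolvable.solvable K f.ker
  refine IsSolvable.mk (R := K) (k := l + k) ?_
  rw [LieIdeal.derivedSeries_eq_bot_iff] at hl
  rw [derivedSeries_def, derivedSeriesOfIdeal_add, eq_bot_iff, ← hl]
  refine derivedSeriesOfIdeal_mono ?_ l
  have := LieIdeal.derivedSeries_map_le k (f := f)
  rw [hk, LieIdeal.map_le_iff_le_comap] at this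
  exact this

lemma isSolvable_comap (f : L' →ₗ⁅K⁆ L) [IsSolvable f.ker] (H : LieSubalgebra K L) [IsSolvable H] :
    IsSolvable (H.comap f) := by
  let g : H.comap f →ₗ⁅K⁆ H :=
    { (f : L' →ₗ[K] L).restrict (p := (H.comap f).toSubmodule) (q := H.toSubmodule)
        fun _ h => h with
      map_lie' := fun {x y} => Subtype.ext (f.map_lie x y) }
  have hg : ∀ x, (g x : L) = f x := fun _ => rfl
  let i : g.ker →ₗ⁅K⁆ f.ker :=
    { toFun := fun x => ⟨x.1.1, f.mem_ker.2 <| by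
        rw [← hg, g.mem_ker.1 x.2]; rfl⟩
      map_add' := fun _ _ => rfl
      map_smul' := fun _ _ => rfl
      map_lie' := rfl }
  have hi : Function.Injective i := fun x y h =>
    Subtype.ext (Subtype.ext (congrArg (fun z : f.ker => (z : L')) h))
  have : IsSolvable g.ker := hi.lieAlgebra_isSolvable
  exact isSolvable_of_isSolvable_ker g

lemma finrank_comap_eq [FiniteDimensional K L'] (f : L' →ₗ⁅K⁆ L) (hf : Function.Surjective f)
    (H : LieSubalgebra K L) : finrank K (H.comap f) = finrank K H + finrank K f.ker := by
  have hker : LinearMap.ker (f : L' →ₗ[K] L) ≤ H.toSubmodule.comap (f : L' →ₗ[K] L) :=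
    fun x hx => by
      rw [Submodule.mem_comap, LinearMap.mem_ker.1 hx]
      exact Submodule.zero_mem _
  have h := LinearMap.finrank_range_add_finrank_ker
    ((f : L' →ₗ[K] L).domRestrict (H.toSubmodule.comap (f : L' →ₗ[K] L)))
  rw [LinearMap.ker_domRestrict, (Submodule.comapSubtypeEquivOfLe hker).finrank_eq,
    LinearMap.range_domRestrict, Submodule.map_comap_eq_of_surjective hf] at h
  exact h.symm

lemma hasTrivialRadical_of_ker_eq_radical [FiniteDimensional K L'] (f : L' →ₗ⁅K⁆ L)
    (hf : Function.Surjective f) (hker : f.ker = radical K L') : HasTrivialRadical K L := by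
  rw [hasTrivialRadical_iff_no_solvable_ideals]
  intro I hI
  have : IsSolvable f.ker := hker ▸ inferInstance
  have : IsSolvable (LieIdeal.toLieSubalgebra K L I) := hI
  have hJ : IsSolvable (LieIdeal.comap f I) := isSolvable_comap f (LieIdeal.toLieSubalgebra K L I)
  have hle := (LieIdeal.solvable_iff_le_radical K L' _).1 hJ
  rw [eq_bot_iff]
  intro y hy
  obtain ⟨x, rfl⟩ := hf y
  exact f.mem_ker.1 (hker ▸ hle hy)

end LieAlgebra

/-- The quotient map of a Lie algebra by an ideal. -/
def LieIdeal.mkHom {K L : Type*} [CommRing K] [LieRing L] [LieAlgebra K L] (I : LieIdeal K L) :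
    L →ₗ⁅K⁆ L ⧸ I :=
  { I.toSubmodule.mkQ with map_lie' := fun {x y} => LieSubmodule.Quotient.mk_bracket I x y }

lemma LieIdeal.mkHom_surjective {K L : Type*} [CommRing K] [LieRing L] [LieAlgebra K L]
    (I : LieIdeal K L) : Function.Surjective I.mkHom :=
  I.toSubmodule.mkQ_surjective

lemma LieIdeal.ker_mkHom {K L : Type*} [CommRing K] [LieRing L] [LieAlgebra K L]
    (I : LieIdeal K L) : I.mkHom.ker = I := by
  ext x
  exact LieSubmodule.Quotient.mk_eq_zero' (N := I)

lemma LieSubalgebra.isLieAbelian_map {K L L' : Type*} [CommRing K] [LieRing L] [LieAlgebra K L]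
    [LieRing L'] [LieAlgebra K L'] (f : L →ₗ⁅K⁆ L') (H : LieSubalgebra K L) [IsLieAbelian H] :
    IsLieAbelian (H.map f) := by
  refine ⟨?_⟩
  rintro ⟨_, x, hx, rfl⟩ ⟨_, y, hy, rfl⟩
  refine Subtype.ext ?_
  change ⁅f x, f y⁆ = 0
  have := congrArg Subtype.val (trivial_lie_zero H H ⟨x, hx⟩ ⟨y, hy⟩)
  rw [← f.map_lie]
  exact (congrArg f this).trans f.map_zero

lemma LieSubalgebra.finrank_map_of_injective {K L L' : Type*} [Field K] [LieRing L]
    [LieAlgebra K L] [LieRing L'] [LieAlgebra K L'] (f : L →ₗ⁅K⁆ L') (hf : Function.Injective f)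
    (H : LieSubalgebra K L) : finrank K (H.map f) = finrank K H :=
  (Submodule.equivMapOfInjective (f : L →ₗ[K] L') hf H.toSubmodule).finrank_eq.symm

/-- If `𝔤` is a finite-dimensional real Lie algebra in which every abelian Lie subalgebra has
dimension at most `n`, then `dim 𝔤 ≤ 4n² + 18n`. -/
theorem dim_le_of_real_lie_algebra
    (L : Type*) [LieRing L] [LieAlgebra ℝ L]
    [FiniteDimensional ℝ L] (n : ℕ)
    (hA : ∀ H : LieSubalgebra ℝ L, IsLieAbelian H → Module.finrank ℝ H ≤ n) :
    Module.finrank ℝ L ≤ 4 * n ^ 2 + 18 * n := by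
  set R := LieAlgebra.radical ℝ L
  let π := R.mkHom
  have hπ : Function.Surjective π := R.mkHom_surjective
  have hker : π.ker = R := R.ker_mkHom
  have : LieAlgebra.HasTrivialRadical ℝ (L ⧸ R) :=
    LieAlgebra.hasTrivialRadical_of_ker_eq_radical π hπ hker
  have : LieAlgebra.IsSolvable π.ker := by rw [hker]; infer_instance
  obtain ⟨x, hx⟩ := LieAlgebra.exists_isCartanSubalgebra_engel ℝ (L ⧸ R)
  set H := LieSubalgebra.engel ℝ x
  have map_le : ∀ {M : Type _} [LieRing M] [LieAlgebra ℝ M] (f : M →ₗ⁅ℝ⁆ L)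
      (_ : Function.Injective f) (A : LieSubalgebra ℝ M), IsLieAbelian A → finrank ℝ A ≤ n := by
    intro M _ _ f hf A hab
    rw [← A.finrank_map_of_injective f hf]
    exact hA _ (A.isLieAbelian_map f)
  obtain ⟨s, hs⟩ := exists_levi_section _ L π (Nat.lt_succ_self _) hπ inferInstance
  have hH : finrank ℝ H ≤ n :=
    map_le s (Function.LeftInverse.injective hs) H inferInstance
  have hS := LieAlgebra.isSolvable_comap π H
  have hSdim : finrank ℝ (H.comap π) ≤ n ^ 2 + n :=
    finrank_le_of_isSolvable n (map_le (H.comap π).incl Subtype.val_injective)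
  rw [LieAlgebra.finrank_comap_eq π hπ] at hSdim
  have hL : finrank ℝ L = finrank ℝ (L ⧸ R) + finrank ℝ π.ker := by
    have := LinearMap.finrank_range_add_finrank_ker (π : L →ₗ[ℝ] L ⧸ R)
    rw [LinearMap.range_eq_top.2 hπ, finrank_top] at this
    exact this.symm
  have hQ := LieAlgebra.IsKilling.finrank_le_of_isCartanSubalgebra H
  have hsq : finrank ℝ H ^ 2 ≤ n ^ 2 := by gcongr
  omega
end

section
/- Let K be a field and let A be a finite-dimensional semisimple unital associative algebra over K. If every commutative (non-unital) subalgebra of A has dimension at most n, then dim A ≤ n². -/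
/-- A finite-dimensional algebra contains a commutative subalgebra equal to its own centralizer. -/
theorem Subalgebra.exists_centralizer_eq_self (K D : Type*) [Field K] [Ring D] [Algebra K D]
    [FiniteDimensional K D] :
    ∃ L : Subalgebra K D, Subalgebra.centralizer K (L : Set D) = L := by
  let P : Subalgebra K D → Prop := fun L ↦ ∀ x ∈ L, ∀ y ∈ L, x * y = y * x
  have hbot : P ⊥ := by
    intro x hx y _
    obtain ⟨k, rfl⟩ := Algebra.mem_bot.mp hx
    exact Algebra.commutes k y
  have hwf : WellFoundedGT (Subalgebra K D) :=
    ⟨(InvImage.wf (fun L : Subalgebra K D ↦ Subalgebra.toSubmodule L)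
      (wellFounded_gt (α := Submodule K D)))⟩
  obtain ⟨L, hL, hmax⟩ := hwf.wf.has_min {L | P L} ⟨⊥, hbot⟩
  refine ⟨L, le_antisymm (fun x hx ↦ ?_) fun x hx y hy ↦ hL y hy x hx⟩
  by_contra hxL
  have hx' : ∀ y ∈ L, y * x = x * y := fun y hy ↦ Subalgebra.mem_centralizer_iff K |>.mp hx y hy
  have hcomm : ∀ a ∈ insert x (L : Set D), ∀ b ∈ insert x (L : Set D), a * b = b * a := by
    rintro a (rfl | ha) b (rfl | hb)
    · rfl
    · exact (hx' b hb).symm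
    · exact hx' a ha
    · exact hL a ha b hb
  refine hmax (Algebra.adjoin K (insert x (L : Set D))) (fun a ha b hb ↦ ?_) ?_
  · exact congrArg Subtype.val
      ((Algebra.isMulCommutative_adjoin K hcomm).is_comm.comm ⟨a, ha⟩ ⟨b, hb⟩)
  · refine lt_of_le_of_ne
      (fun y hy ↦ Algebra.subset_adjoin (Set.mem_insert_of_mem x hy)) fun h ↦ hxL ?_
    rw [h]
    exact Algebra.subset_adjoin (Set.mem_insert x _)

/-- If `b` is left linearly independent over a self-centralizing subalgebra `L` of a division
ring, then the maps `l ↦ l * b j` on `L` are left linearly independent over the division ring. -/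
theorem Subalgebra.eq_zero_of_forall_sum_mul_mul_eq_zero {K D ι : Type*} [Field K]
    [DivisionRing D] [Algebra K D] (L : Subalgebra K D)
    (hL : Subalgebra.centralizer K (L : Set D) = L) {b : ι → D} (hb : LinearIndependent L b)
    (s : Finset ι) :
    ∀ c : ι → D, (∀ l ∈ L, ∑ j ∈ s, c j * l * b j = 0) → ∀ j ∈ s, c j = 0 := by
  classical
  induction s using Finset.induction_on with
  | empty => simp
  | insert i t hi ih =>
    intro c hc
    by_cases h0 : c i = 0
    · have := ih c fun l hl ↦ by simpa [Finset.sum_insert hi, h0] using hc l hl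
      simpa [h0] using this
    exfalso
    set a : ι → D := fun j ↦ (c i)⁻¹ * c j with ha
    have hai : a i = 1 := inv_mul_cancel₀ h0
    have hac (l : D) (hl : l ∈ L) : ∑ j ∈ insert i t, a j * l * b j = 0 := by
      simpa [Finset.mul_sum, mul_assoc, ha] using congrArg ((c i)⁻¹ * ·) (hc l hl)
    have hcomm (m : D) (hm : m ∈ L) : ∀ j ∈ t, a j * m - m * a j = 0 := by
      refine ih _ fun l hl ↦ ?_
      have h1 := hac (m * l) (mul_mem hm hl)
      have h2 := congrArg (m * ·) (hac l hl)
      simp only [Finset.sum_insert hi, hai, Finset.mul_sum, mul_add, mul_zero, one_mul] at h1 h2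
      have h3 := congrArg₂ (· - ·) h1 h2
      simpa [sub_mul, Finset.sum_sub_distrib, mul_assoc] using h3
    have hmem : ∀ j ∈ insert i t, a j ∈ L := by
      intro j hj
      rcases Finset.mem_insert.mp hj with rfl | hj
      · rw [hai]; exact one_mem L
      · rw [← hL, Subalgebra.mem_centralizer_iff]
        exact fun m hm ↦ (sub_eq_zero.mp (hcomm m hm j hj)).symm
    have hzero := linearIndependent_iff'.mp hb (insert i t)
      (fun j ↦ if h : j ∈ insert i t then ⟨a j, hmem j h⟩ else 0) (by
        rw [← hac 1 (one_mem L)]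
        refine Finset.sum_congr rfl fun j hj ↦ ?_
        rw [dif_pos hj, mul_one]
        rfl) i (Finset.mem_insert_self i t)
    rw [dif_pos (Finset.mem_insert_self i t)] at hzero
    exact one_ne_zero (hai.symm.trans (congrArg Subtype.val hzero))

/-- A self-centralizing subalgebra `L` of a finite-dimensional division algebra `D` satisfies
`dim D ≤ (dim L)²`. -/
theorem Subalgebra.finrank_le_sq_of_centralizer_eq_self {K D : Type*} [Field K] [DivisionRing D]
    [Algebra K D] [FiniteDimensional K D] (L : Subalgebra K D)
    (hL : Subalgebra.centralizer K (L : Set D) = L) :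
    Module.finrank K D ≤ Module.finrank K L ^ 2 := by
  let _ : DivisionRing L := divisionRingOfFiniteDimensional K L
  have : Module.Finite L D := Module.Finite.of_restrictScalars_finite K L D
  let b := Module.finBasis L D
  have hcard : Module.finrank L D ≤ Module.finrank K L := by
    let f : (Fin (Module.finrank L D) → D) →ₗ[K] L →ₗ[K] D :=
      LinearMap.mk₂ K (fun c l ↦ ∑ j, c j * l * b j)
        (by simp [add_mul, Finset.sum_add_distrib])
        (by simp [Finset.smul_sum])
        (by simp [mul_add, add_mul, Finset.sum_add_distrib])
        (by simp [Finset.smul_sum])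
    have hf : Function.Injective f := by
      rw [← LinearMap.ker_eq_bot, LinearMap.ker_eq_bot']
      intro c hc
      ext j
      exact L.eq_zero_of_forall_sum_mul_mul_eq_zero hL b.linearIndependent Finset.univ c
        (fun l hl ↦ LinearMap.congr_fun hc ⟨l, hl⟩) j (Finset.mem_univ j)
    have h := LinearMap.finrank_le_finrank_of_injective hf
    rw [Module.finrank_linearMap, Module.finrank_pi_fintype] at h
    simp only [Finset.sum_const, Finset.card_univ, Fintype.card_fin, smul_eq_mul] at h
    exact Nat.le_of_mul_le_mul_right h Module.finrank_pos
  rw [← Module.finrank_mul_finrank K L D, sq]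
  exact Nat.mul_le_mul_left _ hcard

/-- If `A` is a finite-dimensional semisimple unital associative algebra over a field `K` in
which every commutative (non-unital) subalgebra has dimension at most `n`, then
`dim A ≤ n²`. -/
theorem dim_le_of_semisimple_associative_algebra
    (K : Type*) [Field K] (A : Type*) [Ring A] [Algebra K A]
    [IsSemisimpleRing A] [FiniteDimensional K A] (n : ℕ)
    (hA : ∀ S : NonUnitalSubalgebra K A, (∀ x ∈ S, ∀ y ∈ S, x * y = y * x) →
      Module.finrank K S ≤ n) :
    Module.finrank K A ≤ n ^ 2 := by
  obtain ⟨r, D, d, _, _, _, _, ⟨e⟩⟩ :=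
    IsSemisimpleRing.exists_algEquiv_pi_matrix_divisionRing_finite K A
  choose L hL using fun i ↦ Subalgebra.exists_centralizer_eq_self K (D i)
  let f : (Π i, Fin (d i) → L i) →ₐ[K] Π i, Matrix (Fin (d i)) (Fin (d i)) (D i) :=
    AlgHom.pi fun i ↦ ((Matrix.diagonalAlgHom K).comp ((L i).val.compLeft (Fin (d i)))).comp
      (Pi.evalAlgHom K _ i)
  let g : (Π i, Fin (d i) → L i) →ₐ[K] A := e.symm.toAlgHom.comp f
  have hf : Function.Injective f := by
    intro v w h
    ext i j
    have h' := congrFun (Matrix.diagonal_injective (congrFun h i)) j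
    exact h'
  have hg : Function.Injective g := e.symm.injective.comp hf
  have hcomm (v w : Π i, Fin (d i) → L i) : v * w = w * v := by
    ext i j
    have h : (v i j : D i) ∈ Subalgebra.centralizer K (L i : Set (D i)) := by
      rw [hL]
      exact (v i j).2
    exact ((Subalgebra.mem_centralizer_iff K).mp h _ (w i j).2).symm
  have hle := hA g.range.toNonUnitalSubalgebra (by
    rintro _ ⟨v, rfl⟩ _ ⟨w, rfl⟩
    simp only [AlgHom.toRingHom_eq_coe, RingHom.coe_coe, ← map_mul, hcomm v w])
  have hrange : Module.finrank K g.range.toNonUnitalSubalgebra =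
      ∑ i, d i * Module.finrank K (L i) := by
    have h := LinearMap.finrank_range_of_inj (f := g.toLinearMap) hg
    simp only [Module.finrank_pi_fintype, Finset.sum_const, Finset.card_univ, Fintype.card_fin,
      smul_eq_mul] at h
    exact h
  calc Module.finrank K A = ∑ i, d i * d i * Module.finrank K (D i) := by
        rw [e.toLinearEquiv.finrank_eq, Module.finrank_pi_fintype]
        simp [Module.finrank_matrix]
    _ ≤ ∑ i, (d i * Module.finrank K (L i)) ^ 2 := by
        refine Finset.sum_le_sum fun i _ ↦ ?_
        rw [mul_pow, ← sq]
        exact Nat.mul_le_mul_left _ ((L i).finrank_le_sq_of_centralizer_eq_self (hL i))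
    _ ≤ (∑ i, d i * Module.finrank K (L i)) ^ 2 :=
        Finset.sum_sq_le_sq_sum_of_nonneg fun _ _ ↦ Nat.zero_le _
    _ ≤ n ^ 2 := Nat.pow_le_pow_left (hrange ▸ hle) 2
end

section
/- Let K be a field whose algebraic closure K̄ is a finite extension of K, with d = [K̄ : K], and let A be a finite-dimensional semisimple unital associative algebra over K. If every commutative (non-unital) subalgebra of A has dimension at most n, then 2 · dim A ≤ max(2d, 9) · n. -/
/-- If `F` is its own centralizer in a division algebra, then vectors that are linearly independent
over `F` give linearly independent maps `b ↦ b * v i` from `F` to `D` over `D`. -/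
theorem Subalgebra.eq_zero_of_sum_mul_mul_eq_zero {K D ι : Type*} [Field K] [DivisionRing D]
    [Algebra K D] (F : Subalgebra K D) (hF : ∀ x : D, (∀ b ∈ F, b * x = x * b) → x ∈ F)
    {v : ι → D} (hv : LinearIndependent F v) (s : Finset ι) :
    ∀ c : ι → D, (∀ b ∈ F, ∑ i ∈ s, c i * (b * v i) = 0) → ∀ i ∈ s, c i = 0 := by
  classical
  induction s using Finset.induction_on with
  | empty => simp
  | insert a s ha ih =>
    intro c hc
    by_cases h0 : c a = 0
    · have := ih c fun b hb ↦ by simpa [Finset.sum_insert ha, h0] using hc b hb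
      simpa [h0] using this
    exfalso
    let e : ι → D := fun i ↦ (c a)⁻¹ * c i
    have hea : e a = 1 := inv_mul_cancel₀ h0
    have he : ∀ b ∈ F, ∑ i ∈ insert a s, e i * (b * v i) = 0 := fun b hb ↦ by
      simp_rw [e, mul_assoc, ← Finset.mul_sum, hc b hb, mul_zero]
    have hcomm : ∀ b ∈ F, ∀ i ∈ s, b * e i - e i * b = 0 := fun b hb ↦ by
      refine ih (fun i ↦ b * e i - e i * b) fun b' hb' ↦ ?_
      have h1 := he (b * b') (F.mul_mem hb hb')
      have h2 := congrArg (b * ·) (he b' hb')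
      simp only [Finset.sum_insert ha, hea, one_mul, mul_zero, mul_add, Finset.mul_sum] at h1 h2
      simp only [sub_mul, Finset.sum_sub_distrib]
      rw [sub_eq_zero]
      rw [← mul_assoc] at h2
      simp only [mul_assoc] at h1 h2 ⊢
      exact add_left_cancel (h2.trans h1.symm)
    have hmem : ∀ i ∈ insert a s, e i ∈ F := by
      intro i hi
      rcases Finset.mem_insert.1 hi with rfl | hi
      · exact hea ▸ F.one_mem
      · exact hF _ fun b hb ↦ sub_eq_zero.1 (hcomm b hb i hi)
    have h := linearIndependent_iff'.1 hv (insert a s)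
      (fun i ↦ if hi : e i ∈ F then ⟨e i, hi⟩ else 0) (by
        rw [← he 1 F.one_mem]
        refine Finset.sum_congr rfl fun i hi ↦ ?_
        simp [hmem i hi, Subalgebra.smul_def]) a (Finset.mem_insert_self a s)
    rw [dif_pos (hmem a (Finset.mem_insert_self a s))] at h
    exact one_ne_zero (hea.symm.trans (congrArg Subtype.val h))

open Module in
/-- A division algebra has dimension at most the square of the dimension of any subalgebra that
contains its own centralizer. -/
theorem Subalgebra.finrank_le_sq_of_centralizer_le {K D : Type*} [Field K] [DivisionRing D]
    [Algebra K D] [FiniteDimensional K D] (F : Subalgebra K D)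
    (hF : ∀ x : D, (∀ b ∈ F, b * x = x * b) → x ∈ F) :
    finrank K D ≤ finrank K F * finrank K F := by
  let : DivisionRing F := divisionRingOfFiniteDimensional K F
  have : Module.Finite F D := Module.Finite.of_restrictScalars_finite K F D
  let v := finBasis F D
  let b := finBasis K F
  have hli : LinearIndependent D fun (i : Fin (finrank F D)) (j : Fin (finrank K F)) ↦
      (b j : D) * v i := by
    rw [Fintype.linearIndependent_iff]
    intro c hc i
    refine F.eq_zero_of_sum_mul_mul_eq_zero hF v.linearIndependent Finset.univ c
      (fun x hx ↦ ?_) i (Finset.mem_univ i)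
    let φ : F →ₗ[K] D :=
      ∑ i, LinearMap.mulLeft K (c i) ∘ₗ LinearMap.mulRight K (v i) ∘ₗ F.val.toLinearMap
    have hφ : φ = 0 := b.ext fun j ↦ by
      have := congrFun hc j
      simpa [φ] using this
    have := LinearMap.congr_fun hφ ⟨x, hx⟩
    simpa [φ] using this
  have hcard := hli.fintype_card_le_finrank
  simp only [Fintype.card_fin, finrank_fin_fun] at hcard
  rw [← finrank_mul_finrank K F D]
  exact Nat.mul_le_mul_left _ hcard

/-- A finite-dimensional algebra has a commutative subalgebra containing its own centralizer. -/
theorem Subalgebra.exists_commutative_centralizer_le (K D : Type*) [Field K] [Ring D]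
    [Algebra K D] [FiniteDimensional K D] :
    ∃ F : Subalgebra K D, (∀ x ∈ F, ∀ y ∈ F, x * y = y * x) ∧
      ∀ x : D, (∀ b ∈ F, b * x = x * b) → x ∈ F := by
  have : WellFoundedGT (Subalgebra K D) :=
    StrictMono.wellFoundedGT (f := Subalgebra.toSubmodule) fun _ _ h ↦ h
  obtain ⟨F, hF⟩ := exists_maximal_of_wellFoundedGT
    (fun F : Subalgebra K D ↦ ∀ x ∈ F, ∀ y ∈ F, x * y = y * x)
    ⟨⊥, by
      intro x hx y _
      obtain ⟨r, rfl⟩ := Algebra.mem_bot.1 hx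
      exact Algebra.commutes r y⟩
  refine ⟨F, hF.1, fun x hx ↦ ?_⟩
  have hcomm := Algebra.isMulCommutative_adjoin K (s := insert x (F : Set D)) (by
    rintro y (rfl | hy) z (rfl | hz)
    · rfl
    · exact (hx z hz).symm
    · exact hx y hy
    · exact hF.1 y hy z hz)
  have hle : F ≤ Algebra.adjoin K (insert x (F : Set D)) := fun y hy ↦
    Algebra.subset_adjoin (Set.mem_insert_of_mem x hy)
  exact hF.2 (fun y hy z hz ↦ setLike_mul_comm hy hz) hle
    (Algebra.subset_adjoin (Set.mem_insert x _))

open Module in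
/-- A finite-dimensional commutative domain embeds in the algebraic closure of the base field. -/
theorem finrank_le_finrank_algebraicClosure (K F : Type*) [Field K] [CommRing F] [IsDomain F]
    [Algebra K F] [FiniteDimensional K F] [FiniteDimensional K (AlgebraicClosure K)] :
    finrank K F ≤ finrank K (AlgebraicClosure K) := by
  let : Field F := fieldOfFiniteDimensional K F
  let f : F →ₐ[K] AlgebraicClosure K := IsAlgClosed.lift
  exact LinearMap.finrank_le_finrank_of_injective (f := f.toLinearMap) f.toRingHom.injective

/-- `A` has a commutative non-unital subalgebra of dimension at least `2 * dim A / C`. -/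
def HasLargeCommutativeSubalgebra (K A : Type*) [Field K] [Ring A] [Algebra K A] (C : ℕ) : Prop :=
  ∃ S : NonUnitalSubalgebra K A, (∀ x ∈ S, ∀ y ∈ S, x * y = y * x) ∧
    2 * Module.finrank K A ≤ C * Module.finrank K S

namespace HasLargeCommutativeSubalgebra

open Module

variable {K : Type*} [Field K] {C : ℕ}

theorem mono {A : Type*} [Ring A] [Algebra K A] {C' : ℕ} (hC : C ≤ C')
    (h : HasLargeCommutativeSubalgebra K A C) : HasLargeCommutativeSubalgebra K A C' :=
  let ⟨S, hS, hdim⟩ := h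
  ⟨S, hS, hdim.trans (Nat.mul_le_mul_right _ hC)⟩

theorem of_algEquiv {A B : Type*} [Ring A] [Algebra K A] [Ring B] [Algebra K B] (e : A ≃ₐ[K] B)
    (h : HasLargeCommutativeSubalgebra K A C) : HasLargeCommutativeSubalgebra K B C := by
  obtain ⟨S, hS, hdim⟩ := h
  refine ⟨S.map e, ?_, ?_⟩
  · rintro _ ⟨x, hx, rfl⟩ _ ⟨y, hy, rfl⟩
    exact (map_mul e x y).symm.trans ((congrArg e (hS x hx y hy)).trans (map_mul e y x))
  · have : finrank K (S.map e) = finrank K S :=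
      (e.toLinearEquiv.submoduleMap S.toSubmodule).finrank_eq.symm
    rw [this, ← e.toLinearEquiv.finrank_eq]
    exact hdim

theorem pi {ι : Type*} [Fintype ι] {A : ι → Type*} [∀ i, Ring (A i)] [∀ i, Algebra K (A i)]
    [∀ i, FiniteDimensional K (A i)] (h : ∀ i, HasLargeCommutativeSubalgebra K (A i) C) :
    HasLargeCommutativeSubalgebra K (∀ i, A i) C := by
  choose S hS hdim using h
  let T : NonUnitalSubalgebra K (∀ i, A i) :=
    { carrier := {x | ∀ i, x i ∈ S i}
      add_mem' := fun hx hy i ↦ (S i).add_mem (hx i) (hy i)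
      zero_mem' := fun i ↦ (S i).zero_mem
      mul_mem' := fun hx hy i ↦ (S i).mul_mem (hx i) (hy i)
      smul_mem' := fun c _ hx i ↦ (S i).toSubmodule.smul_mem c (hx i) }
  let e : T ≃ₗ[K] ∀ i, S i :=
    { toFun x i := ⟨x.1 i, x.2 i⟩
      invFun y := ⟨fun i ↦ y i, fun i ↦ (y i).2⟩
      map_add' _ _ := rfl
      map_smul' _ _ := rfl }
  refine ⟨T, fun x hx y hy ↦ funext fun i ↦ hS i _ (hx i) _ (hy i), ?_⟩
  have hfin (i : ι) : FiniteDimensional K (S i) :=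
    inferInstanceAs (FiniteDimensional K (S i).toSubmodule)
  rw [e.finrank_eq, finrank_pi_fintype, finrank_pi_fintype, Finset.mul_sum, Finset.mul_sum]
  exact Finset.sum_le_sum fun i _ ↦ hdim i

theorem of_divisionRing (K D : Type*) [Field K] [FiniteDimensional K (AlgebraicClosure K)]
    [DivisionRing D] [Algebra K D] [FiniteDimensional K D] :
    HasLargeCommutativeSubalgebra K D (2 * finrank K (AlgebraicClosure K)) := by
  obtain ⟨F, hcomm, hF⟩ := Subalgebra.exists_commutative_centralizer_le K D
  refine ⟨F.toNonUnitalSubalgebra, hcomm, ?_⟩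
  let : CommRing F :=
    { (inferInstance : Ring F) with
      mul_comm := fun x y ↦ Subtype.ext (hcomm x x.2 y y.2) }
  rw [mul_assoc]
  exact Nat.mul_le_mul_left 2 <| (F.finrank_le_sq_of_centralizer_le hF).trans <|
    Nat.mul_le_mul_right _ (finrank_le_finrank_algebraicClosure K F)

theorem matrix_sum {α β D : Type*} [Fintype α] [Fintype β] [DecidableEq α] [DecidableEq β]
    [Ring D] [Algebra K D] [FiniteDimensional K D]
    (hC : 2 * (Fintype.card α + Fintype.card β) ^ 2 ≤ C * (Fintype.card α * Fintype.card β)) :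
    HasLargeCommutativeSubalgebra K (Matrix (α ⊕ β) (α ⊕ β) D) C := by
  let φ : Matrix α β D →ₗ[K] Matrix (α ⊕ β) (α ⊕ β) D :=
    { toFun N := Matrix.fromBlocks 0 N 0 0
      map_add' _ _ := by simp [Matrix.fromBlocks_add]
      map_smul' _ _ := by simp [Matrix.fromBlocks_smul] }
  have hmul (M N : Matrix α β D) : φ M * φ N = 0 := by simp [φ, Matrix.fromBlocks_multiply]
  have hφ : Function.Injective φ := fun M N h ↦ by
    simpa [φ, Matrix.fromBlocks_inj] using h
  let T : NonUnitalSubalgebra K (Matrix (α ⊕ β) (α ⊕ β) D) :=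
    { φ.range with
      mul_mem' := by
        rintro _ _ ⟨M, rfl⟩ ⟨N, rfl⟩
        exact ⟨0, by rw [hmul, map_zero]⟩ }
  have hT : finrank K T = Fintype.card α * Fintype.card β * finrank K D :=
    (LinearMap.finrank_range_of_inj hφ).trans (finrank_matrix K D α β)
  refine ⟨T, ?_, ?_⟩
  · rintro _ ⟨M, rfl⟩ _ ⟨N, rfl⟩
    rw [hmul, hmul]
  · rw [hT, finrank_matrix, Fintype.card_sum, ← sq, ← mul_assoc, ← mul_assoc]
    exact Nat.mul_le_mul_right _ hC

theorem matrix_fin {D : Type*} [Ring D] [Algebra K D] [FiniteDimensional K D] {m : ℕ}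
    (hm : m ≠ 1) : HasLargeCommutativeSubalgebra K (Matrix (Fin m) (Fin m) D) 9 := by
  obtain ⟨p, q, rfl, hpq⟩ : ∃ p q : ℕ, p + q = m ∧ 2 * (p + q) ^ 2 ≤ 9 * (p * q) := by
    refine ⟨m / 2, m - m / 2, by omega, ?_⟩
    obtain ⟨p, rfl | rfl⟩ := m.even_or_odd'
    · rw [show 2 * p / 2 = p by omega, show 2 * p - p = p by omega]
      nlinarith
    · rw [show (2 * p + 1) / 2 = p by omega, show 2 * p + 1 - p = p + 1 by omega]
      have : 1 ≤ p := by omega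
      nlinarith
  exact of_algEquiv (Matrix.reindexAlgEquiv K D finSumFinEquiv)
    (matrix_sum (α := Fin p) (β := Fin q) (by simpa using hpq))

end HasLargeCommutativeSubalgebra

/-- Let `K` be a field whose algebraic closure is a finite extension of degree `d`. If `A` is a
finite-dimensional semisimple unital associative algebra over `K` in which every commutative
(non-unital) subalgebra has dimension at most `n`, then `2 · dim A ≤ max(2d, 9) · n`. -/
theorem dim_le_of_semisimple_algebra_of_finite_closure
    (K : Type*) [Field K] [FiniteDimensional K (AlgebraicClosure K)] (d : ℕ)
    (hd : d = Module.finrank K (AlgebraicClosure K))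
    (A : Type*) [Ring A] [Algebra K A] [IsSemisimpleRing A] [FiniteDimensional K A] (n : ℕ)
    (hA : ∀ S : NonUnitalSubalgebra K A, (∀ x ∈ S, ∀ y ∈ S, x * y = y * x) →
      Module.finrank K S ≤ n) :
    2 * Module.finrank K A ≤ max (2 * d) 9 * n := by
  obtain ⟨k, D, m, _, _, _, -, ⟨e⟩⟩ :=
    IsSemisimpleRing.exists_algEquiv_pi_matrix_divisionRing_finite K A
  have h (i : Fin k) :
      HasLargeCommutativeSubalgebra K (Matrix (Fin (m i)) (Fin (m i)) (D i)) (max (2 * d) 9) := by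
    by_cases hm : m i = 1
    · rw [hm, hd]
      have hD := (HasLargeCommutativeSubalgebra.of_divisionRing K (D i)).mono (le_max_left _ 9)
      refine hD.of_algEquiv (AlgEquiv.ofBijective (Matrix.scalarAlgHom (Fin 1) K) ⟨?_, fun M ↦ ?_⟩)
      · exact fun _ _ ↦ Matrix.scalar_inj.1
      · exact ⟨M 0 0, by ext i j; fin_cases i; fin_cases j; simp⟩
    · exact (HasLargeCommutativeSubalgebra.matrix_fin hm).mono (le_max_right _ _)
  obtain ⟨S, hS, hdim⟩ := (HasLargeCommutativeSubalgebra.pi h).of_algEquiv e.symm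
  exact hdim.trans (Nat.mul_le_mul_left _ (hA S hS))
end

section
/- Let K be a field of characteristic 0 and let A be a finite-dimensional associative (possibly non-unital) algebra over K. If every commutative (non-unital) subalgebra of A has dimension at most n, then 2 · dim A ≤ 3n² + n. -/
open Module Polynomial

/-- Adjoining a vector `x` commuting with a commuting subspace gives a commuting subspace. -/
theorem mul_comm_of_mem_sup_span_singleton {K B : Type*} [Field K] [Ring B] [Algebra K B]
    {V : Submodule K B} {x : B} (hV : ∀ y ∈ V, ∀ z ∈ V, y * z = z * y)
    (hx : ∀ y ∈ V, y * x = x * y) :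
    ∀ y ∈ V ⊔ K ∙ x, ∀ z ∈ V ⊔ K ∙ x, y * z = z * y := by
  intro y hy z hz
  obtain ⟨a, ha, _, hs, rfl⟩ := Submodule.mem_sup.mp hy
  obtain ⟨b, hb, _, ht, rfl⟩ := Submodule.mem_sup.mp hz
  obtain ⟨s, rfl⟩ := Submodule.mem_span_singleton.mp hs
  obtain ⟨t, rfl⟩ := Submodule.mem_span_singleton.mp ht
  simp only [mul_add, add_mul, hV a ha b hb, smul_add, mul_smul_comm, smul_mul_assoc, hx a ha,
    hx b hb, smul_smul, mul_comm s t]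
  abel

/-- A division algebra has dimension at most the square of that of a self-centralizing subfield. -/
theorem finrank_le_sq_of_commute_mem_range {K F D : Type*} [Field K] [Field F] [DivisionRing D]
    [Algebra K F] [Algebra K D] [FiniteDimensional K D] (φ : F →ₐ[K] D)
    (hφ : ∀ x : D, (∀ f, x * φ f = φ f * x) → ∃ f, φ f = x) :
    finrank K D ≤ finrank K F ^ 2 := by
  let : Module F D := Module.compHom D (φ : F →+* D)
  have smul_eq (f : F) (x : D) : f • x = φ f * x := rfl
  have : IsScalarTower K F D := ⟨fun k f x => by simp [smul_eq]⟩
  have : FiniteDimensional K F :=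
    FiniteDimensional.of_injective φ.toLinearMap (φ : F →+* D).injective
  have : FiniteDimensional F D := FiniteDimensional.right K F D
  let y := finBasis F D
  have key (m : ℕ) : ∀ g : Fin (finrank F D) → D, {i | g i ≠ 0}.ncard = m →
      (∀ f, ∑ i, g i * φ f * y i = 0) → g = 0 := by
    induction m using Nat.strong_induction_on with
    | _ m ih =>
      intro g hm hg
      by_contra hne
      obtain ⟨j, hj⟩ := Function.ne_iff.mp hne
      have hj : g j ≠ 0 := hj
      let h : Fin (finrank F D) → D := fun i => (g j)⁻¹ * g i
      have hh (f : F) : ∑ i, h i * φ f * y i = 0 := by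
        have := congrArg ((g j)⁻¹ * ·) (hg f)
        simpa [h, Finset.mul_sum, mul_assoc] using this
      have hcomm (b : F) : (fun i => h i * φ b - φ b * h i) = 0 := by
        refine ih _ ?_ _ rfl fun f => ?_
        · rw [← hm]
          refine Set.ncard_lt_ncard ⟨fun i hi hi0 => hi ?_, fun hsub => ?_⟩ (Set.toFinite _)
          · simp [h, hi0]
          · exact hsub hj (by simp [h, hj])
        · have h1 := hh (b * f)
          have h2 := congrArg (φ b * ·) (hh f)
          simp only [Finset.mul_sum, mul_zero] at h2
          rw [← sub_zero (0 : D)]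
          nth_rw 1 [← h1]
          rw [← h2, ← Finset.sum_sub_distrib]
          refine Finset.sum_congr rfl fun i _ => ?_
          rw [map_mul]
          noncomm_ring
      have hmem (i) : ∃ c, φ c = h i :=
        hφ _ fun f => sub_eq_zero.mp (congrFun (hcomm f) i)
      choose c hc using hmem
      have hsum : ∑ i, c i • y i = 0 := by simpa [smul_eq, hc] using hh 1
      have hcj := Fintype.linearIndependent_iff.mp y.linearIndependent c hsum j
      have := hc j
      simp [hcj, h, hj] at this
  let Ψ : (Fin (finrank F D) → D) →ₗ[K] (F →ₗ[K] D) :=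
    { toFun := fun g =>
        { toFun := fun f => ∑ i, g i * φ f * y i
          map_add' := fun a b => by simp [mul_add, add_mul, Finset.sum_add_distrib]
          map_smul' := fun a b => by simp [Finset.smul_sum] }
      map_add' := fun a b => by ext; simp [add_mul, Finset.sum_add_distrib]
      map_smul' := fun a b => by ext; simp [Finset.smul_sum] }
  have hinj : Function.Injective Ψ := by
    rw [injective_iff_map_eq_zero]
    exact fun g hg => key _ g rfl fun f => LinearMap.congr_fun hg f
  have hle := LinearMap.finrank_le_finrank_of_injective hinj
  rw [finrank_linearMap, finrank_pi_fintype, Finset.sum_const, Finset.card_univ, Fintype.card_fin,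
    smul_eq_mul] at hle
  have hs := Nat.le_of_mul_le_mul_right hle finrank_pos
  rw [← finrank_mul_finrank K F D, sq]
  exact Nat.mul_le_mul_left _ hs

/-- In characteristic zero, a division algebra `D` contains elements of a fixed degree `f` with
`dim D ≤ f ^ 2`, with infinitely many minimal polynomials. -/
theorem exists_infinite_minpoly_of_divisionRing (K D : Type*) [Field K] [CharZero K]
    [DivisionRing D] [Algebra K D] [FiniteDimensional K D] :
    ∃ f : ℕ, finrank K D ≤ f ^ 2 ∧
      {p : K[X] | p.natDegree = f ∧ ∃ x : D, minpoly K x = p}.Infinite := by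
  obtain ⟨V, hV⟩ := exists_maximal_of_wellFoundedGT
    (fun V : Submodule K D => ∀ x ∈ V, ∀ y ∈ V, x * y = y * x) ⟨⊥, by simp⟩
  have hmem (x : D) (hx : ∀ y ∈ V, x * y = y * x) : x ∈ V := by
    exact hV.2 (y := V ⊔ K ∙ x)
      (mul_comm_of_mem_sup_span_singleton hV.1 fun y hy => (hx y hy).symm) le_sup_left
      (Submodule.mem_sup_right (Submodule.mem_span_singleton_self x))
  let F : Subalgebra K D := Subalgebra.centralizer K (V : Set D)
  have hFV (x : D) : x ∈ F ↔ x ∈ V :=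
    ⟨fun hx => hmem x fun y hy => ((Subalgebra.mem_centralizer_iff K).mp hx y hy).symm,
      fun hx => (Subalgebra.mem_centralizer_iff K).mpr fun y hy => hV.1 y hy x hx⟩
  let : CommRing F := { (inferInstance : Ring F) with
    mul_comm := fun a b => Subtype.ext (hV.1 _ ((hFV _).mp a.2) _ ((hFV _).mp b.2)) }
  let : Field F := fieldOfFiniteDimensional K F
  have hle : finrank K D ≤ finrank K F ^ 2 := by
    refine finrank_le_sq_of_commute_mem_range F.val fun x hx => ?_
    exact ⟨⟨x, (hFV x).mpr (hmem x fun y hy => hx ⟨y, (hFV y).mpr hy⟩)⟩, rfl⟩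
  refine ⟨finrank K F, hle, ?_⟩
  obtain ⟨α, hα⟩ := Field.exists_primitive_element K F
  have hdeg : (minpoly K α).natDegree = finrank K F := by
    rw [← IntermediateField.adjoin.finrank (Algebra.IsIntegral.isIntegral α), hα,
      IntermediateField.finrank_top']
  have hsub : Set.range (fun c : K => minpoly K (α + algebraMap K F c)) ⊆
      {p : K[X] | p.natDegree = finrank K F ∧ ∃ x : D, minpoly K x = p} := by
    rintro _ ⟨c, rfl⟩
    refine ⟨?_, _, minpoly.algHom_eq F.val Subtype.val_injective _⟩
    beta_reduce
    rw [minpoly.add_algebraMap, natDegree_comp, natDegree_X_sub_C, mul_one, hdeg]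
  refine Set.Infinite.mono hsub fun hfin => ?_
  refine Set.infinite_univ (α := K) (Set.Finite.of_finite_fibers
    (f := fun c : K => minpoly K (α + algebraMap K F c)) (by simpa using hfin) ?_)
  rintro p ⟨c, -, rfl⟩
  refine Set.Finite.subset ((rootSet_finite (minpoly K (α + algebraMap K F c)) F).preimage
    (f := fun c : K => α + algebraMap K F c) fun a _ b _ h => ?_) ?_
  · exact (algebraMap K F).injective (add_left_cancel h)
  · rintro d ⟨-, hd⟩
    simp only [Set.mem_preimage, Set.mem_singleton_iff] at hd
    rw [Set.mem_preimage, mem_rootSet]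
    refine ⟨minpoly.ne_zero (Algebra.IsIntegral.isIntegral _), ?_⟩
    rw [← hd]
    exact minpoly.aeval _ _

/-- A finite family of infinite sets has an injective system of representatives. -/
theorem exists_injective_of_infinite {ι α : Type*} [Finite ι] (S : ι → Set α)
    (hS : ∀ i, (S i).Infinite) : ∃ p : ι → α, Function.Injective p ∧ ∀ i, p i ∈ S i := by
  classical
  have := Fintype.ofFinite ι
  have (i : ι) : ∃ T : Finset α, (T : Set α) ⊆ S i ∧ T.card = Fintype.card ι :=
    (hS i).exists_subset_card_eq _
  choose T hT hTc using this
  obtain ⟨p, hp, hpT⟩ := (Finset.all_card_le_biUnion_card_iff_exists_injective T).mp fun s => by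
    obtain rfl | ⟨i, hi⟩ := s.eq_empty_or_nonempty
    · simp
    · exact (Finset.card_le_univ s).trans
        ((hTc i).symm.le.trans (Finset.card_le_card (Finset.subset_biUnion_of_mem T hi)))
  exact ⟨p, hp, fun i => hT i (hpT i)⟩

/-- A finite-dimensional semisimple algebra `S` over a field of characteristic zero with an
augmentation contains an element `θ` with `dim S - 1 ≤ (deg θ - 1) ^ 2`. -/
theorem exists_finrank_le_of_isSemisimpleRing {K S : Type*} [Field K] [CharZero K] [Ring S]
    [Algebra K S] [FiniteDimensional K S] [IsSemisimpleRing S] (φ : S →ₐ[K] K) :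
    ∃ θ : S, finrank K S ≤ ((minpoly K θ).natDegree - 1) ^ 2 + 1 := by
  obtain ⟨m, D, k, _, _, _, hk, ⟨e⟩⟩ :=
    IsSemisimpleRing.exists_algEquiv_pi_matrix_divisionRing_finite K S
  choose f hf hinf using fun i => exists_infinite_minpoly_of_divisionRing K (D i)
  obtain ⟨p, hp, hpm⟩ := exists_injective_of_infinite
    (fun s : Σ i, Fin (k i) => {p : K[X] | p.natDegree = f s.1 ∧ ∃ x : D s.1, minpoly K x = p})
    fun s => hinf s.1
  choose hdeg x hx using hpm
  have hf0 (i) : f i ≠ 0 := fun h => by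
    have := hf i
    rw [h] at this
    have := finrank_pos (R := K) (M := D i)
    omega
  let z (i : Fin m) (j : Fin (k i)) : D i := x ⟨i, j⟩
  let θ : (i : Fin m) → Matrix (Fin (k i)) (Fin (k i)) (D i) :=
    fun i => Matrix.diagonalAlgHom K (z i)
  have hdvd (s) : p s ∣ minpoly K θ := by
    rw [← hx]
    refine minpoly.dvd _ _ ?_
    have h1 : Pi.evalAlgHom K _ s.1 (aeval θ (minpoly K θ)) = 0 := by rw [minpoly.aeval, map_zero]
    rw [← aeval_algHom_apply] at h1
    change aeval (Matrix.diagonalAlgHom K (z s.1)) (minpoly K θ) = 0 at h1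
    rw [aeval_algHom_apply] at h1
    have h2 := Matrix.diagonal_injective (h1.trans (Matrix.diagonal_zero).symm)
    have h3 : Pi.evalAlgHom K _ s.2 (aeval (z s.1) (minpoly K θ)) = 0 := by
      rw [h2]; rfl
    rwa [← aeval_algHom_apply] at h3
  have hprod : ∏ s, p s ∣ minpoly K θ := by
    refine Finset.prod_dvd_of_coprime (fun s _ t _ hst => ?_) fun s _ => hdvd s
    have hirr (s) : Irreducible (p s) :=
      hx s ▸ minpoly.irreducible (Algebra.IsIntegral.isIntegral _)
    have hmon (s) : (p s).Monic := hx s ▸ minpoly.monic (Algebra.IsIntegral.isIntegral _)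
    refine (hirr s).coprime_iff_not_dvd.mpr fun h => hst (hp ?_)
    exact eq_of_monic_of_associated (hmon s) (hmon t) ((hirr s).associated_of_dvd (hirr t) h)
  have hsum : ∑ i, k i * f i ≤ (minpoly K θ).natDegree := by
    refine le_trans (le_of_eq ?_) (natDegree_le_of_dvd hprod
      (minpoly.ne_zero (Algebra.IsIntegral.isIntegral _)))
    rw [natDegree_prod _ _ fun s _ =>
      hx s ▸ minpoly.ne_zero (Algebra.IsIntegral.isIntegral _), Fintype.sum_sigma]
    simp [hdeg]
  have hrank (i) : finrank K (Matrix (Fin (k i)) (Fin (k i)) (D i)) ≤ (k i * f i) ^ 2 := by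
    rw [finrank_matrix, Fintype.card_fin, mul_pow, sq (k i)]
    exact Nat.mul_le_mul_left _ (hf i)
  -- One of the blocks is a copy of `K`, namely the one on which the augmentation is nonzero.
  let ψ := φ.comp e.symm.toAlgHom
  obtain ⟨i₀, hi₀⟩ : ∃ i, ψ (Pi.single i 1) ≠ 0 := by
    by_contra! h
    have h1 := map_sum ψ (fun i => Pi.single i 1) Finset.univ
    rw [Finset.sum_congr rfl fun i _ => h i, Finset.sum_const_zero] at h1
    have h2 : ∑ i, Pi.single i 1 = (1 : (i : Fin m) → Matrix (Fin (k i)) (Fin (k i)) (D i)) :=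
      Finset.univ_sum_single 1
    rw [h2, map_one] at h1
    exact one_ne_zero h1
  have hone : ψ (Pi.single i₀ 1) = 1 := by
    have h : ψ (Pi.single i₀ 1) * ψ (Pi.single i₀ 1) = ψ (Pi.single i₀ 1) := by
      rw [← map_mul, ← Pi.single_mul, one_mul]
    exact mul_right_cancel₀ hi₀ (h.trans (one_mul _).symm)
  let χ : Matrix (Fin (k i₀)) (Fin (k i₀)) (D i₀) →+* K :=
    { toFun := fun a => ψ (Pi.single i₀ a)
      map_one' := hone
      map_mul' := fun a b => by rw [Pi.single_mul, map_mul]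
      map_zero' := by rw [Pi.single_zero, map_zero]
      map_add' := fun a b => by rw [Pi.single_add, map_add] }
  have hblock : finrank K (Matrix (Fin (k i₀)) (Fin (k i₀)) (D i₀)) ≤ 1 := by
    rw [← finrank_self K]
    refine LinearMap.finrank_le_finrank_of_injective
      (f := ψ.toLinearMap ∘ₗ
        LinearMap.single K (fun i => Matrix (Fin (k i)) (Fin (k i)) (D i)) i₀) ?_
    exact χ.injective
  refine ⟨e.symm θ, ?_⟩
  have hminpoly : minpoly K (e.symm θ) = minpoly K θ :=
    minpoly.algHom_eq e.symm.toAlgHom e.symm.injective θ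
  rw [hminpoly, e.toLinearEquiv.finrank_eq, finrank_pi_fintype,
    ← Finset.sum_erase_add _ _ (Finset.mem_univ i₀)]
  refine add_le_add ?_ hblock
  calc ∑ i ∈ Finset.univ.erase i₀, finrank K (Matrix (Fin (k i)) (Fin (k i)) (D i))
      ≤ ∑ i ∈ Finset.univ.erase i₀, (k i * f i) ^ 2 := Finset.sum_le_sum fun i _ => hrank i
    _ ≤ (∑ i ∈ Finset.univ.erase i₀, k i * f i) ^ 2 :=
      Finset.sum_sq_le_sq_sum_of_nonneg fun _ _ => Nat.zero_le _
    _ ≤ _ := by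
      refine Nat.pow_le_pow_left ?_ 2
      rw [← Finset.sum_erase_add _ _ (Finset.mem_univ i₀)] at hsum
      have : 0 < k i₀ * f i₀ :=
        Nat.mul_pos (Nat.pos_of_ne_zero (NeZero.ne _)) (Nat.pos_of_ne_zero (hf0 _))
      omega

/-- If every commuting subspace of a nilpotent ideal `J` has dimension at most `n`, then
`dim J ≤ n (n + 1) / 2`. -/
theorem two_mul_finrank_le_of_isNilpotent {K B : Type*} [Field K] [Ring B] [Algebra K B]
    [FiniteDimensional K B] (J : Ideal B) [J.IsTwoSided] (hJ : IsNilpotent J) (n : ℕ)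
    (hn : ∀ V : Submodule K B, V ≤ J.restrictScalars K → (∀ x ∈ V, ∀ y ∈ V, x * y = y * x) →
      finrank K V ≤ n) :
    2 * finrank K (J.restrictScalars K) ≤ n ^ 2 + n := by
  obtain ⟨k, hk⟩ := hJ
  let P (V : Submodule K B) : Prop := V ≤ J.restrictScalars K ∧
    (∀ x ∈ V, ∀ y ∈ V, x * y = y * x) ∧ (∀ x ∈ J, ∀ y ∈ V, x * y - y * x ∈ V) ∧
    2 * finrank K (J.restrictScalars K) + finrank K V ≤ finrank K V ^ 2 + 2 * finrank K
      (J.restrictScalars K ⊓ (Subalgebra.centralizer K (V : Set B)).toSubmodule : Submodule K B)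
  have hcent (V : Submodule K B) (x : B) :
      x ∈ (J.restrictScalars K ⊓ (Subalgebra.centralizer K (V : Set B)).toSubmodule) ↔
        x ∈ J ∧ ∀ y ∈ V, y * x = x * y := by
    simp [Subalgebra.mem_centralizer_iff]
  obtain ⟨V, hV⟩ := exists_maximal_of_wellFoundedGT P ⟨⊥, by
    refine ⟨bot_le, by simp, by simp, ?_⟩
    have : (J.restrictScalars K ⊓
        (Subalgebra.centralizer K ((⊥ : Submodule K B) : Set B)).toSubmodule) =
        J.restrictScalars K := by
      ext x; rw [hcent]; simp only [Submodule.mem_bot, forall_eq, zero_mul, mul_zero, and_true]; rfl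
    rw [this]; simp⟩
  obtain ⟨⟨hVJ, hVc, hVi, hVd⟩, hmax⟩ := hV
  set C := J.restrictScalars K ⊓ (Subalgebra.centralizer K (V : Set B)).toSubmodule
  have hCV : C ≤ V := by
    by_contra hnot
    let S (m : ℕ) : Prop := ∃ x ∈ C, x ∉ V ∧ x ∈ J ^ m
    obtain ⟨x₀, hx₀, hx₀V⟩ := SetLike.not_le_iff_exists.mp hnot
    have hS0 : S 0 := ⟨x₀, hx₀, hx₀V, by simp [Submodule.pow_zero, Ideal.one_eq_top]⟩
    have hSk : ¬ S k := by
      rintro ⟨x, -, hxV, hx⟩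
      rw [hk] at hx
      exact hxV ((show x = 0 from hx) ▸ V.zero_mem)
    obtain ⟨m, ⟨x, hxC, hxV, hxm⟩, hm⟩ : ∃ m, S m ∧ ¬ S (m + 1) := by
      by_contra! h
      exact hSk (Nat.rec hS0 h k)
    obtain ⟨hxJ, hxc⟩ := (hcent V x).mp hxC
    have hxi (z : B) (hz : z ∈ J) : z * x - x * z ∈ V := by
      by_contra hzV
      refine hm ⟨_, (hcent V _).mpr ⟨?_, fun y hy => ?_⟩, hzV, ?_⟩
      · exact J.sub_mem (J.mul_mem_left _ hxJ) (J.mul_mem_right _ hxJ)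
      · have h1 := hxc _ (hVi z hz y hy)
        have h2 := hxc y hy
        have h3 : y * (z * x - x * z) - (z * x - x * z) * y =
            - ((z * y - y * z) * x - x * (z * y - y * z)) + z * (y * x - x * y)
              - (y * x - x * y) * z := by
          noncomm_ring
        rw [← sub_eq_zero, h3, h1, h2]
        simp
      · refine Ideal.sub_mem _ ?_ ?_
        · rw [Ideal.IsTwoSided.pow_succ]
          exact Ideal.mul_mem_mul hz hxm
        · rw [Submodule.pow_succ]
          exact Ideal.mul_mem_mul hxm hz
    refine hxV (hmax (y := V ⊔ K ∙ x) ⟨?_, ?_, ?_, ?_⟩ le_sup_left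
      (Submodule.mem_sup_right (Submodule.mem_span_singleton_self x)))
    · exact sup_le hVJ ((Submodule.span_singleton_le_iff_mem _ _).mpr hxJ)
    · exact mul_comm_of_mem_sup_span_singleton hVc hxc
    · intro z hz a ha
      obtain ⟨a, haV, _, hs, rfl⟩ := Submodule.mem_sup.mp ha
      obtain ⟨s, rfl⟩ := Submodule.mem_span_singleton.mp hs
      refine Submodule.mem_sup_left ?_
      have : z * (a + s • x) - (a + s • x) * z = (z * a - a * z) + s • (z * x - x * z) := by
        simp only [mul_add, add_mul, mul_smul_comm, smul_mul_assoc, smul_sub]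
        abel
      rw [this]
      exact V.add_mem (hVi z hz a haV) (V.smul_mem _ (hxi z hz))
    · have hfr : finrank K (V ⊔ K ∙ x : Submodule K B) = finrank K V + 1 := by
        have hx0 : x ≠ 0 := fun h => hxV (h ▸ V.zero_mem)
        have h := Submodule.finrank_sup_add_finrank_inf_eq V (K ∙ x)
        have hd : V ⊓ K ∙ x = ⊥ :=
          (((Submodule.disjoint_span_singleton' hx0).mpr hxV)).eq_bot
        rw [hd, finrank_bot, finrank_span_singleton hx0] at h
        exact h
      let ad : C →ₗ[K] V :=
        { toFun := fun z => ⟨z.1 * x - x * z.1, hxi _ ((hcent V _).mp z.2).1⟩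
          map_add' := fun a b => by
            ext; simp only [Submodule.coe_add, mul_add, add_mul]; abel
          map_smul' := fun a b => by
            ext; simp [smul_sub] }
      have h1 := LinearMap.finrank_range_add_finrank_ker ad
      have h2 := Submodule.finrank_le (LinearMap.range ad)
      have h3 : finrank K (LinearMap.ker ad) ≤ finrank K (J.restrictScalars K ⊓
          (Subalgebra.centralizer K ((V ⊔ K ∙ x : Submodule K B) : Set B)).toSubmodule :
            Submodule K B) := by
        rw [← Submodule.finrank_map_subtype_eq C]
        refine Submodule.finrank_mono ?_
        rintro _ ⟨z, hz, rfl⟩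
        obtain ⟨hzJ, hzc⟩ := (hcent V _).mp z.2
        refine (hcent _ _).mpr ⟨hzJ, fun a ha => ?_⟩
        obtain ⟨a, haV, _, hs, rfl⟩ := Submodule.mem_sup.mp ha
        obtain ⟨s, rfl⟩ := Submodule.mem_span_singleton.mp hs
        have hzx : (z : B) * x = x * z := sub_eq_zero.mp (congrArg Subtype.val hz)
        simp [add_mul, mul_add, hzc a haV, hzx]
      rw [hfr]
      nlinarith
  have h1 := Submodule.finrank_mono hCV
  have h2 := hn V hVJ hVc
  nlinarith

/-- The bound for an algebra with an augmentation, in terms of commuting subspaces of the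
augmentation ideal. -/
theorem two_mul_finrank_le_of_augmentation {K B : Type*} [Field K] [CharZero K] [Ring B]
    [Algebra K B] [FiniteDimensional K B] (φ : B →ₐ[K] K) (n : ℕ)
    (hn : ∀ V : Submodule K B, (∀ x ∈ V, φ x = 0) → (∀ x ∈ V, ∀ y ∈ V, x * y = y * x) →
      finrank K V ≤ n) :
    2 * finrank K B ≤ 3 * n ^ 2 + n + 2 := by
  have : IsArtinianRing B := IsArtinianRing.of_finite K B
  set J := Ring.jacobson B
  have hJ : IsNilpotent J := IsSemiprimaryRing.isNilpotent
  have hφJ (x : B) (hx : x ∈ J) : φ x = 0 := by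
    obtain ⟨k, hk⟩ := hJ
    have hpow (m : ℕ) : x ^ m ∈ J ^ m := by
      induction m with
      | zero => simp [Submodule.pow_zero, Ideal.one_eq_top]
      | succ m ih =>
        rw [pow_succ, Submodule.pow_succ]
        exact Ideal.mul_mem_mul ih hx
    have hxk : x ^ k = 0 := by
      have := hpow k
      rwa [hk] at this
    exact eq_zero_of_pow_eq_zero (n := k) (by rw [← map_pow, hxk, map_zero])
  have hrad := two_mul_finrank_le_of_isNilpotent (K := K) J hJ n fun V hV =>
    hn V fun x hx => hφJ x (hV hx)
  let π : B →ₐ[K] B ⧸ J := Ideal.Quotient.mkₐ K J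
  have : FiniteDimensional K (B ⧸ J) :=
    FiniteDimensional.of_surjective π.toLinearMap Ideal.Quotient.mk_surjective
  obtain ⟨θ, hθ⟩ := exists_finrank_le_of_isSemisimpleRing (Ideal.Quotient.liftₐ J φ hφJ)
  obtain ⟨b, hb⟩ : ∃ b, π b = θ := Ideal.Quotient.mk_surjective θ
  have hquot : (minpoly K θ).natDegree - 1 ≤ n := by
    let a := b - algebraMap K B (φ b)
    have hφa : φ a = 0 := by simp [a]
    let v : Fin ((minpoly K θ).natDegree - 1) → B := fun i => a ^ ((i : ℕ) + 1)
    have hdeg : (minpoly K θ).natDegree ≤ (minpoly K a).natDegree := by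
      have hmonic := (minpoly.monic (Algebra.IsIntegral.isIntegral (R := K) a)).comp_X_sub_C (φ b)
      have hroot : aeval θ ((minpoly K a).comp (X - C (φ b))) = 0 := by
        have hπ : θ - algebraMap K (B ⧸ J) (φ b) = π a := by simp [a, hb]
        rw [aeval_comp, map_sub, aeval_X, aeval_C, hπ, aeval_algHom_apply, minpoly.aeval, map_zero]
      refine (natDegree_le_of_dvd (minpoly.dvd K θ hroot) hmonic.ne_zero).trans ?_
      rw [natDegree_comp, natDegree_X_sub_C, mul_one]
    have hv : LinearIndependent K v :=
      (linearIndependent_pow (K := K) a).comp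
        (fun i : Fin ((minpoly K θ).natDegree - 1) => ⟨i + 1, by omega⟩) fun i j h => by
          simpa [Fin.ext_iff] using h
    rw [← Fintype.card_fin ((minpoly K θ).natDegree - 1), ← finrank_span_eq_card hv]
    refine hn _ (fun x hx => ?_) ?_
    · have hle : Submodule.span K (Set.range v) ≤ LinearMap.ker φ.toLinearMap := by
        rw [Submodule.span_le]
        rintro _ ⟨i, rfl⟩
        simp [v, hφa]
      exact hle hx
    · have hle : Submodule.span K (Set.range v) ≤ (Algebra.adjoin K {a}).toSubmodule := by
        rw [Submodule.span_le]
        rintro _ ⟨i, rfl⟩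
        exact pow_mem (Algebra.self_mem_adjoin_singleton K a) _
      exact fun x hx y hy => setLike_mul_comm (S := Subalgebra K B) (hle hx) (hle hy)
  have hdim : finrank K (B ⧸ J) + finrank K (J.restrictScalars K) = finrank K B :=
    Submodule.finrank_quotient_add_finrank (J.restrictScalars K)
  have := Nat.pow_le_pow_left hquot 2
  omega

/-- If `A` is a finite-dimensional associative (possibly non-unital) algebra over a field `K`
of characteristic `0` in which every commutative (non-unital) subalgebra has dimension at most
`n`, then `2 · dim A ≤ 3n² + n`. -/
theorem dim_le_of_associative_algebra_char_zero
    (K : Type*) [Field K] [CharZero K] (A : Type*) [NonUnitalRing A] [Module K A]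
    [SMulCommClass K A A] [IsScalarTower K A A] [FiniteDimensional K A] (n : ℕ)
    (hA : ∀ S : NonUnitalSubalgebra K A, (∀ x ∈ S, ∀ y ∈ S, x * y = y * x) →
      Module.finrank K S ≤ n) :
    2 * Module.finrank K A ≤ 3 * n ^ 2 + n := by
  let ε : Unitization K A ≃ₗ[K] K × A :=
    { Unitization.equiv with
      map_add' := Unitization.toProd_add
      map_smul' := Unitization.toProd_smul }
  have : FiniteDimensional K (Unitization K A) := ε.symm.finiteDimensional
  have hdim : finrank K (Unitization K A) = finrank K A + 1 := by
    rw [ε.finrank_eq, finrank_prod, finrank_self, add_comm]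
  have := two_mul_finrank_le_of_augmentation (Unitization.fstHom K A) n fun V hV hVc => by
    let W : Submodule K A := V.comap (Unitization.inrHom K K A)
    have hW : V = W.map (Unitization.inrHom K K A) := by
      refine (Submodule.map_comap_eq_of_le fun x hx => ⟨x.snd, ?_⟩).symm
      exact Unitization.ext (hV x hx).symm rfl
    have hWc : ∀ x ∈ W, ∀ y ∈ W, x * y = y * x := fun x hx y hy =>
      Unitization.inr_injective (R := K) (by simpa using hVc _ hx _ hy)
    have hle : W ≤ (NonUnitalAlgebra.adjoin K (W : Set A)).toSubmodule :=
      NonUnitalAlgebra.subset_adjoin K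
    have hcomm := NonUnitalAlgebra.isMulCommutative_adjoin K hWc
    rw [hW]
    refine (Submodule.finrank_map_le _ _).trans ((Submodule.finrank_mono hle).trans (hA _ ?_))
    exact fun x hx y hy => setLike_mul_comm hx hy
  omega
end
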